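/- Assume K > R(R+1)(d−1) and let δ satisfy 0 < δ < (K − R(R+1)(d−1))/(K + R(R+1)(d−1)). Then there is a constant c depending only on n, R, d and δ (not on C, C̃, ν or P) such that for all ν ∈ ℤ^R and all P ≥ 2: |M(P, ν) − P^{n−Rd} 𝔖(ν) J(P^{−d} ν)| ≤ c · C C̃^{K/(d−1)+R²−1} P^{n−Rd−δ}. -/

import Mathlib

open MeasureTheory Filter MvPolynomial

noncomputable section

/-- `e t = exp (2 π i t)` -/
def eC (t : ℝ) : ℂ := Complex.exp (2 * (Real.pi : ℂ) * Complex.I * (t : ℂ))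

abbrev Qbar : Type := AlgebraicClosure ℚ

/-- Dimension of the affine singular locus of `g` (the common zero set of the partial
derivatives of `g`), as the Krull dimension of its coordinate ring. -/
def singDim (n : ℕ) (g : MvPolynomial (Fin n) Qbar) : WithBot ℕ∞ :=
  ringKrullDim (MvPolynomial (Fin n) Qbar ⧸
    Ideal.span (Set.range fun j : Fin n => MvPolynomial.pderiv j g))

/-- `Δ = max_{b ∈ ℤ^R \ {0}} dim Sing(b₁ g₁ + ⋯ + b_R g_R)`. -/
def birchDelta (n R : ℕ) (g : Fin R → MvPolynomial (Fin n) ℤ) : WithBot ℕ∞ :=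
  ⨆ (b : Fin R → ℤ) (_ : b ≠ 0),
    singDim n (MvPolynomial.map (Int.castRingHom Qbar) (∑ i, b i • g i))

/-- `K = (n - Δ)/2^(d-1)` where `Δ = max_{b ≠ 0} dim Sing(f̃_b)`. -/
def KofDelta (n R d : ℕ) (g : Fin R → MvPolynomial (Fin n) ℤ) (K : ℝ) : Prop :=
  ∃ Δ : ℕ, ((Δ : ℕ∞) : WithBot ℕ∞) = birchDelta n R g ∧
    K = ((n : ℝ) - (Δ : ℝ)) / 2 ^ (d - 1)

/-- The quantity `R(R+1)(d-1)` as a real number. -/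
def BB (R d : ℕ) : ℝ := (R : ℝ) * ((R : ℝ) + 1) * ((d : ℝ) - 1)

/-- The `R × R` minor of the Jacobian matrix of `f` with columns given by the elements
of `I`. -/
def jacMinor {n R : ℕ} (f : Fin R → MvPolynomial (Fin n) ℤ)
    (I : Finset (Fin n)) (hI : I.card = R) : MvPolynomial (Fin n) ℤ :=
  Matrix.det (Matrix.of fun i k : Fin R => MvPolynomial.pderiv (I.orderEmbOfFin hI k) (f i))

/-- `Cv` is the maximum of the absolute values of the coefficients of the `f i`. -/
def coeffMax {n R : ℕ} (f : Fin R → MvPolynomial (Fin n) ℤ) (Cv : ℝ) : Prop :=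
  IsGreatest {x : ℝ | ∃ (i : Fin R) (m : (Fin n) →₀ ℕ), x = |((MvPolynomial.coeff m (f i) : ℤ) : ℝ)|} Cv

/-- The integer points of the dilated box `P𝓑`. -/
def boxPts {n : ℕ} (aB bB : Fin n → ℝ) (P : ℝ) : Finset (Fin n → ℤ) :=
  Finset.Icc (fun j => ⌈P * aB j⌉) (fun j => ⌊P * bB j⌋)

/-- The exponential sum `S(α) = ∑_{x ∈ P𝓑 ∩ ℤ^n} e(α · f(x))`. -/
def Sexp {n R : ℕ} (f : Fin R → MvPolynomial (Fin n) ℤ) (aB bB : Fin n → ℝ) (P : ℝ)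
    (α : Fin R → ℝ) : ℂ :=
  ∑ x ∈ boxPts aB bB P, eC (∑ i, α i * (MvPolynomial.eval x (f i) : ℝ))

/-- The complete exponential sum `S_{a,q} = ∑_{x mod q} e(a · f(x)/q)`. -/
def Sgauss {n R : ℕ} (f : Fin R → MvPolynomial (Fin n) ℤ) (q : ℕ) (a : Fin R → ℤ) : ℂ :=
  ∑ x : Fin n → Fin q,
    eC ((∑ i, (a i : ℝ) * (MvPolynomial.eval (fun j => ((x j : ℕ) : ℤ)) (f i) : ℝ)) / q)

/-- `S_{a,q}(ν) = S_{a,q} e(-a·ν/q)`. -/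
def SgaussNu {n R : ℕ} (f : Fin R → MvPolynomial (Fin n) ℤ) (q : ℕ) (a : Fin R → ℤ)
    (ν : Fin R → ℤ) : ℂ :=
  Sgauss f q a * eC (-(∑ i, (a i : ℝ) * (ν i : ℝ)) / q)

/-- Residues `1 ≤ aᵢ ≤ q` (coded by `Fin q`, shifted by one) with `gcd(a₁, …, a_R, s) = 1`. -/
def resSet (R q s : ℕ) : Finset (Fin R → Fin q) :=
  Finset.univ.filter fun a => Nat.gcd (Finset.univ.gcd fun i => (a i : ℕ) + 1) s = 1

/-- The singular series `𝔖(ν)`. -/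
def singularSeries {n R : ℕ} (f : Fin R → MvPolynomial (Fin n) ℤ) (ν : Fin R → ℤ) : ℂ :=
  ∑' q : ℕ, ((q : ℂ) ^ n)⁻¹ *
    ∑ a ∈ resSet R q q, SgaussNu f q (fun i => ((a i : ℕ) : ℤ) + 1) ν

/-- The local density `𝔖_p(ν)`. -/
def localDensity {n R : ℕ} (f : Fin R → MvPolynomial (Fin n) ℤ) (ν : Fin R → ℤ) (p : ℕ) : ℂ :=
  ∑' r : ℕ, ((p : ℂ) ^ (r * n))⁻¹ *
    ∑ a ∈ resSet R (p ^ r) p, SgaussNu f (p ^ r) (fun i => ((a i : ℕ) : ℤ) + 1) ν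

/-- The box `𝓑 = ∏ⱼ [aⱼ, bⱼ]` as a subset of `ℝ^n`. -/
def boxSet {n : ℕ} (aB bB : Fin n → ℝ) : Set (Fin n → ℝ) :=
  Set.univ.pi fun j => Set.Icc (aB j) (bB j)

/-- The oscillatory integral `I(𝓒, γ) = ∫_{ζ ∈ 𝓒} e(γ · g(ζ)) dζ`. -/
def Iosc {n R : ℕ} (g : Fin R → MvPolynomial (Fin n) ℤ) (C : Set (Fin n → ℝ))
    (γ : Fin R → ℝ) : ℂ :=
  ∫ ζ in C, eC (∑ i, γ i * MvPolynomial.aeval ζ (g i))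

/-- `J(μ, Φ) = ∫_{|γ| ≤ Φ} I(𝓑, γ) e(-γ·μ) dγ`. -/
def Jint {n R : ℕ} (g : Fin R → MvPolynomial (Fin n) ℤ) (aB bB : Fin n → ℝ)
    (μ : Fin R → ℝ) (Φ : ℝ) : ℂ :=
  ∫ γ in {γ : Fin R → ℝ | ∀ i, |γ i| ≤ Φ}, Iosc g (boxSet aB bB) γ * eC (-(∑ i, γ i * μ i))

/-- The singular integral `J(μ) = lim_{Φ → ∞} J(μ, Φ)`. -/
def Jlim {n R : ℕ} (g : Fin R → MvPolynomial (Fin n) ℤ) (aB bB : Fin n → ℝ)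
    (μ : Fin R → ℝ) : ℂ :=
  limUnder Filter.atTop fun Φ : ℝ => Jint g aB bB μ Φ

/-- `M(P, ν)`: the number of integer points `x ∈ P𝓑` with `f(x) = ν`. -/
def Mcount {n R : ℕ} (f : Fin R → MvPolynomial (Fin n) ℤ) (aB bB : Fin n → ℝ) (P : ℝ)
    (ν : Fin R → ℤ) : ℕ :=
  ((boxPts aB bB P).filter fun x => ∀ i, MvPolynomial.eval x (f i) = ν i).card

/-- A single major arc `𝔐_{a,q}(θ)`. -/
def majorArc {R : ℕ} (d : ℕ) (Ct P θ : ℝ) (q : ℕ) (a : Fin R → ℤ) : Set (Fin R → ℝ) :=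
  Set.univ.pi fun i => Set.Icc
    ((a i : ℝ) / q - Ct ^ (R - 1) * P ^ (-(d : ℝ) + (R : ℝ) * ((d : ℝ) - 1) * θ) / (2 * q))
    ((a i : ℝ) / q + Ct ^ (R - 1) * P ^ (-(d : ℝ) + (R : ℝ) * ((d : ℝ) - 1) * θ) / (2 * q))

/-- The major arcs `𝔐(θ)`. -/
def majorArcs (R d : ℕ) (Ct P θ : ℝ) : Set (Fin R → ℝ) :=
  ⋃ (q : ℕ) (_ : 1 ≤ q ∧ (q : ℝ) ≤ Ct ^ R * P ^ ((R : ℝ) * ((d : ℝ) - 1) * θ))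
    (a : Fin R → ℤ)
    (_ : (∀ i, 1 ≤ a i ∧ a i ≤ (q : ℤ)) ∧ Int.gcd (Finset.univ.gcd a) (q : ℤ) = 1),
    majorArc d Ct P θ q a

/-- The minor arcs `𝔪 = [0,1]^R \ 𝔐(θ)`, taken modulo `1`. -/
def minorArcs (R d : ℕ) (Ct P θ : ℝ) : Set (Fin R → ℝ) :=
  {α | (∀ i, 0 ≤ α i ∧ α i ≤ 1) ∧
    ∀ z : Fin R → ℤ, (fun i => α i + (z i : ℝ)) ∉ majorArcs R d Ct P θ}

/-- Nonsingularity of the affine variety `f = 0` over `ℚ̄`: at every common zero the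
Jacobian matrix has (maximal) rank `R`, i.e. some `R × R` minor is nonvanishing. -/
def AffineNonsingular {n : ℕ} (R : ℕ) (f : Fin R → MvPolynomial (Fin n) ℤ) : Prop :=
  ∀ x : Fin n → Qbar, (∀ i, MvPolynomial.aeval x (f i) = 0) →
    ∃ (I : Finset (Fin n)) (hI : I.card = R), MvPolynomial.aeval x (jacMinor f I hI) ≠ 0

/-- Nonsingularity of the projective variety `g = 0` over `ℚ̄` (for forms `g`): at every
nonzero point of the affine cone the Jacobian matrix has rank `R`. -/
def ProjNonsingular {n : ℕ} (R : ℕ) (g : Fin R → MvPolynomial (Fin n) ℤ) : Prop :=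
  ∀ x : Fin n → Qbar, x ≠ 0 → (∀ i, MvPolynomial.aeval x (g i) = 0) →
    ∃ (I : Finset (Fin n)) (hI : I.card = R), MvPolynomial.aeval x (jacMinor g I hI) ≠ 0



-- part A1
section



/-! ### Basic facts on `eC` -/

lemma eC_add (x y : ℝ) : eC (x + y) = eC x * eC y := by
  unfold eC
  rw [← Complex.exp_add]; congr 1; push_cast; ring

lemma eC_zero : eC 0 = 1 := by simp [eC]

lemma norm_eC (x : ℝ) : ‖eC x‖ = 1 := by
  unfold eC
  rw [show 2 * (Real.pi : ℂ) * Complex.I * (x : ℂ) = ((2 * Real.pi * x : ℝ) : ℂ) * Complex.I by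
    push_cast; ring]
  exact Complex.norm_exp_ofReal_mul_I _

lemma eC_int (k : ℤ) : eC (k : ℝ) = 1 := by
  unfold eC
  rw [show 2 * (Real.pi : ℂ) * Complex.I * ((k : ℝ) : ℂ) = (k : ℂ) * (2 * Real.pi * Complex.I) by
    push_cast; ring]
  exact Complex.exp_int_mul_two_pi_mul_I k

lemma eC_ne_zero (x : ℝ) : eC x ≠ 0 := by
  intro h; have := norm_eC x; rw [h] at this; simp at this

lemma eC_neg (x : ℝ) : eC (-x) = (starRingEnd ℂ) (eC x) := by
  unfold eC
  rw [← Complex.exp_conj]; congr 1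
  simp only [map_mul, Complex.conj_I, Complex.conj_ofReal, Complex.ofReal_neg]
  rw [show (starRingEnd ℂ) 2 = 2 from Complex.conj_ofReal 2]
  ring

lemma eC_sub (x y : ℝ) : eC (x - y) = eC x * (starRingEnd ℂ) (eC y) := by
  rw [sub_eq_add_neg, eC_add, eC_neg]

lemma eC_add_int (x : ℝ) (k : ℤ) : eC (x + k) = eC x := by
  rw [eC_add, eC_int, mul_one]

lemma eC_nat_mul (x : ℝ) (k : ℕ) : eC (k * x) = eC x ^ k := by
  induction k with
  | zero => simp [eC_zero]
  | succ k ih => rw [pow_succ, ← ih, ← eC_add]; congr 1; push_cast; ring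

lemma continuous_eC : Continuous eC := by
  unfold eC; fun_prop

lemma norm_eC_sub_one (x : ℝ) : ‖eC x - 1‖ = 2 * |Real.sin (Real.pi * x)| := by
  have : eC x - 1 = eC (x/2) * (eC (x/2) - (starRingEnd ℂ) (eC (x/2))) := by
    rw [mul_sub, ← eC_add, ← eC_sub]; simp [eC_zero]
  rw [this, norm_mul, norm_eC, one_mul, Complex.sub_conj]
  have h2 : (eC (x/2)).im = Real.sin (Real.pi * x) := by
    unfold eC
    rw [show 2 * (Real.pi : ℂ) * Complex.I * ((x/2 : ℝ) : ℂ) = ((Real.pi * x : ℝ) : ℂ) * Complex.I by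
      push_cast; ring]
    exact Complex.exp_ofReal_mul_I_im _
  rw [h2, norm_mul, Complex.norm_I, mul_one, Complex.norm_real, Real.norm_eq_abs, abs_mul]
  norm_num

lemma norm_eC_sub_le (x y : ℝ) : ‖eC x - eC y‖ ≤ 2 * Real.pi * |x - y| := by
  have : eC x - eC y = eC y * (eC (x - y) - 1) := by
    rw [mul_sub, ← eC_add]; simp
  rw [this, norm_mul, norm_eC, one_mul, norm_eC_sub_one]
  have := Real.abs_sin_le_abs (x := Real.pi * (x-y))
  rw [abs_mul, abs_of_pos Real.pi_pos] at this
  linarith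

/-- distance to the nearest integer -/
def dZ (x : ℝ) : ℝ := |x - round x|

lemma dZ_nonneg (x : ℝ) : 0 ≤ dZ x := abs_nonneg _

lemma dZ_le_half (x : ℝ) : dZ x ≤ 1 / 2 := abs_sub_round x

lemma dZ_le (x : ℝ) (k : ℤ) : dZ x ≤ |x - k| := round_le x k

lemma four_dZ_le (x : ℝ) : 4 * dZ x ≤ ‖eC x - 1‖ := by
  have h0 : eC x = eC (x - round x) := by
    have := eC_add_int (x - round x) (round x)
    rw [← this]; congr 1; ring
  rw [h0, norm_eC_sub_one]
  have hx := dZ_le_half x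
  have h1 := Real.mul_le_sin (x := Real.pi * dZ x) (mul_nonneg Real.pi_pos.le (dZ_nonneg x))
    (by nlinarith [Real.pi_pos])
  have h2 : 2 / Real.pi * (Real.pi * dZ x) = 2 * dZ x := by
    field_simp
  rw [h2] at h1
  have h3 : |Real.sin (Real.pi * (x - round x))| = |Real.sin (Real.pi * dZ x)| := by
    unfold dZ
    rcases abs_choice (x - round x) with h | h <;> rw [h]
    rw [mul_neg, Real.sin_neg, abs_neg]
  rw [h3]
  have := le_abs_self (Real.sin (Real.pi * dZ x))
  linarith

lemma geom_range_bound (x : ℝ) (m : ℕ) :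
    ‖∑ k ∈ Finset.range m, eC (x * k)‖ * (2 * dZ x) ≤ 1 := by
  have h1 : ∑ k ∈ Finset.range m, eC (x * k) = ∑ k ∈ Finset.range m, eC x ^ k := by
    refine Finset.sum_congr rfl fun k _ => ?_
    rw [mul_comm, eC_nat_mul]
  have h2 : ‖∑ k ∈ Finset.range m, eC (x * k)‖ * ‖eC x - 1‖ ≤ 2 := by
    rw [h1, ← norm_mul, geom_sum_mul, ← eC_nat_mul]
    calc _ ≤ ‖eC (m * x)‖ + ‖(1:ℂ)‖ := norm_sub_le _ _
      _ = 2 := by rw [norm_eC]; norm_num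
  have h3 := four_dZ_le x
  nlinarith [norm_nonneg (∑ k ∈ Finset.range m, eC (x * k))]

lemma geom_Icc_bound (x : ℝ) (lo hi : ℤ) :
    ‖∑ k ∈ Finset.Icc lo hi, eC (x * k)‖ * (2 * dZ x) ≤ 1 := by
  have : ∑ k ∈ Finset.Icc lo hi, eC (x * k) =
      eC (x * lo) * ∑ k ∈ Finset.range (hi + 1 - lo).toNat, eC (x * k) := by
    rw [Finset.mul_sum, Int.Icc_eq_finset_map, Finset.sum_map]
    refine Finset.sum_congr rfl fun k _ => ?_
    rw [← eC_add]; congr 1; simp; ring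
  rw [this, norm_mul, norm_eC, one_mul]
  exact geom_range_bound x _

/-- weight -/
def wt (N t : ℝ) : ℝ := if t * N ≤ 1 then N else 1 / t

lemma wt_nonneg {N t : ℝ} (hN : 0 ≤ N) : 0 ≤ wt N t := by
  unfold wt; split_ifs with h
  · exact hN
  · have : 0 < t := by
      by_contra h'
      push Not at h'
      nlinarith
    positivity

lemma geom_wt_bound (x : ℝ) (lo hi : ℤ) (N : ℝ) (hN : 0 ≤ N) (h : (hi - lo + 1 : ℝ) ≤ N) :
    ‖∑ k ∈ Finset.Icc lo hi, eC (x * k)‖ ≤ wt N (dZ x) := by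
  unfold wt
  split_ifs with h1
  · refine (norm_sum_le _ _).trans ?_
    simp only [norm_eC, Finset.sum_const, nsmul_eq_mul, mul_one, Int.card_Icc]
    by_cases h2 : 0 ≤ hi + 1 - lo
    · have : (((hi + 1 - lo).toNat : ℤ) : ℝ) = ((hi + 1 - lo : ℤ) : ℝ) := by
        rw [Int.toNat_of_nonneg h2]
      push_cast at this
      rw [this]; linarith
    · rw [Int.toNat_of_nonpos (by omega)]; simpa using hN
  · have hd : 0 < dZ x := by
      by_contra h'
      push Not at h'
      nlinarith
    rw [le_div_iff₀ hd]
    have := geom_Icc_bound x lo hi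
    nlinarith [norm_nonneg (∑ k ∈ Finset.Icc lo hi, eC (x * k))]

end


-- part A2
section



/-! ### Multilinear forms and differencing -/

section Tensor
variable {n : ℕ} {A : Type*} [CommRing A]

/-- degree `< k` -/
def dlt (k : ℕ) (F : MvPolynomial (Fin n) A) : Prop := ∀ m, k ≤ Finsupp.degree m → coeff m F = 0

lemma dlt_add {k : ℕ} {F G : MvPolynomial (Fin n) A} (hF : dlt k F) (hG : dlt k G) :
    dlt k (F + G) := fun m hm => by rw [coeff_add, hF m hm, hG m hm, add_zero]

lemma dlt_zero {k : ℕ} : dlt k (0 : MvPolynomial (Fin n) A) := fun m _ => by simp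

lemma dlt_sum {ι : Type*} {k : ℕ} (s : Finset ι) (F : ι → MvPolynomial (Fin n) A)
    (hF : ∀ i ∈ s, dlt k (F i)) : dlt k (∑ i ∈ s, F i) := fun m hm => by
  rw [coeff_sum]; exact Finset.sum_eq_zero fun i hi => hF i hi m hm

lemma dlt_C_mul {k : ℕ} (c : A) {F : MvPolynomial (Fin n) A} (hF : dlt k F) :
    dlt k (C c * F) := fun m hm => by rw [coeff_C_mul, hF m hm, mul_zero]

lemma dlt_neg {k : ℕ} {F : MvPolynomial (Fin n) A} (hF : dlt k F) :
    dlt k (-F) := fun m hm => by rw [coeff_neg, hF m hm, neg_zero]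

lemma dlt_sub {k : ℕ} {F G : MvPolynomial (Fin n) A} (hF : dlt k F) (hG : dlt k G) :
    dlt k (F - G) := by rw [sub_eq_add_neg]; exact dlt_add hF (dlt_neg hG)

lemma dlt_mono {k l : ℕ} (h : k ≤ l) {F : MvPolynomial (Fin n) A} (hF : dlt k F) :
    dlt l F := fun m hm => hF m (h.trans hm)

lemma dlt_zero_iff {F : MvPolynomial (Fin n) A} (hF : dlt 0 F) : F = 0 := by
  ext m; simpa using hF m (Nat.zero_le _)

lemma dlt_mul {k l : ℕ} {F G : MvPolynomial (Fin n) A} (hF : dlt (k + 1) F) (hG : dlt l G) :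
    dlt (k + l) (F * G) := fun m hm => by
  rw [coeff_mul]
  refine Finset.sum_eq_zero fun x hx => ?_
  rw [Finset.HasAntidiagonal.mem_antidiagonal] at hx
  have : Finsupp.degree x.1 + Finsupp.degree x.2 = Finsupp.degree m := by
    rw [← hx, map_add]
  by_cases h : k + 1 ≤ Finsupp.degree x.1
  · rw [hF _ h, zero_mul]
  · rw [hG _ (by omega), mul_zero]

lemma dlt_X (i : Fin n) : dlt 2 (X i : MvPolynomial (Fin n) A) := fun m hm => by
  rw [coeff_X, if_neg]
  rintro rfl
  simp at hm

lemma dlt_C (c : A) : dlt 1 (C c : MvPolynomial (Fin n) A) := fun m hm => by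
  rw [coeff_C, if_neg]
  rintro rfl
  simp at hm

lemma dlt_iff_totalDegree {k : ℕ} {F : MvPolynomial (Fin n) A} (h : F.totalDegree ≤ k) :
    dlt (k + 1) F := fun m hm => by
  apply coeff_eq_zero_of_totalDegree_lt
  have : ∑ i ∈ m.support, m i = Finsupp.degree m := rfl
  omega

/-- shift -/
def shiftP (h : Fin n → A) (F : MvPolynomial (Fin n) A) : MvPolynomial (Fin n) A :=
  bind₁ (fun i => X i + C (h i)) F

/-- difference -/
def diffP (h : Fin n → A) (F : MvPolynomial (Fin n) A) : MvPolynomial (Fin n) A :=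
  shiftP h F - F

/-- directional derivative -/
def derP (h : Fin n → A) (F : MvPolynomial (Fin n) A) : MvPolynomial (Fin n) A :=
  ∑ j, C (h j) * pderiv j F

lemma eval_shiftP (h x : Fin n → A) (F : MvPolynomial (Fin n) A) :
    eval x (shiftP h F) = eval (x + h) F := by
  unfold shiftP
  rw [← aeval_eq_eval, ← aeval_eq_eval, aeval_bind₁]
  congr 2
  funext i
  simp

lemma eval_diffP (h x : Fin n → A) (F : MvPolynomial (Fin n) A) :
    eval x (diffP h F) = eval (x + h) F - eval x F := by
  unfold diffP; rw [map_sub, eval_shiftP]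

lemma shiftP_add (h : Fin n → A) (F G : MvPolynomial (Fin n) A) :
    shiftP h (F + G) = shiftP h F + shiftP h G := map_add _ _ _

lemma derP_add (h : Fin n → A) (F G : MvPolynomial (Fin n) A) :
    derP h (F + G) = derP h F + derP h G := by
  simp [derP, mul_add, Finset.sum_add_distrib]

lemma derP_X_mul (h : Fin n → A) (i : Fin n) (G : MvPolynomial (Fin n) A) :
    derP h (X i * G) = X i * derP h G + C (h i) * G := by
  unfold derP
  simp only [Derivation.leibniz, smul_eq_mul, mul_add, Finset.sum_add_distrib]
  congr 1
  · rw [Finset.mul_sum]; exact Finset.sum_congr rfl fun j _ => by ring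
  · rw [Finset.sum_eq_single i]
    · simp
    · intro j _ hj; rw [pderiv_X_of_ne (Ne.symm hj)]; simp
    · simp

/-- Taylor estimate -/
def TayP (h : Fin n → A) (k : ℕ) (G : MvPolynomial (Fin n) A) : Prop :=
  dlt (k + 1) G ∧ dlt k (diffP h G) ∧ dlt (k - 1) (diffP h G - derP h G)

lemma TayP_X_mul (h : Fin n → A) (k : ℕ) (i : Fin n) (G : MvPolynomial (Fin n) A)
    (hG : TayP h k G) : TayP h (k + 1) (X i * G) := by
  obtain ⟨h1, h2, h3⟩ := hG
  have e1 : diffP h (X i * G) = X i * diffP h G + C (h i) * G + C (h i) * diffP h G := by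
    unfold diffP shiftP
    rw [map_mul, bind₁_X_right]; ring
  refine ⟨?_, ?_, ?_⟩
  · have := dlt_mul (dlt_X i) h1
    exact dlt_mono (by omega) this
  · rw [e1]
    refine dlt_add (dlt_add ?_ (dlt_C_mul _ h1)) (dlt_mono (by omega) (dlt_C_mul _ h2))
    exact dlt_mono (by omega) (dlt_mul (dlt_X i) h2)
  · rw [e1, derP_X_mul]
    have e2 : X i * diffP h G + C (h i) * G + C (h i) * diffP h G - (X i * derP h G + C (h i) * G)
        = X i * (diffP h G - derP h G) + C (h i) * diffP h G := by ring
    rw [e2]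
    refine dlt_add ?_ (dlt_C_mul _ h2)
    rcases Nat.eq_zero_or_pos k with rfl | hk
    · rw [dlt_zero_iff h3, mul_zero]; exact dlt_zero
    · exact dlt_mono (by omega) (dlt_mul (dlt_X i) h3)

lemma TayP_C (h : Fin n → A) (c : A) : TayP h 0 (C c) := by
  refine ⟨dlt_C c, ?_, ?_⟩ <;> simp [diffP, shiftP, derP, dlt_zero]

lemma TayP_mono (h : Fin n → A) {k l : ℕ} (hkl : k ≤ l) {G : MvPolynomial (Fin n) A}
    (hG : TayP h k G) : TayP h l G :=
  ⟨dlt_mono (by omega) hG.1, dlt_mono hkl hG.2.1, dlt_mono (by omega) hG.2.2⟩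

lemma TayP_add (h : Fin n → A) {k : ℕ} {F G : MvPolynomial (Fin n) A}
    (hF : TayP h k F) (hG : TayP h k G) : TayP h k (F + G) := by
  refine ⟨dlt_add hF.1 hG.1, ?_, ?_⟩
  · have : diffP h (F + G) = diffP h F + diffP h G := by
      unfold diffP; rw [shiftP_add]; ring
    rw [this]; exact dlt_add hF.2.1 hG.2.1
  · have : diffP h (F + G) - derP h (F + G)
        = (diffP h F - derP h F) + (diffP h G - derP h G) := by
      unfold diffP; rw [shiftP_add, derP_add]; ring
    rw [this]; exact dlt_add hF.2.2 hG.2.2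

lemma TayP_monomial (h : Fin n → A) (k : ℕ) : ∀ (m : Fin n →₀ ℕ) (c : A), Finsupp.degree m = k →
    TayP h k (monomial m c) := by
  induction k with
  | zero =>
    intro m c hm
    have : m = 0 := (Finsupp.degree_eq_zero_iff m).1 hm
    subst this
    exact TayP_C h c
  | succ k ih =>
    intro m c hm
    have hm0 : m ≠ 0 := by rintro rfl; simp at hm
    obtain ⟨i, hi⟩ := Finsupp.ne_iff.1 hm0
    have hs : Finsupp.single i 1 + (m - Finsupp.single i 1) = m := by
      rw [add_comm]
      apply tsub_add_cancel_of_le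
      rw [Finsupp.single_le_iff]
      exact Nat.one_le_iff_ne_zero.2 hi
    have hd : Finsupp.degree (m - Finsupp.single i 1) = k := by
      have := congrArg Finsupp.degree hs
      rw [map_add, Finsupp.degree_single] at this
      omega
    have := TayP_X_mul h k i _ (ih _ c hd)
    rwa [X, monomial_mul, hs, one_mul] at this

lemma TayP_of_dlt (h : Fin n → A) (k : ℕ) (F : MvPolynomial (Fin n) A) (hF : dlt (k + 1) F) :
    TayP h k F := by
  rw [F.as_sum]
  have : ∀ s : Finset (Fin n →₀ ℕ), s ⊆ F.support →
      TayP h k (∑ v ∈ s, monomial v (coeff v F)) := by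
    intro s
    induction s using Finset.induction_on with
    | empty =>
      intro _
      have := TayP_mono h (Nat.zero_le k) (TayP_C h (0 : A))
      simpa using this
    | insert a s ha ih =>
      intro hs
      rw [Finset.sum_insert ha]
      refine TayP_add h ?_ (ih fun x hx => hs (Finset.mem_insert_of_mem hx))
      refine TayP_mono h ?_ (TayP_monomial h _ a _ rfl)
      by_contra hc
      have := hF a (by omega)
      exact (mem_support_iff.1 (hs (Finset.mem_insert_self a s))) this
  exact this _ subset_rfl

/-- exponent of a sequence of indices -/
def fexp {k : ℕ} (v : Fin k → Fin n) : Fin n →₀ ℕ := ∑ i, Finsupp.single (v i) 1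

lemma degree_fexp {k : ℕ} (v : Fin k → Fin n) : Finsupp.degree (fexp v) = k := by
  simp [fexp, map_sum]

lemma fexp_cons {k : ℕ} (j : Fin n) (v : Fin k → Fin n) :
    fexp (Fin.cons j v : Fin (k + 1) → Fin n) = fexp v + Finsupp.single j 1 := by
  simp [fexp, Fin.sum_univ_succ, add_comm]

/-- factorial of exponent -/
def mfac (m : Fin n →₀ ℕ) : ℕ := ∏ j, (m j).factorial

lemma mfac_add_single (m : Fin n →₀ ℕ) (j : Fin n) :
    mfac (m + Finsupp.single j 1) = mfac m * (m j + 1) := by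
  unfold mfac
  rw [← Finset.mul_prod_erase _ _ (Finset.mem_univ j), ← Finset.mul_prod_erase _ (fun j => (m j).factorial) (Finset.mem_univ j)]
  have : ∏ x ∈ Finset.univ.erase j, ((m + Finsupp.single j 1 : Fin n →₀ ℕ) x).factorial
      = ∏ x ∈ Finset.univ.erase j, (m x).factorial := by
    refine Finset.prod_congr rfl fun x hx => ?_
    have : x ≠ j := Finset.ne_of_mem_erase hx
    simp [Finsupp.single_apply, this.symm]
  rw [this]
  simp [Nat.factorial_succ]; ring

/-- coefficient tensor -/
def Tn (F : MvPolynomial (Fin n) A) {k : ℕ} (v : Fin k → Fin n) : A :=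
  (mfac (fexp v) : A) * coeff (fexp v) F

lemma Tn_pderiv (F : MvPolynomial (Fin n) A) {k : ℕ} (j : Fin n) (v : Fin k → Fin n) :
    Tn (pderiv j F) v = Tn F (Fin.cons j v : Fin (k + 1) → Fin n) := by
  unfold Tn
  rw [fexp_cons, mfac_add_single, coeff_pderiv]
  push_cast; ring

lemma Tn_add (F G : MvPolynomial (Fin n) A) {k : ℕ} (v : Fin k → Fin n) :
    Tn (F + G) v = Tn F v + Tn G v := by unfold Tn; rw [coeff_add, mul_add]

lemma Tn_C_mul (c : A) (F : MvPolynomial (Fin n) A) {k : ℕ} (v : Fin k → Fin n) :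
    Tn (C c * F) v = c * Tn F v := by unfold Tn; rw [coeff_C_mul]; ring

lemma Tn_sum {ι : Type*} (s : Finset ι) (F : ι → MvPolynomial (Fin n) A) {k : ℕ}
    (v : Fin k → Fin n) : Tn (∑ i ∈ s, F i) v = ∑ i ∈ s, Tn (F i) v := by
  unfold Tn; rw [coeff_sum, Finset.mul_sum]

lemma Tn_diffP (h : Fin n → A) {k : ℕ} (F : MvPolynomial (Fin n) A) (hF : dlt (k + 2) F)
    (v : Fin k → Fin n) :
    Tn (diffP h F) v = ∑ j, h j * Tn F (Fin.cons j v : Fin (k + 1) → Fin n) := by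
  have h3 := (TayP_of_dlt h (k + 1) F hF).2.2 (fexp v) (by rw [degree_fexp]; omega)
  rw [coeff_sub, sub_eq_zero] at h3
  have h4 : Tn (diffP h F) v = Tn (derP h F) v := by unfold Tn; rw [h3]
  rw [h4, derP, Tn_sum]
  exact Finset.sum_congr rfl fun j _ => by rw [Tn_C_mul, Tn_pderiv]

/-- The multilinear forms -/
def Psi (F : MvPolynomial (Fin n) A) (j : Fin n) {k : ℕ} (h : Fin k → Fin n → A) : A :=
  ∑ v : Fin k → Fin n, Tn F (Fin.cons j v : Fin (k + 1) → Fin n) * ∏ i, h i (v i)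

lemma sum_fin_cons {α M : Type*} [Fintype α] [AddCommMonoid M] {k : ℕ}
    (g : (Fin (k + 1) → α) → M) :
    ∑ v, g v = ∑ a : α, ∑ v : Fin k → α, g (Fin.cons a v) := by
  rw [← (Fin.consEquiv (fun _ => α)).sum_comp, Fintype.sum_prod_type]
  rfl

lemma Psi_diffP (h : Fin n → A) {k : ℕ} (F : MvPolynomial (Fin n) A) (hF : dlt (k + 3) F)
    (j : Fin n) (h' : Fin k → Fin n → A) :
    Psi (diffP h F) j h' = Psi F j (Fin.cons h h' : Fin (k + 1) → Fin n → A) := by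
  unfold Psi
  rw [sum_fin_cons, Finset.sum_comm]
  refine Finset.sum_congr rfl fun v _ => ?_
  rw [Tn_diffP h F hF, Finset.sum_mul]
  refine Finset.sum_congr rfl fun l _ => ?_
  have : Tn F (Fin.cons l (Fin.cons j v : Fin (k + 1) → Fin n) : Fin (k + 1 + 1) → Fin n)
      = Tn F (Fin.cons j (Fin.cons l v : Fin (k + 1) → Fin n) : Fin (k + 1 + 1) → Fin n) := by
    unfold Tn
    simp only [fexp_cons, add_assoc, add_comm (Finsupp.single j 1)]
  rw [this, Fin.prod_univ_succ]
  simp only [Fin.cons_zero, Fin.cons_succ]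
  ring

lemma Psi_sum_smul {ι : Type*} (s : Finset ι) (c : ι → A) (F : ι → MvPolynomial (Fin n) A)
    (j : Fin n) {k : ℕ} (h : Fin k → Fin n → A) :
    Psi (∑ i ∈ s, C (c i) * F i) j h = ∑ i ∈ s, c i * Psi (F i) j h := by
  unfold Psi
  simp only [Tn_sum, Tn_C_mul, Finset.sum_mul, Finset.mul_sum]
  rw [Finset.sum_comm]
  exact Finset.sum_congr rfl fun i _ => Finset.sum_congr rfl fun v _ => by ring

/-- degree at most one -/
lemma eval_linear (F : MvPolynomial (Fin n) A) (hF : dlt 2 F) (x : Fin n → A) :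
    eval x F = coeff 0 F + ∑ j, Psi F j (fun i : Fin 0 => i.elim0) * x j := by
  have h1 : F = C (coeff 0 F) + ∑ j, C (coeff (Finsupp.single j 1) F) * X j := by
    ext m
    simp only [coeff_add, coeff_C, coeff_sum, coeff_C_mul, coeff_X]
    by_cases hm : 2 ≤ Finsupp.degree m
    · rw [hF m hm, if_neg (by rintro rfl; simp at hm), zero_add, Finset.sum_eq_zero]
      intro j _
      rw [if_neg (by rintro rfl; simp at hm), mul_zero]
    · by_cases h0 : m = 0
      · subst h0
        rw [if_pos rfl, Finset.sum_eq_zero, add_zero]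
        intro j _
        rw [if_neg (by simp), mul_zero]
      · obtain ⟨i, hi⟩ := Finsupp.ne_iff.1 h0
        have hi' : Finsupp.single i 1 ≤ m := by
          rw [Finsupp.single_le_iff]; exact Nat.one_le_iff_ne_zero.2 hi
        have hs := tsub_add_cancel_of_le hi'
        have hd := congrArg Finsupp.degree hs
        rw [map_add, Finsupp.degree_single] at hd
        have : m - Finsupp.single i 1 = 0 := by
          rw [← Finsupp.degree_eq_zero_iff]; omega
        rw [this, zero_add] at hs
        subst hs
        rw [if_neg (Ne.symm h0), zero_add, Finset.sum_eq_single i]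
        · simp
        · intro j _ hj
          rw [if_neg, mul_zero]
          intro h
          exact hj ((Finsupp.single_left_injective one_ne_zero) h)
        · simp
  conv_lhs => rw [h1]
  simp only [map_add, map_sum, map_mul, eval_C, eval_X]
  congr 1
  refine Finset.sum_congr rfl fun j _ => ?_
  congr 1
  unfold Psi Tn
  simp only [Finset.univ_unique, Finset.sum_singleton, fexp_cons]
  simp [fexp, mfac]
  rw [Finset.prod_eq_one]
  · simp
  · intro i _
    rw [Finsupp.single_apply]; split_ifs <;> simp

end Tensor

end


-- part A3
section



/-! ### Weyl differencing -/

/-- integer points of sup norm at most `M` -/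
def boxZ (n : ℕ) (M : ℝ) : Finset (Fin n → ℤ) :=
  Finset.Icc (fun _ => -⌊M⌋) (fun _ => ⌊M⌋)

lemma mem_boxZ {n : ℕ} {M : ℝ} {x : Fin n → ℤ} : x ∈ boxZ n M ↔ ∀ j, |(x j : ℝ)| ≤ M := by
  unfold boxZ
  rw [Finset.mem_Icc, Pi.le_def, Pi.le_def]
  constructor
  · rintro ⟨h1, h2⟩ j
    rw [← Int.cast_abs, ← Int.le_floor, abs_le]
    exact ⟨h1 j, h2 j⟩
  · intro h
    have : ∀ j, |x j| ≤ ⌊M⌋ := fun j => by rw [Int.le_floor, Int.cast_abs]; exact h j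
    exact ⟨fun j => (abs_le.1 (this j)).1, fun j => (abs_le.1 (this j)).2⟩

/-- tuples of integer points -/
def tupZ (n k : ℕ) (M : ℝ) : Finset (Fin k → Fin n → ℤ) := Fintype.piFinset fun _ => boxZ n M

lemma mem_tupZ {n k : ℕ} {M : ℝ} {x : Fin k → Fin n → ℤ} :
    x ∈ tupZ n k M ↔ ∀ i, x i ∈ boxZ n M := by
  unfold tupZ; rw [Fintype.mem_piFinset]

lemma sum_tupZ_succ {n k : ℕ} {M : ℝ} {V : Type*} [AddCommMonoid V]
    (g : (Fin (k + 1) → Fin n → ℤ) → V) :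
    ∑ h ∈ tupZ n (k + 1) M, g h = ∑ a ∈ boxZ n M, ∑ h ∈ tupZ n k M, g (Fin.cons a h) := by
  rw [← Finset.sum_product']
  symm
  refine Finset.sum_nbij' (fun p => Fin.cons p.1 p.2) (fun h => (h 0, Fin.tail h)) ?_ ?_ ?_ ?_ ?_
  · rintro ⟨a, h⟩ hp
    rw [Finset.mem_product] at hp
    rw [mem_tupZ]
    intro i
    refine Fin.cases ?_ (fun i => ?_) i
    · exact hp.1
    · exact mem_tupZ.1 hp.2 i
  · intro h hh
    rw [Finset.mem_product, mem_tupZ]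
    rw [mem_tupZ] at hh
    exact ⟨hh 0, fun i => hh i.succ⟩
  · rintro ⟨a, h⟩ _; simp
  · intro h _; simp
  · intro h _; rfl

/-- integer vector to real -/
def toR {n : ℕ} (x : Fin n → ℤ) : Fin n → ℝ := fun j => (x j : ℝ)

lemma toR_add {n : ℕ} (x y : Fin n → ℤ) : toR (x + y) = toR x + toR y := by
  funext j; simp [toR]

/-- tuple cast -/
def toRR {n k : ℕ} (h : Fin k → Fin n → ℤ) : Fin k → Fin n → ℝ := fun i => toR (h i)

lemma toRR_cons {n k : ℕ} (a : Fin n → ℤ) (h : Fin k → Fin n → ℤ) :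
    toRR (Fin.cons a h : Fin (k + 1) → Fin n → ℤ) =
      (Fin.cons (toR a) (toRR h) : Fin (k + 1) → Fin n → ℝ) := by
  funext i
  refine Fin.cases ?_ (fun i => ?_) i <;> simp [toRR]

lemma card_boxZ_le (n : ℕ) (M : ℝ) (hM : 0 ≤ M) : ((boxZ n M).card : ℝ) ≤ (2 * M + 1) ^ n := by
  unfold boxZ
  rw [Pi.card_Icc]
  push_cast
  simp only [Int.card_Icc, Finset.prod_const, Finset.card_univ, Fintype.card_fin]
  have h0 : 0 ≤ ⌊M⌋ := Int.floor_nonneg.2 hM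
  have : (((⌊M⌋ + 1 - -⌊M⌋).toNat : ℤ) : ℝ) = ((⌊M⌋ + 1 - -⌊M⌋ : ℤ) : ℝ) := by
    rw [Int.toNat_of_nonneg (by omega)]
  push_cast at this
  rw [this]
  have := Int.floor_le M
  have h0' : (0 : ℝ) ≤ ⌊M⌋ := by exact_mod_cast h0
  exact pow_le_pow_left₀ (by linarith) (by linarith) n

/-- van der Corput / Weyl step -/
lemma weyl_step {n : ℕ} (lo hi : Fin n → ℤ) (N : ℝ) (hN : ∀ j, (hi j - lo j : ℝ) ≤ N)
    (φ : (Fin n → ℤ) → ℝ) :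
    ‖∑ x ∈ Finset.Icc lo hi, eC (φ x)‖ ^ 2 ≤
      ∑ h ∈ boxZ n N, ‖∑ x ∈ Finset.Icc (lo ⊔ (lo - h)) (hi ⊓ (hi - h)),
        eC (φ (x + h) - φ x)‖ := by
  set I := Finset.Icc lo hi
  have h1 : ((‖∑ x ∈ I, eC (φ x)‖ ^ 2 : ℝ) : ℂ) =
      ∑ x ∈ I, ∑ y ∈ I, eC (φ y - φ x) := by
    rw [← Complex.normSq_eq_norm_sq, ← Complex.mul_conj, map_sum, Finset.sum_mul_sum,
      Finset.sum_comm]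
    refine Finset.sum_congr rfl fun x _ => Finset.sum_congr rfl fun y _ => ?_
    rw [eC_sub]
  have h2 : ∑ x ∈ I, ∑ y ∈ I, eC (φ y - φ x) =
      ∑ h ∈ boxZ n N, ∑ x ∈ Finset.Icc (lo ⊔ (lo - h)) (hi ⊓ (hi - h)), eC (φ (x + h) - φ x) := by
    rw [Finset.sum_sigma', Finset.sum_sigma']
    refine Finset.sum_nbij' (fun p => ⟨p.2 - p.1, p.1⟩) (fun p => ⟨p.2, p.2 + p.1⟩) ?_ ?_ ?_ ?_ ?_
    · rintro ⟨x, y⟩ hp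
      simp only [Finset.mem_sigma, I, Finset.mem_Icc, mem_boxZ, sup_le_iff, le_inf_iff,
        Pi.le_def, Pi.sub_apply] at hp ⊢
      obtain ⟨⟨a1, a2⟩, b1, b2⟩ := hp
      refine ⟨fun j => ?_, ⟨a1, fun j => by linarith [b2 j, b1 j]⟩, ⟨a2, fun j => by linarith [b2 j]⟩⟩
      have e1 : (lo j : ℝ) ≤ x j := by exact_mod_cast a1 j
      have e2 : (x j : ℝ) ≤ hi j := by exact_mod_cast a2 j
      have e3 : (lo j : ℝ) ≤ y j := by exact_mod_cast b1 j
      have e4 : (y j : ℝ) ≤ hi j := by exact_mod_cast b2 j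
      push_cast
      rw [abs_le]; constructor <;> linarith [hN j]
    · rintro ⟨h, x⟩ hp
      simp only [Finset.mem_sigma, I, Finset.mem_Icc, sup_le_iff, le_inf_iff,
        Pi.le_def, Pi.sub_apply, Pi.add_apply] at hp ⊢
      obtain ⟨_, ⟨a1, a2⟩, b1, b2⟩ := hp
      exact ⟨⟨a1, b1⟩, fun j => by linarith [a2 j], fun j => by linarith [b2 j]⟩
    · rintro ⟨x, y⟩ _; simp
    · rintro ⟨h, x⟩ _; simp
    · rintro ⟨x, y⟩ _; simp
  have h3 : ‖∑ x ∈ I, eC (φ x)‖ ^ 2 = ‖((‖∑ x ∈ I, eC (φ x)‖ ^ 2 : ℝ) : ℂ)‖ := by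
    rw [Complex.norm_real, Real.norm_eq_abs, abs_of_nonneg (by positivity)]
  rw [h3, h1, h2]
  exact norm_sum_le _ _

lemma weyl_diff {n : ℕ} (N : ℝ) (hN1 : 1 ≤ N) (k : ℕ) :
    ∀ (F : MvPolynomial (Fin n) ℝ), dlt (k + 2) F → ∀ (lo hi : Fin n → ℤ),
    (∀ j, (hi j - lo j + 1 : ℝ) ≤ N) →
    ‖∑ x ∈ Finset.Icc lo hi, eC (eval (toR x) F)‖ ^ (2 ^ k) ≤
      ((2 * N + 1) ^ n) ^ (2 ^ k - k - 1) *
        ∑ h ∈ tupZ n k N, ∏ j, wt N (dZ (Psi F j (toRR h))) := by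
  induction k with
  | zero =>
    intro F hF lo hi hN
    have hS : ∑ x ∈ Finset.Icc lo hi, eC (eval (toR x) F) =
        eC (coeff 0 F) * ∏ j, ∑ t ∈ Finset.Icc (lo j) (hi j),
          eC (Psi F j (fun i : Fin 0 => i.elim0) * t) := by
      rw [Finset.prod_univ_sum, Finset.mul_sum]
      refine Finset.sum_congr rfl fun x _ => ?_
      rw [eval_linear F hF, eC_add]
      congr 1
      have : ∀ (s : Finset (Fin n)) (g : Fin n → ℝ), eC (∑ j ∈ s, g j) = ∏ j ∈ s, eC (g j) := by
        intro s g
        induction s using Finset.induction_on with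
        | empty => simp [eC_zero]
        | insert a s ha ih => rw [Finset.sum_insert ha, Finset.prod_insert ha, eC_add, ih]
      rw [this]; rfl
    rw [hS]
    simp only [pow_zero, pow_one, Nat.sub_zero, Nat.sub_self, one_mul]
    have hT : tupZ n 0 N = {fun i : Fin 0 => i.elim0} := by
      ext h; simp only [mem_tupZ, Finset.mem_singleton]
      constructor
      · intro _; funext i; exact i.elim0
      · intro _ i; exact i.elim0
    rw [hT, Finset.sum_singleton, norm_mul, norm_eC, one_mul, norm_prod]
    refine Finset.prod_le_prod (fun _ _ => norm_nonneg _) fun j _ => ?_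
    have e : toRR (fun i : Fin 0 => (i.elim0 : Fin n → ℤ)) = fun i : Fin 0 => i.elim0 := by
      funext i; exact i.elim0
    rw [e]
    exact geom_wt_bound _ _ _ _ (by linarith) (hN j)
  | succ k ih =>
    intro F hF lo hi hN
    set S := ∑ x ∈ Finset.Icc lo hi, eC (eval (toR x) F) with hSdef
    set W : ℝ := (2 * N + 1) ^ n with hW
    have hW1 : 1 ≤ W := one_le_pow₀ (by linarith)
    have hstep := weyl_step lo hi N (fun j => by linarith [hN j]) (fun x => eval (toR x) F)
    set G : (Fin n → ℤ) → ℂ := fun h => ∑ x ∈ Finset.Icc (lo ⊔ (lo - h)) (hi ⊓ (hi - h)),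
        eC (eval (toR x) (diffP (toR h) F)) with hG
    have hstep' : ‖S‖ ^ 2 ≤ ∑ h ∈ boxZ n N, ‖G h‖ := by
      refine hstep.trans (le_of_eq ?_)
      refine Finset.sum_congr rfl fun h _ => ?_
      rw [hG]
      congr 1
      refine Finset.sum_congr rfl fun x _ => ?_
      rw [eval_diffP, toR_add]
    have hG2 : ∀ h ∈ boxZ n N, ‖G h‖ ^ (2 ^ k) ≤ W ^ (2 ^ k - k - 1) *
        ∑ h' ∈ tupZ n k N, ∏ j, wt N (dZ (Psi F j (toRR (Fin.cons h h' : Fin (k + 1) → Fin n → ℤ)))) := by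
      intro h _
      have hd : dlt (k + 2) (diffP (toR h) F) := (TayP_of_dlt (toR h) (k + 2) F hF).2.1
      refine (ih _ hd _ _ ?_).trans (le_of_eq ?_)
      · intro j
        have a1 : (lo ⊔ (lo - h)) j ≥ lo j := le_sup_left
        have a2 : (hi ⊓ (hi - h)) j ≤ hi j := inf_le_left
        have a1' : ((lo ⊔ (lo - h)) j : ℝ) ≥ lo j := by exact_mod_cast a1
        have a2' : ((hi ⊓ (hi - h)) j : ℝ) ≤ hi j := by exact_mod_cast a2
        linarith [hN j]
      · congr 1
        refine Finset.sum_congr rfl fun h' _ => ?_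
        refine Finset.prod_congr rfl fun j _ => ?_
        rw [Psi_diffP _ _ hF, toRR_cons]
    have hcard := card_boxZ_le n N (by linarith)
    have hJ : (∑ h ∈ boxZ n N, ‖G h‖) ^ (2 ^ k) ≤
        ((boxZ n N).card : ℝ) ^ (2 ^ k - 1) * ∑ h ∈ boxZ n N, ‖G h‖ ^ (2 ^ k) := by
      have hp : 2 ^ k = (2 ^ k - 1) + 1 := by have := Nat.one_le_two_pow (n := k); omega
      rw [hp]
      simpa using pow_sum_le_card_mul_sum_pow (s := boxZ n N) (f := fun h => ‖G h‖)
        (fun _ _ => norm_nonneg _) (2 ^ k - 1)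
    have hk1 : k + 1 ≤ 2 ^ k := Nat.lt_two_pow_self
    calc ‖S‖ ^ 2 ^ (k + 1) = (‖S‖ ^ 2) ^ (2 ^ k) := by rw [← pow_mul, pow_succ']
      _ ≤ (∑ h ∈ boxZ n N, ‖G h‖) ^ (2 ^ k) := pow_le_pow_left₀ (by positivity) hstep' _
      _ ≤ ((boxZ n N).card : ℝ) ^ (2 ^ k - 1) * ∑ h ∈ boxZ n N, ‖G h‖ ^ (2 ^ k) := hJ
      _ ≤ W ^ (2 ^ k - 1) * ∑ h ∈ boxZ n N, (W ^ (2 ^ k - k - 1) *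
        ∑ h' ∈ tupZ n k N, ∏ j, wt N (dZ (Psi F j (toRR (Fin.cons h h' : Fin (k + 1) → Fin n → ℤ))))) := by
          refine mul_le_mul (pow_le_pow_left₀ (by positivity) hcard _) (Finset.sum_le_sum hG2)
            (Finset.sum_nonneg fun _ _ => by positivity) (by positivity)
      _ = _ := by
          rw [← Finset.mul_sum, ← mul_assoc, ← pow_add, sum_tupZ_succ]
          congr 2
          rw [pow_succ]; omega

end


-- part A4
section



/-! ### From weights to counting -/

lemma inv_le_aux (N t : ℝ) (hN : 1 ≤ N) :
    ⌊N * Int.fract t⌋₊ < ⌈N⌉₊ ∧ wt N (dZ t) ≤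
      N * (3 / ((⌊N * Int.fract t⌋₊ : ℝ) + 1) + 3 / ((⌈N⌉₊ : ℝ) - (⌊N * Int.fract t⌋₊ : ℝ))) := by
  have hN0 : 0 < N := by linarith
  have hf0 := Int.fract_nonneg t
  have hf1 := Int.fract_lt_one t
  set r := ⌊N * Int.fract t⌋₊ with hr
  set m := ⌈N⌉₊ with hm
  have hr1 : (r : ℝ) ≤ N * Int.fract t := Nat.floor_le (by positivity)
  have hr2 : N * Int.fract t < r + 1 := Nat.lt_floor_add_one _
  have hm1 : N ≤ m := Nat.le_ceil N
  have hm2 : (m : ℝ) < N + 1 := Nat.ceil_lt_add_one hN0.le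
  have hlt : (r : ℝ) < m := by nlinarith
  refine ⟨by exact_mod_cast hlt, ?_⟩
  have hr0 : (0 : ℝ) ≤ r := Nat.cast_nonneg r
  have hpos : 0 < (m : ℝ) - r := by linarith
  have hdz : (r : ℝ) ≤ N * dZ t ∨ N - 1 - r ≤ N * dZ t := by
    unfold dZ
    rw [abs_sub_round_eq_min]
    rcases min_choice (Int.fract t) (1 - Int.fract t) with h | h <;> rw [h]
    · left; linarith
    · right; nlinarith
  have hwN : wt N (dZ t) ≤ N := by
    unfold wt; split_ifs with h
    · exact le_rfl
    · push Not at h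
      have hd : 0 < dZ t := by
        rcases (dZ_nonneg t).lt_or_eq with h' | h'
        · exact h'
        · rw [← h'] at h; linarith
      rw [div_le_iff₀ hd]; linarith
  have hwt : ∀ x : ℝ, 1 ≤ x → x ≤ N * dZ t → wt N (dZ t) ≤ N / x := by
    intro x hx hx2
    unfold wt; split_ifs with h
    · have : x = 1 := by nlinarith
      rw [this]; simp
    · have hd : 0 < dZ t := by
        rcases (dZ_nonneg t).lt_or_eq with h' | h'
        · exact h'
        · rw [← h'] at h; exact absurd (by linarith) h
      rw [div_le_div_iff₀ hd (by linarith)]; linarith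
  rw [mul_add]
  have p1 : 0 ≤ N * (3 / ((r : ℝ) + 1)) := by positivity
  have p2 : 0 ≤ N * (3 / ((m : ℝ) - r)) := by positivity
  rcases hdz with h | h
  · have : wt N (dZ t) ≤ N * (3 / ((r : ℝ) + 1)) := by
      by_cases h1 : (1 : ℝ) ≤ r
      · refine (hwt r h1 h).trans ?_
        rw [mul_div_assoc', div_le_div_iff₀ (by linarith) (by linarith)]; nlinarith
      · push Not at h1
        refine hwN.trans ?_
        rw [mul_div_assoc', le_div_iff₀ (by linarith)]; nlinarith
    linarith
  · have : wt N (dZ t) ≤ N * (3 / ((m : ℝ) - r)) := by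
      by_cases h1 : (1 : ℝ) ≤ N - 1 - r
      · refine (hwt _ h1 h).trans ?_
        rw [mul_div_assoc', div_le_div_iff₀ (by linarith) (by linarith)]; nlinarith
      · push Not at h1
        refine hwN.trans ?_
        rw [mul_div_assoc', le_div_iff₀ (by linarith)]; nlinarith
    linarith

lemma sum_weights (N : ℝ) (hN : 1 ≤ N) :
    ∑ r ∈ Finset.range ⌈N⌉₊, N * (3 / ((r : ℝ) + 1) + 3 / ((⌈N⌉₊ : ℝ) - (r : ℝ))) ≤
      12 * N * (1 + Real.log N) := by
  set m := ⌈N⌉₊ with hm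
  have hm2 : (m : ℝ) < N + 1 := Nat.ceil_lt_add_one (by linarith)
  have hm1 : N ≤ m := Nat.le_ceil N
  have hH : ∑ r ∈ Finset.range m, 1 / ((r : ℝ) + 1) ≤ 1 + Real.log m := by
    have := harmonic_le_one_add_log m
    refine le_trans (le_of_eq ?_) this
    unfold harmonic; push_cast
    exact Finset.sum_congr rfl fun i _ => by rw [one_div]
  have hH2 : ∑ r ∈ Finset.range m, 1 / ((m : ℝ) - r) = ∑ r ∈ Finset.range m, 1 / ((r : ℝ) + 1) := by
    rw [← Finset.sum_range_reflect]
    refine Finset.sum_congr rfl fun r hr => ?_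
    have := Finset.mem_range.1 hr
    rw [Nat.sub_sub, Nat.cast_sub (by omega)]
    push_cast; congr 1; ring
  have hlog : Real.log m ≤ 1 + Real.log N := by
    have : Real.log m ≤ Real.log (2 * N) := Real.log_le_log (by linarith) (by linarith)
    rw [Real.log_mul (by norm_num) (by linarith)] at this
    have := Real.log_two_lt_d9
    linarith
  have hl0 : 0 ≤ Real.log N := Real.log_nonneg hN
  have : ∑ r ∈ Finset.range m, N * (3 / ((r : ℝ) + 1) + 3 / ((m : ℝ) - (r : ℝ))) =
      3 * N * (∑ r ∈ Finset.range m, 1 / ((r : ℝ) + 1) + ∑ r ∈ Finset.range m, 1 / ((m : ℝ) - r)) := by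
    rw [← Finset.sum_add_distrib, Finset.mul_sum]
    refine Finset.sum_congr rfl fun r _ => ?_
    ring
  rw [this, hH2]
  have : 3 * N * (∑ r ∈ Finset.range m, 1 / ((r : ℝ) + 1) + ∑ r ∈ Finset.range m, 1 / ((r : ℝ) + 1)) ≤
    3 * N * ((1 + (1 + Real.log N)) + (1 + (1 + Real.log N))) := by
    gcongr <;> linarith
  nlinarith

open Classical in
lemma logsum {n : ℕ} (N : ℝ) (hN : 1 ≤ N) (y : (Fin n → ℤ) → Fin n → ℝ)
    (hy : ∀ u u', y (u - u') = y u - y u') :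
    ∑ u ∈ boxZ n N, ∏ j, wt N (dZ (y u j)) ≤ (12 * N * (1 + Real.log N)) ^ n *
      (((boxZ n (2 * N)).filter fun u => ∀ j, dZ (y u j) ≤ 1 / N).card : ℝ) := by
  have hN0 : 0 < N := by linarith
  set Z := (boxZ n (2 * N)).filter fun u => ∀ j, dZ (y u j) ≤ 1 / N with hZ
  set m := ⌈N⌉₊ with hm
  set ρ : (Fin n → ℤ) → Fin n → ℕ := fun u j => ⌊N * Int.fract (y u j)⌋₊ with hρ
  set g : ℕ → ℝ := fun r => N * (3 / ((r : ℝ) + 1) + 3 / ((m : ℝ) - (r : ℝ))) with hg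
  have hmaps : ∀ u ∈ boxZ n N, ρ u ∈ Fintype.piFinset fun _ : Fin n => Finset.range m := by
    intro u _
    rw [Fintype.mem_piFinset]; intro j
    rw [Finset.mem_range]; exact (inv_le_aux N _ hN).1
  rw [← Finset.sum_fiberwise_of_maps_to hmaps]
  have hcount : ∀ r, (((boxZ n N).filter fun u => ρ u = r).card : ℝ) ≤ Z.card := by
    intro r
    rcases ((boxZ n N).filter fun u => ρ u = r).eq_empty_or_nonempty with h | ⟨u0, hu0⟩
    · rw [h]; simp
    · norm_cast
      refine Finset.card_le_card_of_injOn (fun u => u - u0) ?_ ?_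
      · intro u hu
        simp only [Finset.coe_filter, Set.mem_ofPred_eq, Finset.mem_filter] at hu hu0
        simp only [hZ, Finset.coe_filter, Set.mem_ofPred_eq]
        refine ⟨?_, fun j => ?_⟩
        · have h1 := mem_boxZ.1 hu.1
          have h2 := mem_boxZ.1 hu0.1
          rw [mem_boxZ]; intro j
          rw [Pi.sub_apply]; push_cast
          refine (abs_sub _ _).trans ?_
          linarith [h1 j, h2 j]
        · rw [hy]
          refine (dZ_le _ (⌊y u j⌋ - ⌊y u0 j⌋)).trans ?_
          have e : (y u - y u0) j - ((⌊y u j⌋ - ⌊y u0 j⌋ : ℤ) : ℝ) =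
            Int.fract (y u j) - Int.fract (y u0 j) := by
              rw [Pi.sub_apply]; unfold Int.fract; push_cast; ring
          rw [e, le_div_iff₀ hN0]
          have q1 : ⌊N * Int.fract (y u j)⌋₊ = ⌊N * Int.fract (y u0 j)⌋₊ := by
            have := hu.2.trans hu0.2.symm
            exact congrFun this j
          have a1 := Nat.floor_le (mul_nonneg hN0.le (Int.fract_nonneg (y u j)))
          have a2 := Nat.lt_floor_add_one (N * Int.fract (y u j))
          have b1 := Nat.floor_le (mul_nonneg hN0.le (Int.fract_nonneg (y u0 j)))
          have b2 := Nat.lt_floor_add_one (N * Int.fract (y u0 j))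
          rw [q1] at a1 a2
          rw [← abs_of_pos hN0, ← abs_mul, abs_le]
          constructor <;> nlinarith
      · intro a _ b _ h
        simpa using h
  have hg0 : ∀ r ∈ Finset.range m, 0 ≤ g r := by
    intro r hr
    have : (r : ℝ) < m := by exact_mod_cast Finset.mem_range.1 hr
    have : 0 < (m : ℝ) - r := by linarith
    rw [hg]; positivity
  calc _ ≤ ∑ r ∈ Fintype.piFinset fun _ : Fin n => Finset.range m, (∏ j, g (r j)) * (Z.card : ℝ) := by
        refine Finset.sum_le_sum fun r hr => ?_
        rw [Fintype.mem_piFinset] at hr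
        refine (Finset.sum_le_card_nsmul _ _ (∏ j, g (r j)) ?_).trans ?_
        · intro u hu
          refine Finset.prod_le_prod (fun j _ => wt_nonneg hN0.le) fun j _ => ?_
          rw [← (Finset.mem_filter.1 hu).2]
          exact (inv_le_aux N _ hN).2
        · rw [nsmul_eq_mul, mul_comm]
          exact mul_le_mul_of_nonneg_left (hcount r) (Finset.prod_nonneg fun j _ => hg0 _ (hr j))
    _ = (∑ r ∈ Finset.range m, g r) ^ n * (Z.card : ℝ) := by
        rw [← Finset.sum_mul, ← Finset.prod_univ_sum]
        simp
    _ ≤ _ := by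
        refine mul_le_mul_of_nonneg_right ?_ (Nat.cast_nonneg _)
        exact pow_le_pow_left₀ (Finset.sum_nonneg hg0) (sum_weights N hN) n

end


-- part A5
section



/-! ### The shrinking lemma -/

lemma packing {E : Type*} [NormedAddCommGroup E] [NormedSpace ℝ E] [FiniteDimensional ℝ E]
    (s : Finset E) (r : ℝ) (hr : 0 < r) (hr1 : r ≤ 1) (hs : ∀ c ∈ s, ‖c‖ ≤ 1)
    (h : ∀ c ∈ s, ∀ d ∈ s, c ≠ d → r ≤ ‖c - d‖) :
    (s.card : ℝ) ≤ (4 / r) ^ Module.finrank ℝ E := by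
  borelize E
  let μ : Measure E := Measure.addHaar
  set A := ⋃ c ∈ s, Metric.ball (c : E) (r / 2) with hA
  have D : Set.Pairwise (s : Set E) (Function.onFun Disjoint fun c => Metric.ball (c : E) (r / 2)) := by
    rintro c hc d hd hcd
    apply Metric.ball_disjoint_ball
    rw [dist_eq_norm]
    have := h c hc d hd hcd
    linarith
  have A_subset : A ⊆ Metric.ball (0 : E) 2 := by
    refine Set.iUnion₂_subset fun x hx => ?_
    apply Metric.ball_subset_ball'
    rw [dist_zero_right]
    have := hs x hx
    linarith
  have hr2 : 0 < r / 2 := by linarith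
  have I : (s.card : ENNReal) * ENNReal.ofReal ((r / 2) ^ Module.finrank ℝ E) * μ (Metric.ball 0 1) ≤
      ENNReal.ofReal (2 ^ Module.finrank ℝ E) * μ (Metric.ball 0 1) :=
    calc
      _ = μ A := by
        rw [hA, measure_biUnion_finset D fun c _ => measurableSet_ball]
        simp only [μ.addHaar_ball_of_pos _ hr2]
        simp only [Finset.sum_const, nsmul_eq_mul, mul_assoc]
      _ ≤ μ (Metric.ball (0 : E) 2) := measure_mono A_subset
      _ = _ := by
        simp only [μ.addHaar_ball_of_pos _ (show (0 : ℝ) < 2 by norm_num)]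
  have J : (s.card : ENNReal) * ENNReal.ofReal ((r / 2) ^ Module.finrank ℝ E) ≤
      ENNReal.ofReal (2 ^ Module.finrank ℝ E) :=
    (ENNReal.mul_le_mul_iff_left (Metric.measure_ball_pos _ _ zero_lt_one).ne' measure_ball_lt_top.ne).1 I
  have K := ENNReal.toReal_le_of_le_ofReal (by positivity) J
  rw [ENNReal.toReal_mul, ENNReal.toReal_natCast, ENNReal.toReal_ofReal (by positivity)] at K
  have : (4 / r) ^ Module.finrank ℝ E = 2 ^ Module.finrank ℝ E / (r / 2) ^ Module.finrank ℝ E := by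
    rw [← div_pow]; congr 1; field_simp; norm_num
  rw [this, le_div_iff₀ (by positivity)]
  exact K

open Classical in
lemma exists_net {ι E : Type*} [NormedAddCommGroup E] (v : ι → E) (r : ℝ) (B : Finset ι) :
    ∃ T ⊆ B, (∀ t ∈ T, ∀ t' ∈ T, t ≠ t' → r ≤ ‖v t - v t'‖) ∧ ∀ u ∈ B, u ∉ T → ∃ t ∈ T, ‖v u - v t‖ < r := by
  induction B using Finset.induction_on with
  | empty => exact ⟨∅, by simp⟩
  | insert a B ha ih =>
    obtain ⟨T, hT, h1, h2⟩ := ih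
    by_cases h : ∃ t ∈ T, ‖v a - v t‖ < r
    · refine ⟨T, hT.trans (Finset.subset_insert _ _), h1, ?_⟩
      intro u hu hu2
      rcases Finset.mem_insert.1 hu with rfl | hu
      · exact h
      · exact h2 u hu hu2
    · push Not at h
      refine ⟨insert a T, Finset.insert_subset_insert _ hT, ?_, ?_⟩
      · intro t ht t' ht' hne
        rcases Finset.mem_insert.1 ht with e | ht2
        · rcases Finset.mem_insert.1 ht' with e' | ht2'
          · exact absurd (e.trans e'.symm) hne
          · rw [e]; exact h _ ht2'
        · rcases Finset.mem_insert.1 ht' with e' | ht2'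
          · rw [norm_sub_rev, e']; exact h _ ht2
          · exact h1 _ ht2 _ ht2' hne
      · intro u hu hu2
        rcases Finset.mem_insert.1 hu with rfl | hu
        · exact absurd (Finset.mem_insert_self _ _) hu2
        · obtain ⟨t, ht, h3⟩ := h2 u hu (fun h => hu2 (Finset.mem_insert_of_mem h))
          exact ⟨t, Finset.mem_insert_of_mem ht, h3⟩

open Classical in
lemma cover_count {ι E : Type*} [NormedAddCommGroup E] [NormedSpace ℝ E] [FiniteDimensional ℝ E]
    (B : Finset ι) (v : ι → E) (V : Submodule ℝ E) (m : ℕ) (hV : Module.finrank ℝ V ≤ m)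
    (hvV : ∀ u ∈ B, v u ∈ V) (hv : ∀ u ∈ B, ‖v u‖ ≤ 1) (r : ℝ) (hr : 0 < r) (hr1 : r ≤ 1)
    (W : ℕ) (hW : ∀ t ∈ B, (B.filter fun u => ‖v u - v t‖ < r).card ≤ W) :
    (B.card : ℝ) ≤ (4 / r) ^ m * W := by
  obtain ⟨T, hT, h1, h2⟩ := exists_net v r B
  have hB : B ⊆ T.biUnion fun t => B.filter fun u => ‖v u - v t‖ < r := by
    intro u hu
    rw [Finset.mem_biUnion]
    by_cases h : u ∈ T
    · exact ⟨u, h, Finset.mem_filter.2 ⟨hu, by simpa using hr⟩⟩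
    · obtain ⟨t, ht, h3⟩ := h2 u hu h
      exact ⟨t, ht, Finset.mem_filter.2 ⟨hu, h3⟩⟩
  have hc : B.card ≤ T.card * W :=
    (Finset.card_le_card hB).trans (Finset.card_biUnion_le_card_mul _ _ _ fun t ht => hW t (hT ht))
  have hc' : (B.card : ℝ) ≤ T.card * W := by exact_mod_cast hc
  refine hc'.trans (mul_le_mul_of_nonneg_right ?_ (Nat.cast_nonneg _))
  set w : T → V := fun t => ⟨v t.1, hvV _ (hT t.2)⟩ with hw
  have winj : Function.Injective w := by
    intro t t' h
    by_contra hne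
    have h3 := h1 _ t.2 _ t'.2 (fun h => hne (Subtype.ext h))
    have h4 : v t.1 = v t'.1 := congrArg Subtype.val h
    rw [h4] at h3; simp at h3; linarith
  have hpk := packing (Finset.univ.image w) r hr hr1 ?_ ?_
  · rw [Finset.card_image_of_injective _ winj, Finset.card_univ, Fintype.card_coe] at hpk
    refine hpk.trans (pow_le_pow_right₀ ?_ hV)
    rw [le_div_iff₀ hr]; linarith
  · intro c hc
    obtain ⟨t, _, rfl⟩ := Finset.mem_image.1 hc
    exact hv _ (hT t.2)
  · intro c hc d hd hcd
    obtain ⟨t, _, rfl⟩ := Finset.mem_image.1 hc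
    obtain ⟨t', _, rfl⟩ := Finset.mem_image.1 hd
    refine h1 _ t.2 _ t'.2 fun h => hcd ?_
    rw [Subtype.ext h]

/-- the standard symplectic form, curried -/
def sympl (n : ℕ) : ((Fin n → ℝ) × (Fin n → ℝ)) →ₗ[ℝ] Module.Dual ℝ ((Fin n → ℝ) × (Fin n → ℝ)) :=
  LinearMap.mk₂ ℝ (fun p q => p.1 ⬝ᵥ q.2 - q.1 ⬝ᵥ p.2)
    (by intro a b c; simp [add_dotProduct, dotProduct_add]; ring)
    (by intro a b c; simp; ring)
    (by intro a b c; simp [add_dotProduct, dotProduct_add]; ring)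
    (by intro a b c; simp; ring)

lemma sympl_apply (n : ℕ) (p q : (Fin n → ℝ) × (Fin n → ℝ)) :
    sympl n p q = p.1 ⬝ᵥ q.2 - q.1 ⬝ᵥ p.2 := rfl

lemma sympl_inj (n : ℕ) : Function.Injective (sympl n) := by
  rw [← LinearMap.ker_eq_bot, LinearMap.ker_eq_bot']
  intro p hp
  have h1 : ∀ j, p.1 j = 0 := by
    intro j
    have := LinearMap.congr_fun hp (0, Pi.single j 1)
    simpa [sympl_apply] using this
  have h2 : ∀ j, p.2 j = 0 := by
    intro j
    have := LinearMap.congr_fun hp (Pi.single j 1, 0)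
    simpa [sympl_apply] using this
  exact Prod.ext (funext h1) (funext h2)

lemma isotropic_finrank (n : ℕ) (V : Submodule ℝ ((Fin n → ℝ) × (Fin n → ℝ)))
    (hV : ∀ p ∈ V, ∀ q ∈ V, sympl n p q = 0) : Module.finrank ℝ V ≤ n := by
  have h1 : V.map (sympl n) ≤ V.dualAnnihilator := by
    rintro _ ⟨p, hp, rfl⟩
    rw [Submodule.mem_dualAnnihilator]
    exact hV p hp
  have h2 := Submodule.finrank_mono h1
  have h3 : Module.finrank ℝ (V.map (sympl n)) = Module.finrank ℝ V :=
    (Submodule.equivMapOfInjective (sympl n) (sympl_inj n) V).finrank_eq.symm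
  have h4 := Subspace.finrank_add_finrank_dualAnnihilator_eq V
  have h5 : Module.finrank ℝ ((Fin n → ℝ) × (Fin n → ℝ)) = n + n := by simp
  omega


/-- the linear form `(Lu)_j` -/
def lf {n : ℕ} (L : Fin n → Fin n → ℝ) (u : Fin n → ℤ) (j : Fin n) : ℝ := ∑ l, L j l * (u l : ℝ)

lemma lf_sub {n : ℕ} (L : Fin n → Fin n → ℝ) (u u' : Fin n → ℤ) (j : Fin n) :
    lf L (u - u') j = lf L u j - lf L u' j := by
  unfold lf
  rw [← Finset.sum_sub_distrib]
  refine Finset.sum_congr rfl fun l _ => ?_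
  rw [Pi.sub_apply]; push_cast; ring

open Classical in
/-- points of the box with small `Lu` modulo one -/
def ZC {n : ℕ} (L : Fin n → Fin n → ℝ) (M τ : ℝ) : Finset (Fin n → ℤ) :=
  (boxZ n M).filter fun u => ∀ j, dZ (lf L u j) ≤ τ

lemma mem_ZC {n : ℕ} {L : Fin n → Fin n → ℝ} {M τ : ℝ} {u : Fin n → ℤ} :
    u ∈ ZC L M τ ↔ (∀ j, |(u j : ℝ)| ≤ M) ∧ ∀ j, dZ (lf L u j) ≤ τ := by
  unfold ZC; rw [Finset.mem_filter, mem_boxZ]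

/-- the vector attached to `u` -/
def vecU {n : ℕ} (L : Fin n → Fin n → ℝ) (M τ : ℝ) (u : Fin n → ℤ) : (Fin n → ℝ) × (Fin n → ℝ) :=
  (fun j => (u j : ℝ) / M, fun j => (lf L u j - round (lf L u j)) / τ)

lemma vecU_norm_le {n : ℕ} {L : Fin n → Fin n → ℝ} {M τ s : ℝ} (hM : 0 < M) (hτ : 0 < τ)
    (hs : 0 ≤ s) {u : Fin n → ℤ} (hu : u ∈ ZC L (s * M) (s * τ)) : ‖vecU L M τ u‖ ≤ s := by
  obtain ⟨h1, h2⟩ := mem_ZC.1 hu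
  unfold vecU
  rw [Prod.norm_mk, max_le_iff, pi_norm_le_iff_of_nonneg hs, pi_norm_le_iff_of_nonneg hs]
  constructor <;> intro j <;> rw [Real.norm_eq_abs, abs_div]
  · rw [abs_of_pos hM, div_le_iff₀ hM]; exact h1 j
  · rw [abs_of_pos hτ, div_le_iff₀ hτ]; exact h2 j

lemma vecU_close {n : ℕ} {L : Fin n → Fin n → ℝ} {M τ r : ℝ} (hM : 0 < M) (hτ : 0 < τ)
    {u t : Fin n → ℤ} (h : ‖vecU L M τ u - vecU L M τ t‖ < r) : u - t ∈ ZC L (r * M) (r * τ) := by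
  have hr : 0 ≤ r := (norm_nonneg _).trans h.le
  have h := h.le
  unfold vecU at h
  rw [Prod.mk_sub_mk, Prod.norm_mk, max_le_iff, pi_norm_le_iff_of_nonneg hr,
    pi_norm_le_iff_of_nonneg hr] at h
  obtain ⟨h1, h2⟩ := h
  rw [mem_ZC]
  constructor
  · intro j
    have := h1 j
    rw [Pi.sub_apply, ← sub_div, Real.norm_eq_abs, abs_div, abs_of_pos hM, div_le_iff₀ hM] at this
    rw [Pi.sub_apply]; push_cast; exact this
  · intro j
    have := h2 j
    rw [Pi.sub_apply, ← sub_div, Real.norm_eq_abs, abs_div, abs_of_pos hτ, div_le_iff₀ hτ] at this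
    rw [lf_sub]
    refine (dZ_le _ (round (lf L u j) - round (lf L t j))).trans (le_trans (le_of_eq ?_) this)
    push_cast; congr 1; ring

open Classical in
lemma ZC_fibre {n : ℕ} (L : Fin n → Fin n → ℝ) (M τ r : ℝ) (hM : 0 < M) (hτ : 0 < τ)
    (B : Finset (Fin n → ℤ)) (t : Fin n → ℤ) :
    (B.filter fun u => ‖vecU L M τ u - vecU L M τ t‖ < r).card ≤ (ZC L (r * M) (r * τ)).card := by
  refine Finset.card_le_card_of_injOn (fun u => u - t) ?_ ?_
  · intro u hu
    exact vecU_close hM hτ (Finset.mem_filter.1 hu).2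
  · intro a _ b _ h
    simpa using h

lemma vecU_isotropic {n : ℕ} (L : Fin n → Fin n → ℝ) (hL : ∀ i j, L i j = L j i) {M τ s : ℝ}
    (hM : 0 < M) (hτ : 0 < τ) (hs : 0 ≤ s) (hsm : 2 * n * s ^ 2 * (M * τ) < 1) {u u' : Fin n → ℤ}
    (hu : u ∈ ZC L (s * M) (s * τ)) (hu' : u' ∈ ZC L (s * M) (s * τ)) :
    sympl n (vecU L M τ u) (vecU L M τ u') = 0 := by
  rw [sympl_apply]
  have key : (vecU L M τ u).1 ⬝ᵥ (vecU L M τ u').2 - (vecU L M τ u').1 ⬝ᵥ (vecU L M τ u).2 =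
      (((∑ j, u' j * round (lf L u j) - ∑ j, u j * round (lf L u' j) : ℤ)) : ℝ) / (M * τ) := by
    have e1 : ∑ j, (u j : ℝ) * lf L u' j = ∑ j, (u' j : ℝ) * lf L u j := by
      unfold lf
      simp_rw [Finset.mul_sum]
      rw [Finset.sum_comm]
      refine Finset.sum_congr rfl fun i _ => Finset.sum_congr rfl fun j _ => ?_
      rw [hL i j]; ring
    have e2 : ∀ a b : Fin n → ℤ, (vecU L M τ a).1 ⬝ᵥ (vecU L M τ b).2 =
        (∑ j, (a j : ℝ) * lf L b j - ∑ j, (a j : ℝ) * round (lf L b j)) / (M * τ) := by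
      intro a b
      unfold vecU dotProduct
      rw [← Finset.sum_sub_distrib, Finset.sum_div]
      refine Finset.sum_congr rfl fun j _ => ?_
      field_simp
    rw [e2, e2, e1]; push_cast; ring
  rw [key]
  have hb : |(vecU L M τ u).1 ⬝ᵥ (vecU L M τ u').2 - (vecU L M τ u').1 ⬝ᵥ (vecU L M τ u).2| ≤
      2 * n * s ^ 2 := by
    have n1 := vecU_norm_le hM hτ hs hu
    have n2 := vecU_norm_le hM hτ hs hu'
    have hd : ∀ p q : (Fin n → ℝ) × (Fin n → ℝ), ‖p‖ ≤ s → ‖q‖ ≤ s → |p.1 ⬝ᵥ q.2| ≤ n * s ^ 2 := by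
      intro p q hp hq
      unfold dotProduct
      refine (Finset.abs_sum_le_sum_abs _ _).trans ?_
      have : ∀ j ∈ Finset.univ, |p.1 j * q.2 j| ≤ s ^ 2 := by
        intro j _
        rw [abs_mul, sq]
        have a1 : |p.1 j| ≤ s := (norm_le_pi_norm p.1 j).trans ((norm_fst_le p).trans hp)
        have a2 : |q.2 j| ≤ s := (norm_le_pi_norm q.2 j).trans ((norm_snd_le q).trans hq)
        exact mul_le_mul a1 a2 (abs_nonneg _) hs
      refine (Finset.sum_le_card_nsmul _ _ _ this).trans (le_of_eq ?_)
      simp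
    have := abs_sub ((vecU L M τ u).1 ⬝ᵥ (vecU L M τ u').2) ((vecU L M τ u').1 ⬝ᵥ (vecU L M τ u).2)
    linarith [hd _ _ n1 n2, hd _ _ n2 n1]
  rw [key] at hb
  set z : ℤ := ∑ j, u' j * round (lf L u j) - ∑ j, u j * round (lf L u' j) with hz
  have hz0 : z = 0 := by
    rw [abs_div, abs_of_pos (mul_pos hM hτ), div_le_iff₀ (mul_pos hM hτ)] at hb
    have : |(z : ℝ)| < 1 := lt_of_le_of_lt hb hsm
    rw [← Int.cast_abs] at this
    have : |z| < 1 := by exact_mod_cast this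
    exact Int.abs_lt_one_iff.1 this
  rw [hz0]; simp

lemma shrink (n : ℕ) : ∃ c : ℝ, 0 < c ∧ ∀ (L : Fin n → Fin n → ℝ), (∀ i j, L i j = L j i) →
    ∀ M τ lam : ℝ, 0 < M → 0 < τ → M * τ ≤ 2 → 0 < lam → lam ≤ 1 →
    ((ZC L M τ).card : ℝ) ≤ c * (1 / lam) ^ n * ((ZC L (lam * M) (lam * τ)).card : ℝ) := by
  set s : ℝ := 1 / (2 * n + 2) with hs
  have hs0 : 0 < s := by positivity
  have hs1 : s ≤ 1 := by rw [hs, div_le_one (by positivity)]; have : (0 : ℝ) ≤ n := by positivity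
                         linarith
  refine ⟨(4 / s) ^ (n + n) * 4 ^ n, by positivity, ?_⟩
  intro L hL M τ lam hM hτ hMτ hlam hlam1
  have hE : Module.finrank ℝ ((Fin n → ℝ) × (Fin n → ℝ)) = n + n := by simp
  have h1 : ((ZC L M τ).card : ℝ) ≤ (4 / s) ^ (n + n) * ((ZC L (s * M) (s * τ)).card : ℕ) := by
    refine cover_count (ZC L M τ) (vecU L M τ) ⊤ (n + n) ?_ (fun _ _ => trivial) ?_ s hs0 hs1 _ ?_
    · rw [finrank_top, hE]
    · intro u hu
      refine vecU_norm_le hM hτ zero_le_one ?_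
      simpa using hu
    · intro t _; exact ZC_fibre L M τ s hM hτ _ t
  have hsm : 2 * n * s ^ 2 * (M * τ) < 1 := by
    have hn : (0 : ℝ) ≤ n := by positivity
    have : 2 * n * s ^ 2 * (M * τ) ≤ 2 * n * s ^ 2 * 2 := by gcongr
    refine lt_of_le_of_lt this ?_
    rw [hs, div_pow, one_pow, mul_one_div, div_mul_eq_mul_div, div_lt_one (by positivity)]
    nlinarith
  have h2 : ((ZC L (s * M) (s * τ)).card : ℝ) ≤ (4 / lam) ^ n * ((ZC L (lam * M) (lam * τ)).card : ℕ) := by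
    set V := Submodule.span ℝ (vecU L M τ '' (ZC L (s * M) (s * τ) : Set (Fin n → ℤ))) with hV
    refine cover_count (ZC L (s * M) (s * τ)) (vecU L M τ) V n ?_ ?_ ?_ lam hlam hlam1 _ ?_
    · refine isotropic_finrank n V ?_
      intro p hp q hq
      induction hp using Submodule.span_induction with
      | mem x hx =>
        obtain ⟨u, hu, rfl⟩ := hx
        induction hq using Submodule.span_induction with
        | mem x hx =>
          obtain ⟨u', hu', rfl⟩ := hx
          exact vecU_isotropic L hL hM hτ hs0.le hsm hu hu'
        | zero => simp
        | add x y _ _ h1 h2 => rw [map_add, h1, h2, add_zero]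
        | smul a x _ h => rw [map_smul, h, smul_zero]
      | zero => simp
      | add x y _ _ h1 h2 => rw [map_add, LinearMap.add_apply, h1, h2, add_zero]
      | smul a x _ h => rw [map_smul, LinearMap.smul_apply, h, smul_zero]
    · intro u hu
      exact Submodule.subset_span ⟨u, hu, rfl⟩
    · intro u hu
      exact (vecU_norm_le hM hτ hs0.le hu).trans hs1
    · intro t _; exact ZC_fibre L M τ lam hM hτ _ t
  calc ((ZC L M τ).card : ℝ) ≤ (4 / s) ^ (n + n) * ((ZC L (s * M) (s * τ)).card : ℝ) := h1
    _ ≤ (4 / s) ^ (n + n) * ((4 / lam) ^ n * ((ZC L (lam * M) (lam * τ)).card : ℝ)) := by gcongr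
    _ = _ := by rw [div_pow 4 lam, div_pow 1 lam, one_pow]; ring

end


-- part A6
section



/-! ### Shrinking in all variables -/

/-- multilinear in each variable with symmetric matrix -/
def SymMul {n k : ℕ} (Y : (Fin k → Fin n → ℤ) → Fin n → ℝ) : Prop :=
  ∀ (i : Fin k) (h : Fin k → Fin n → ℤ), ∃ L : Fin n → Fin n → ℝ, (∀ a b, L a b = L b a) ∧
    ∀ u, Y (Function.update h i u) = lf L u

open Classical in
/-- tuples with small value modulo one -/
def TC {n k : ℕ} (Y : (Fin k → Fin n → ℤ) → Fin n → ℝ) (M τ : ℝ) : Finset (Fin k → Fin n → ℤ) :=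
  (tupZ n k M).filter fun h => ∀ j, dZ (Y h j) ≤ τ

open Classical in
lemma card_TC_succ {n k : ℕ} (Y : (Fin (k + 1) → Fin n → ℤ) → Fin n → ℝ) (M τ : ℝ) :
    ((TC Y M τ).card : ℝ) = ∑ a ∈ boxZ n M,
      ((TC (fun h : Fin k → Fin n → ℤ => Y (Fin.cons a h)) M τ).card : ℝ) := by
  unfold TC
  simp_rw [Finset.card_filter]
  push_cast
  rw [sum_tupZ_succ]

open Classical in
lemma multi_shrink (n k : ℕ) : ∃ c : ℝ, 0 < c ∧
    ∀ (Y : (Fin k → Fin n → ℤ) → Fin n → ℝ), SymMul Y →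
    ∀ M τ lam : ℝ, 0 < M → 0 < τ → M * τ ≤ 2 → 0 < lam → lam ≤ 1 →
    ((TC Y M τ).card : ℝ) ≤ c * (1 / lam) ^ (n * k) * ((TC Y (lam * M) (lam ^ k * τ)).card : ℝ) := by
  induction k with
  | zero =>
    refine ⟨1, one_pos, ?_⟩
    intro Y hY M τ lam _ _ _ _ _
    simp only [mul_zero, pow_zero, one_mul]
    refine le_of_eq ?_
    congr 2
  | succ k ih =>
    obtain ⟨c1, hc1, h1⟩ := ih
    obtain ⟨c2, hc2, h2⟩ := shrink n
    refine ⟨c1 * c2, by positivity, ?_⟩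
    intro Y hY M τ lam hM hτ hMτ hlam hlam1
    have hlk : lam ^ k ≤ 1 := pow_le_one₀ hlam.le hlam1
    have hlk0 : 0 < lam ^ k := by positivity
    have hYa : ∀ a, SymMul (fun h : Fin k → Fin n → ℤ => Y (Fin.cons a h)) := by
      intro a i h
      obtain ⟨L, hL, h3⟩ := hY i.succ (Fin.cons a h)
      refine ⟨L, hL, fun u => ?_⟩
      rw [← h3]
      simp only
      rw [Fin.cons_update]
    rw [card_TC_succ]
    have step1 : ∑ a ∈ boxZ n M, ((TC (fun h : Fin k → Fin n → ℤ => Y (Fin.cons a h)) M τ).card : ℝ) ≤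
        ∑ a ∈ boxZ n M, c1 * (1 / lam) ^ (n * k) *
        ((TC (fun h : Fin k → Fin n → ℤ => Y (Fin.cons a h)) (lam * M) (lam ^ k * τ)).card : ℝ) :=
      Finset.sum_le_sum fun a _ => h1 _ (hYa a) M τ lam hM hτ hMτ hlam hlam1
    have swap : ∀ M' τ', ∑ a ∈ boxZ n M', ((TC (fun h : Fin k → Fin n → ℤ => Y (Fin.cons a h))
        (lam * M) τ').card : ℝ) =
        ∑ h ∈ tupZ n k (lam * M),
          (((boxZ n M').filter fun a => ∀ j, dZ (Y (Fin.cons a h) j) ≤ τ').card : ℝ) := by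
      intro M' τ'
      unfold TC
      simp_rw [Finset.card_filter]
      push_cast
      rw [Finset.sum_comm]
    have step2 : ∀ h ∈ tupZ n k (lam * M),
        (((boxZ n M).filter fun a => ∀ j, dZ (Y (Fin.cons a h) j) ≤ lam ^ k * τ).card : ℝ) ≤
        c2 * (1 / lam) ^ n * (((boxZ n (lam * M)).filter
          fun a => ∀ j, dZ (Y (Fin.cons a h) j) ≤ lam ^ (k + 1) * τ).card : ℝ) := by
      intro h _
      obtain ⟨L, hL, h3⟩ := hY 0 (Fin.cons 0 h)
      have h4 : ∀ a, Y (Fin.cons a h) = lf L a := by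
        intro a; rw [← h3, Fin.update_cons_zero]
      have h5 := h2 L hL M (lam ^ k * τ) lam hM (by positivity) ?_ hlam hlam1
      · unfold ZC at h5
        simp_rw [h4]
        rw [pow_succ', mul_assoc lam]
        exact h5
      · calc M * (lam ^ k * τ) = (M * τ) * lam ^ k := by ring
          _ ≤ M * τ * 1 := by gcongr
          _ ≤ 2 := by linarith
    calc _ ≤ _ := step1
      _ = c1 * (1 / lam) ^ (n * k) * ∑ h ∈ tupZ n k (lam * M),
          (((boxZ n M).filter fun a => ∀ j, dZ (Y (Fin.cons a h) j) ≤ lam ^ k * τ).card : ℝ) := by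
          rw [← Finset.mul_sum, swap]
      _ ≤ c1 * (1 / lam) ^ (n * k) * ∑ h ∈ tupZ n k (lam * M), (c2 * (1 / lam) ^ n *
          (((boxZ n (lam * M)).filter
          fun a => ∀ j, dZ (Y (Fin.cons a h) j) ≤ lam ^ (k + 1) * τ).card : ℝ)) := by
          gcongr with h hh
          exact step2 h hh
      _ = _ := by
          rw [← Finset.mul_sum, ← swap, ← card_TC_succ]
          rw [Nat.mul_succ, pow_add]; ring

lemma fexp_erase {n k : ℕ} (v : Fin k → Fin n) (i : Fin k) :
    fexp v = Finsupp.single (v i) 1 + ∑ i' ∈ Finset.univ.erase i, Finsupp.single (v i') 1 := by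
  unfold fexp
  exact (Finset.add_sum_erase _ (fun i => Finsupp.single (v i) 1) (Finset.mem_univ i)).symm

lemma symMul_Psi {n k : ℕ} (F : MvPolynomial (Fin n) ℝ) :
    SymMul (fun (h : Fin k → Fin n → ℤ) j => Psi F j (toRR h)) := by
  intro i h
  refine ⟨fun j l => ∑ v : Fin k → Fin n, if v i = l then
    Tn F (Fin.cons j v : Fin (k + 1) → Fin n) * ∏ i' ∈ Finset.univ.erase i, (h i' (v i') : ℝ) else 0,
    ?_, ?_⟩
  · intro a b
    beta_reduce
    rw [← Finset.sum_filter, ← Finset.sum_filter]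
    refine Finset.sum_nbij' (fun v => Function.update v i a) (fun v => Function.update v i b)
      ?_ ?_ ?_ ?_ ?_
    · intro v _; simp
    · intro v _; simp
    · intro v hv
      simp only [Finset.mem_filter, Finset.mem_univ, true_and] at hv
      rw [Function.update_idem, ← hv, Function.update_eq_self]
    · intro v hv
      simp only [Finset.mem_filter, Finset.mem_univ, true_and] at hv
      rw [Function.update_idem, ← hv, Function.update_eq_self]
    · intro v hv
      simp only [Finset.mem_filter, Finset.mem_univ, true_and] at hv
      have e1 : fexp (Fin.cons a v : Fin (k + 1) → Fin n) =
          fexp (Fin.cons b (Function.update v i a) : Fin (k + 1) → Fin n) := by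
        rw [fexp_cons, fexp_cons, fexp_erase v i, fexp_erase _ i, Function.update_self, hv]
        have : ∑ i' ∈ Finset.univ.erase i, Finsupp.single (Function.update v i a i') 1 =
          ∑ i' ∈ Finset.univ.erase i, Finsupp.single (v i') 1 := by
          refine Finset.sum_congr rfl fun i' hi' => ?_
          rw [Function.update_of_ne (Finset.ne_of_mem_erase hi')]
        rw [this]; abel
      unfold Tn
      rw [e1]
      congr 1
      refine Finset.prod_congr rfl fun i' hi' => ?_
      rw [Function.update_of_ne (Finset.ne_of_mem_erase hi')]
  · intro u
    funext j
    unfold lf Psi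
    simp_rw [Finset.sum_mul]
    rw [Finset.sum_comm]
    refine Finset.sum_congr rfl fun v _ => ?_
    simp_rw [ite_mul, zero_mul]
    rw [Finset.sum_ite_eq]
    simp only [Finset.mem_univ, if_true]
    rw [← Finset.mul_prod_erase _ _ (Finset.mem_univ i)]
    have : ∏ i' ∈ Finset.univ.erase i, toRR (Function.update h i u) i' (v i') =
        ∏ i' ∈ Finset.univ.erase i, (h i' (v i') : ℝ) := by
      refine Finset.prod_congr rfl fun i' hi' => ?_
      unfold toRR toR
      rw [Function.update_of_ne (Finset.ne_of_mem_erase hi')]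
    rw [this]
    unfold toRR toR
    rw [Function.update_self]; ring

open Classical in
lemma weyl_count (n k : ℕ) : ∃ c : ℝ, 0 < c ∧ ∀ (F : MvPolynomial (Fin n) ℝ), dlt (k + 3) F →
    ∀ N H : ℝ, 1 ≤ H → H ≤ N → ∀ (lo hi : Fin n → ℤ), (∀ j, (hi j - lo j + 1 : ℝ) ≤ N) →
    ‖∑ x ∈ Finset.Icc lo hi, eC (eval (toR x) F)‖ ^ (2 ^ (k + 1)) ≤
      c * N ^ (n * 2 ^ (k + 1)) * (1 + Real.log N) ^ n * (H ^ (n * (k + 1)))⁻¹ *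
      ((TC (fun (h : Fin (k + 1) → Fin n → ℤ) j => Psi F j (toRR h)) H
        (H ^ (k + 1) / N ^ (k + 2))).card : ℝ) := by
  obtain ⟨c, hc, hms⟩ := multi_shrink n (k + 1)
  refine ⟨(3 ^ n) ^ (2 ^ (k + 1) - (k + 1) - 1) * 12 ^ n * c * 2 ^ (n * (k + 1)), by positivity, ?_⟩
  intro F hF N H hH hHN lo hi hN
  have hN1 : 1 ≤ N := hH.trans hHN
  have hN0 : 0 < N := by linarith
  have hH0 : 0 < H := by linarith
  have hlog : 0 ≤ Real.log N := Real.log_nonneg hN1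
  set Y : (Fin (k + 1) → Fin n → ℤ) → Fin n → ℝ := fun h j => Psi F j (toRR h) with hY
  have hw := weyl_diff N hN1 (k + 1) F hF lo hi hN
  have hs : SymMul Y := symMul_Psi F
  have h1 : ∑ h ∈ tupZ n (k + 1) N, ∏ j, wt N (dZ (Psi F j (toRR h))) ≤
      (12 * N * (1 + Real.log N)) ^ n * ((TC Y (2 * N) (1 / N)).card : ℝ) := by
    rw [sum_tupZ_succ, Finset.sum_comm]
    have : ∀ h ∈ tupZ n k N, ∑ a ∈ boxZ n N,
        ∏ j, wt N (dZ (Psi F j (toRR (Fin.cons a h : Fin (k + 1) → Fin n → ℤ)))) ≤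
        (12 * N * (1 + Real.log N)) ^ n * (((boxZ n (2 * N)).filter
          fun a => ∀ j, dZ (Y (Fin.cons a h) j) ≤ 1 / N).card : ℝ) := by
      intro h _
      obtain ⟨L, hL, h3⟩ := hs 0 (Fin.cons 0 h)
      have h4 : ∀ a, Y (Fin.cons a h) = lf L a := by
        intro a; rw [← h3, Fin.update_cons_zero]
      refine logsum N hN1 (fun a => Y (Fin.cons a h)) ?_
      intro u u'
      simp only [h4]
      funext j
      exact lf_sub L u u' j
    refine (Finset.sum_le_sum this).trans ?_
    rw [← Finset.mul_sum]
    refine mul_le_mul_of_nonneg_left ?_ (by positivity)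
    have h5 : ∑ h ∈ tupZ n k N, (((boxZ n (2 * N)).filter
          fun a => ∀ j, dZ (Y (Fin.cons a h) j) ≤ 1 / N).card : ℝ) ≤
        ∑ h ∈ tupZ n k (2 * N), (((boxZ n (2 * N)).filter
          fun a => ∀ j, dZ (Y (Fin.cons a h) j) ≤ 1 / N).card : ℝ) := by
      refine Finset.sum_le_sum_of_subset_of_nonneg ?_ (fun _ _ _ => Nat.cast_nonneg _)
      intro h hh
      rw [mem_tupZ] at hh ⊢
      intro i
      have := mem_boxZ.1 (hh i)
      rw [mem_boxZ]; intro j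
      linarith [this j]
    refine h5.trans (le_of_eq ?_)
    unfold TC
    simp_rw [Finset.card_filter]
    push_cast
    rw [Finset.sum_comm, sum_tupZ_succ]
  have h2 := hms Y hs (2 * N) (1 / N) (H / (2 * N)) (by positivity) (by positivity)
    (by field_simp; norm_num) (by positivity) (by rw [div_le_one (by positivity)]; linarith)
  have h3 : ((TC Y (H / (2 * N) * (2 * N)) ((H / (2 * N)) ^ (k + 1) * (1 / N))).card : ℝ) ≤
      ((TC Y H (H ^ (k + 1) / N ^ (k + 2))).card : ℝ) := by
    have e : H / (2 * N) * (2 * N) = H := by field_simp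
    rw [e]
    norm_cast
    refine Finset.card_le_card ?_
    unfold TC
    refine Finset.monotone_filter_right _ ?_
    intro h _ hh j
    refine (hh j).trans ?_
    rw [div_pow, div_mul_div_comm, mul_one, mul_pow]
    refine div_le_div_of_nonneg_left (by positivity) (by positivity) ?_
    rw [pow_succ N (k + 1), mul_assoc]
    refine le_mul_of_one_le_left (by positivity) (one_le_pow₀ (by norm_num))
  have hexp : n * (2 ^ (k + 1) - (k + 1) - 1) + n + n * (k + 1) = n * 2 ^ (k + 1) := by
    have : k + 1 + 1 ≤ 2 ^ (k + 1) := Nat.lt_two_pow_self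
    rw [← Nat.mul_succ, ← Nat.mul_add]; congr 1; omega
  calc _ ≤ _ := hw
    _ ≤ ((3 * N) ^ n) ^ (2 ^ (k + 1) - (k + 1) - 1) * ((12 * N * (1 + Real.log N)) ^ n *
        (c * (1 / (H / (2 * N))) ^ (n * (k + 1)) * ((TC Y H (H ^ (k + 1) / N ^ (k + 2))).card : ℝ))) := by
        have e1 : 2 * N + 1 ≤ 3 * N := by linarith
        refine mul_le_mul (by gcongr) (h1.trans ?_) ?_ (by positivity)
        · refine mul_le_mul_of_nonneg_left (h2.trans ?_) (by positivity)
          exact mul_le_mul_of_nonneg_left h3 (by positivity)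
        · exact Finset.sum_nonneg fun h _ => Finset.prod_nonneg fun j _ => wt_nonneg hN0.le
    _ = _ := by
        rw [← hexp, one_div_div, div_pow, mul_pow (12 * N), mul_pow 12, mul_pow 3, mul_pow (3 ^ n), mul_pow 2, pow_add, pow_add, pow_mul N n]
        ring

end


-- part B1
section


section Fibre
variable {n : ℕ} {k : Type*} [Field k]

lemma exists_split_degree (t : ℕ) : ∀ (s : ℕ) (m : Fin n →₀ ℕ), Finsupp.degree m = t + s →
    ∃ w μ : Fin n →₀ ℕ, m = w + μ ∧ Finsupp.degree μ = t ∧ Finsupp.degree w = s := by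
  intro s
  induction s with
  | zero => intro m hm; exact ⟨0, m, by simp, by simpa using hm, by simp⟩
  | succ s ih =>
    intro m hm
    have hne : m ≠ 0 := by
      rintro rfl
      simp at hm
    obtain ⟨j, hj⟩ := Finsupp.ne_iff.mp hne
    have hj1 : 1 ≤ m j := Nat.one_le_iff_ne_zero.mpr (by simpa using hj)
    have hle : Finsupp.single j 1 ≤ m := by
      rw [Finsupp.single_le_iff]; exact hj1
    have hdec : m = Finsupp.single j 1 + (m - Finsupp.single j 1) := (add_tsub_cancel_of_le hle).symm
    have hdeg : Finsupp.degree (m - Finsupp.single j 1) = t + s := by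
      have := congrArg Finsupp.degree hdec
      rw [map_add, hm, Finsupp.degree_single] at this
      omega
    obtain ⟨w, μ, h1, h2, h3⟩ := ih _ hdeg
    refine ⟨Finsupp.single j 1 + w, μ, ?_, h2, ?_⟩
    · rw [hdec, h1, add_assoc]
    · rw [map_add, h3, Finsupp.degree_single]; omega

/-- all monomials of degree `t` lie in the ideal of the `q i`, with degree control -/
def GoodId {ι : Type*} [Fintype ι] (t : ℕ) (q : ι → MvPolynomial (Fin n) k) (e : ι → ℕ) : Prop :=
  (∀ i, e i ≤ t) ∧ ∀ μ : Fin n →₀ ℕ, Finsupp.degree μ = t →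
    ∃ c : ι → MvPolynomial (Fin n) k, (∀ i, dlt (t - e i + 1) (c i)) ∧
      monomial μ (1 : k) = ∑ i, c i * q i

def dltSub (n : ℕ) (k : Type*) [Field k] (s : ℕ) : Submodule k (MvPolynomial (Fin n) k) where
  carrier := {p | dlt s p}
  add_mem' := fun h1 h2 => dlt_add h1 h2
  zero_mem' := dlt_zero
  smul_mem' := fun c p hp => by
    have : c • p = C c * p := by rw [MvPolynomial.smul_eq_C_mul]
    show dlt s (c • p)
    rw [this]; exact dlt_C_mul c hp

def evZ (Z : Finset (Fin n → k)) : MvPolynomial (Fin n) k →ₗ[k] (Z → k) :=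
  LinearMap.pi fun z => (MvPolynomial.aeval (z : Fin n → k)).toLinearMap

lemma evZ_apply (Z : Finset (Fin n → k)) (p : MvPolynomial (Fin n) k) (z : Z) :
    evZ Z p z = eval (z : Fin n → k) p := by
  simp [evZ, MvPolynomial.aeval_eq_eval]

lemma dlt_monomial {s : ℕ} (m : Fin n →₀ ℕ) (c : k) (h : Finsupp.degree m < s) :
    dlt s (monomial m c) := by
  intro m' hm'
  rw [coeff_monomial, if_neg]
  rintro rfl; omega

lemma evZ_surj (Z : Finset (Fin n → k)) : Function.Surjective (evZ Z) := by
  classical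
  have key : ∀ z : Z, ∃ p : MvPolynomial (Fin n) k, evZ Z p = Pi.single z 1 := by
    intro z
    have hex : ∀ z' : Fin n → k, ∃ p : MvPolynomial (Fin n) k, z' ≠ z.1 →
        eval z.1 p = 1 ∧ eval z' p = 0 := by
      intro z'
      by_cases h : z' = z.1
      · exact ⟨0, fun h' => absurd h h'⟩
      · obtain ⟨j, hj⟩ := Function.ne_iff.mp h
        refine ⟨C ((z.1 j - z' j)⁻¹) * (X j - C (z' j)), fun _ => ⟨?_, by simp⟩⟩
        simp only [map_mul, eval_C, map_sub, eval_X]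
        exact inv_mul_cancel₀ (sub_ne_zero.mpr hj.symm)
    choose J hJ using hex
    refine ⟨∏ z' ∈ Z.erase z.1, J z', ?_⟩
    funext y
    rw [evZ_apply, map_prod]
    by_cases hy : y = z
    · subst hy
      rw [Pi.single_eq_same]
      exact Finset.prod_eq_one fun z' hz' => (hJ z' (Finset.ne_of_mem_erase hz')).1
    · rw [Pi.single_eq_of_ne hy]
      have hy' : y.1 ≠ z.1 := fun h => hy (Subtype.ext h)
      exact Finset.prod_eq_zero (i := y.1) (Finset.mem_erase.mpr ⟨hy', y.2⟩) (hJ y.1 hy').2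
  choose p hp using key
  intro f
  refine ⟨∑ z, f z • p z, ?_⟩
  rw [map_sum]
  simp only [map_smul, hp]
  funext y
  simp [Finset.sum_apply, Pi.single_apply]

lemma fibre_step {ι : Type*} [Fintype ι] {t : ℕ} {q P : ι → MvPolynomial (Fin n) k} {e : ι → ℕ}
    (hG : GoodId t q e) (hP : ∀ i, dlt (e i) (P i - q i)) (Z : Finset (Fin n → k))
    (hZ : ∀ z ∈ Z, ∀ i, eval z (P i) = 0) (s : ℕ) (hs : t ≤ s) :
    (dltSub n k (s + 1)).map (evZ Z) ≤ (dltSub n k s).map (evZ Z) := by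
  rintro _ ⟨p, hp, rfl⟩
  have hp' : dlt (s + 1) p := hp
  rw [p.as_sum, map_sum]
  apply Submodule.sum_mem
  intro m hm
  have hdeg : Finsupp.degree m < s + 1 := by
    by_contra hcon
    exact (mem_support_iff.mp hm) (hp' m (by omega))
  rcases Nat.lt_or_ge (Finsupp.degree m) s with hlt | hge
  · exact Submodule.mem_map_of_mem (dlt_monomial m _ hlt)
  · obtain ⟨w, μ, h1, h2, h3⟩ := exists_split_degree t (s - t) m (by omega)
    obtain ⟨c, hc1, hc2⟩ := hG.2 μ h2
    refine ⟨- ∑ i, (monomial w (coeff m p) * c i) * (P i - q i), ?_, ?_⟩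
    · show dlt s _
      apply dlt_neg
      apply dlt_sum
      intro i _
      have e1 : dlt ((s - t) + (t - e i + 1)) (monomial w (coeff m p) * c i) :=
        dlt_mul (dlt_monomial w _ (by omega)) (hc1 i)
      have hei := hG.1 i
      have e2 := dlt_mul (k := s - e i) (dlt_mono (by omega) e1) (hP i)
      exact dlt_mono (by omega) e2
    · funext z
      rw [evZ_apply, evZ_apply]
      have : monomial m (coeff m p) = monomial w (coeff m p) * monomial μ 1 := by
        rw [monomial_mul, ← h1, mul_one]
      rw [this, hc2]
      simp only [map_neg, map_sum, map_mul, map_sub, hZ z.1 z.2]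
      rw [Finset.mul_sum, ← Finset.sum_neg_distrib]
      apply Finset.sum_congr rfl
      intro i _
      ring

lemma exists_dlt (p : MvPolynomial (Fin n) k) : ∃ s, dlt s p :=
  ⟨p.totalDegree + 1, dlt_iff_totalDegree le_rfl⟩

lemma fibre_bound (n : ℕ) (t : ℕ) : ∃ c : ℕ, ∀ {k : Type} [Field k] {ι : Type} [Fintype ι]
    {q P : ι → MvPolynomial (Fin n) k} {e : ι → ℕ}, GoodId t q e → (∀ i, dlt (e i) (P i - q i)) →
    ∀ Z : Finset (Fin n → k), (∀ z ∈ Z, ∀ i, eval z (P i) = 0) → Z.card ≤ c := by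
  classical
  have hfin : {m : Fin n →₀ ℕ | Finsupp.degree m ≤ t}.Finite := Finsupp.finite_of_degree_le t
  refine ⟨hfin.toFinset.card, ?_⟩
  intro k _ ι _ q P e hG hP Z hZ
  have hmono : ∀ r, (dltSub n k (t + r)).map (evZ Z) ≤ (dltSub n k t).map (evZ Z) := by
    intro r
    induction r with
    | zero => exact le_rfl
    | succ r ih => exact (fibre_step hG hP Z hZ (t + r) (by omega)).trans ih
  have htop : (dltSub n k t).map (evZ Z) = ⊤ := by
    rw [eq_top_iff]
    intro f _
    obtain ⟨p, rfl⟩ := evZ_surj Z f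
    obtain ⟨s, hs⟩ := exists_dlt p
    exact hmono s (Submodule.mem_map_of_mem (show dlt (t + s) p from dlt_mono (by omega) hs))
  have hspan : (⊤ : Submodule k (Z → k)) ≤
      Submodule.span k (((hfin.toFinset.image fun m => evZ Z (monomial m 1)) : Finset (Z → k)) : Set (Z → k)) := by
    rw [← htop]
    rintro _ ⟨p, hp, rfl⟩
    have hp' : dlt t p := hp
    rw [p.as_sum, map_sum]
    apply Submodule.sum_mem
    intro m hm
    have : monomial m (coeff m p) = coeff m p • monomial m (1 : k) := by
      rw [smul_monomial]; simp
    rw [this, map_smul]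
    apply Submodule.smul_mem
    apply Submodule.subset_span
    rw [Finset.coe_image]
    refine ⟨m, ?_, rfl⟩
    simp only [Finset.mem_coe, Set.Finite.mem_toFinset]
    by_contra hcon
    have hcon' : ¬ Finsupp.degree m ≤ t := hcon
    exact (mem_support_iff.mp hm) (hp' m (by omega))
  have h1 : Module.finrank k (Z → k) = Z.card := by simp
  have h2 := finrank_span_finset_le_card (R := k) (hfin.toFinset.image fun m => evZ Z (monomial m 1))
  rw [Set.finrank, top_le_iff.mp hspan, finrank_top, h1] at h2
  exact h2.trans Finset.card_image_le

end Fibre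
end


-- part B2
section


section Noether
variable {n : ℕ} {k : Type*} [Field k]

def linF (n : ℕ) (k : Type*) [Field k] (l : Fin n → ℤ) : MvPolynomial (Fin n) k :=
  ∑ j, C ((l j : ℤ) : k) * X j

lemma linF_eval (l : Fin n → ℤ) (x : Fin n → k) : eval x (linF n k l) = ∑ j, (l j : k) * x j := by
  simp [linF]

def ChainLe (J : Ideal (MvPolynomial (Fin n) k)) (r : ℕ) : Prop :=
  ∀ p : LTSeries (PrimeSpectrum (MvPolynomial (Fin n) k)), J ≤ p.head.asIdeal →
    p.last.asIdeal ≤ idealOfVars (Fin n) k → p.length ≤ r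

lemma chainLe_of_krullDim (J : Ideal (MvPolynomial (Fin n) k)) (r : ℕ)
    (h : ringKrullDim (MvPolynomial (Fin n) k ⧸ J) ≤ ((r : ℕ∞) : WithBot ℕ∞)) : ChainLe J r := by
  intro p hp _
  rw [ringKrullDim_quotient] at h
  have hmem : ∀ i, p i ∈ PrimeSpectrum.zeroLocus (R := MvPolynomial (Fin n) k) J := by
    intro i
    rw [PrimeSpectrum.mem_zeroLocus]
    have h1 : p.head ≤ p i := LTSeries.head_le _ _
    exact fun x hx => h1 (hp hx)
  let p' : LTSeries (PrimeSpectrum.zeroLocus (R := MvPolynomial (Fin n) k) J) :=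
    { length := p.length
      toFun := fun i => ⟨p i, hmem i⟩
      step := fun i => p.step i }
  have h2 := (Order.LTSeries.length_le_krullDim p').trans h
  have h3 : p'.length = p.length := rfl
  rw [h3] at h2
  exact_mod_cast h2

lemma avoid_aux [CharZero k] (S : Set (Ideal (MvPolynomial (Fin n) k))) (hS : S.Finite)
    (hS2 : ∀ p ∈ S, ∃ j, (X j : MvPolynomial (Fin n) k) ∉ p) :
    ∃ l : Fin n → ℤ, ∀ p ∈ S, linF n k l ∉ p := by
  classical
  let sub : Ideal (MvPolynomial (Fin n) k) → Submodule ℚ (Fin n → ℚ) := fun p =>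
    { carrier := {c | ∑ j, C ((c j : ℚ) : k) * X j ∈ p}
      zero_mem' := by simp
      add_mem' := by
        intro a b ha hb
        have := p.add_mem ha hb
        rw [← Finset.sum_add_distrib] at this
        show ∑ j, C (((a + b) j : ℚ) : k) * X j ∈ p
        convert this using 2 with j
        simp [add_mul]
      smul_mem' := by
        intro c a ha
        have := p.mul_mem_left (C ((c : ℚ) : k)) ha
        rw [Finset.mul_sum] at this
        show ∑ j, C (((c • a) j : ℚ) : k) * X j ∈ p
        convert this using 2 with j
        simp [mul_assoc] }
  have htop : (⊤ : Submodule ℚ (Fin n → ℚ)) ∉ hS.toFinset.image sub := by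
    intro h
    obtain ⟨p, hp, hpt⟩ := Finset.mem_image.mp h
    obtain ⟨j, hj⟩ := hS2 p (hS.mem_toFinset.mp hp)
    apply hj
    have : (Pi.single j 1 : Fin n → ℚ) ∈ sub p := by rw [hpt]; trivial
    have h3 : ∑ i, C (((Pi.single j 1 : Fin n → ℚ) i : ℚ) : k) * X i ∈ p := this
    rw [Finset.sum_eq_single j] at h3
    · simpa using h3
    · intro b _ hb
      simp [Pi.single_eq_of_ne hb]
    · simp
  have := Subspace.biUnion_ne_univ_of_top_notMem htop
  obtain ⟨c, hc⟩ := (Set.ne_univ_iff_exists_notMem _).mp this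
  -- clear denominators
  let D : ℕ := ∏ j, (c j).den
  have hD : ∀ j, ∃ z : ℤ, (D : ℚ) * c j = z := by
    intro j
    obtain ⟨e, he⟩ : (c j).den ∣ D := Finset.dvd_prod_of_mem (fun j => (c j).den) (Finset.mem_univ j)
    refine ⟨e * (c j).num, ?_⟩
    rw [he]
    have := Rat.den_mul_eq_num (c j)
    push_cast
    rw [← this]; ring
  choose l hl using hD
  refine ⟨l, fun p hp hlp => hc ?_⟩
  rw [Set.mem_iUnion₂]
  refine ⟨sub p, Finset.mem_image_of_mem _ (hS.mem_toFinset.mpr hp), ?_⟩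
  have hD0 : (D : ℚ) ≠ 0 := by
    have : D ≠ 0 := Finset.prod_ne_zero_iff.mpr fun j _ => (c j).den_nz
    exact_mod_cast this
  have h4 : (fun j => (l j : ℚ)) ∈ sub p := by
    show ∑ j, C (((l j : ℚ)) : k) * X j ∈ p
    simpa [linF] using hlp
  have h5 : c = (D : ℚ)⁻¹ • (fun j => (l j : ℚ)) := by
    funext j
    simp only [Pi.smul_apply, smul_eq_mul]
    rw [← hl j]; field_simp
  rw [h5]
  exact (sub p).smul_mem _ h4

lemma vars_prime_max : (idealOfVars (Fin n) k).IsPrime := by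
  have : idealOfVars (Fin n) k = RingHom.ker (constantCoeff (R := k) (σ := Fin n)) := by
    ext p
    have := mem_pow_idealOfVars_iff' (σ := Fin n) (R := k) 1 p
    rw [pow_one] at this
    rw [this, RingHom.mem_ker]
    constructor
    · intro h; exact h 0 (by simp)
    · intro h x hx
      have : x = 0 := by
        rw [← Finsupp.degree_eq_zero_iff]; omega
      rw [this]; exact h
  rw [this]
  exact RingHom.ker_isPrime _

lemma chain_step [CharZero k] (J : Ideal (MvPolynomial (Fin n) k)) (r : ℕ) (h : ChainLe J (r + 1)) :
    ∃ l : Fin n → ℤ, ChainLe (J ⊔ Ideal.span {linF n k l}) r := by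
  obtain ⟨l, hl⟩ := avoid_aux (k := k) {p | p ∈ J.minimalPrimes ∧ ∃ j, (X j : MvPolynomial (Fin n) k) ∉ p}
    ((Ideal.finite_minimalPrimes_of_isNoetherianRing _ J).subset fun p hp => hp.1)
    (fun p hp => hp.2)
  refine ⟨l, ?_⟩
  intro p hp hlast
  obtain ⟨p0, hp0, hle⟩ := Ideal.exists_minimalPrimes_le (J := p.head.asIdeal) (le_sup_left.trans hp)
  by_cases hx : ∃ j, (X j : MvPolynomial (Fin n) k) ∉ p0
  · have hlp := hl p0 ⟨hp0, hx⟩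
    have hlh : linF n k l ∈ p.head.asIdeal :=
      hp (Ideal.mem_sup_right (Ideal.subset_span rfl))
    let p0' : PrimeSpectrum (MvPolynomial (Fin n) k) := ⟨p0, hp0.1.1⟩
    have hlt : p0' < p.head := lt_of_le_of_ne hle fun heq => hlp (by
      have : p0'.asIdeal = p0 := rfl
      rw [← this, heq]; exact hlh)
    have := h (p.cons p0' hlt) (by simpa using! hp0.1.2) (by simpa using! hlast)
    simpa using! this
  · push Not at hx
    have h1 : idealOfVars (Fin n) k ≤ p0 := by
      rw [Ideal.span_le]
      rintro _ ⟨j, rfl⟩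
      exact hx j
    have h2 : p.last ≤ p.head := hlast.trans (h1.trans hle)
    by_contra hcon
    push Not at hcon
    have h3 : p.head < p.last := by
      apply p.strictMono
      rw [Fin.lt_def]; simp; omega
    exact absurd h3 (not_lt_of_ge h2)

lemma chain_many [CharZero k] (Δ : ℕ) : ∀ (J : Ideal (MvPolynomial (Fin n) k)), ChainLe J Δ →
    ∃ l : Fin Δ → Fin n → ℤ, ChainLe (J ⊔ Ideal.span (Set.range fun s => linF n k (l s))) 0 := by
  induction Δ with
  | zero =>
    intro J h
    refine ⟨Fin.elim0, ?_⟩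
    have : Set.range (fun s : Fin 0 => linF n k ((Fin.elim0 : Fin 0 → Fin n → ℤ) s)) = ∅ := Set.range_eq_empty _
    rw [this, Ideal.span_empty, sup_bot_eq]
    exact h
  | succ r ih =>
    intro J h
    obtain ⟨l, hl⟩ := chain_step J r h
    obtain ⟨l', hl'⟩ := ih _ hl
    refine ⟨Fin.cons l l', ?_⟩
    convert hl' using 1
    rw [sup_assoc, ← Ideal.span_union]
    congr 2
    ext p
    simp only [Set.mem_range, Set.mem_union, Set.mem_singleton_iff]
    constructor
    · rintro ⟨s, rfl⟩
      refine Fin.cases ?_ (fun s => ?_) s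
      · left; simp
      · right; exact ⟨s, by simp⟩
    · rintro (rfl | ⟨s, rfl⟩)
      · exact ⟨0, by simp⟩
      · exact ⟨s.succ, by simp⟩

lemma chain_zero_end [IsAlgClosed k] [CharZero k] (J : Ideal (MvPolynomial (Fin n) k))
    (hJ : ∀ v : Fin n → k, (∀ p ∈ J, eval v p = 0) → ∀ t : k, ∀ p ∈ J, eval (t • v) p = 0)
    (h : ChainLe J 0) : ∃ t : ℕ, idealOfVars (Fin n) k ^ t ≤ J := by
  have hz : ∀ v : Fin n → k, (∀ p ∈ J, eval v p = 0) → v = 0 := by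
    intro v hv
    by_contra hv0
    obtain ⟨j, hj⟩ := Function.ne_iff.mp hv0
    let φ : MvPolynomial (Fin n) k →ₐ[k] Polynomial k := aeval fun i => Polynomial.C (v i) * Polynomial.X
    have hφ : ∀ (p : MvPolynomial (Fin n) k) (t : k), (φ p).eval t = eval (t • v) p := by
      intro p t
      have : ((Polynomial.aeval t).comp φ) = (aeval (t • v) : MvPolynomial (Fin n) k →ₐ[k] k) := by
        apply MvPolynomial.algHom_ext
        intro i
        rw [AlgHom.comp_apply]
        show Polynomial.aeval t (aeval (fun i => Polynomial.C (v i) * Polynomial.X) (X i)) = _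
        rw [aeval_X, aeval_X]
        rw [map_mul, Polynomial.aeval_C, Polynomial.aeval_X]
        simp only [Pi.smul_apply, smul_eq_mul, Algebra.algebraMap_self, RingHom.id_apply]
        ring
      have := congrArg (fun f => f p) this
      simpa [MvPolynomial.aeval_eq_eval] using this
    let Q : PrimeSpectrum (MvPolynomial (Fin n) k) := ⟨RingHom.ker φ.toRingHom, RingHom.ker_isPrime _⟩
    let M : PrimeSpectrum (MvPolynomial (Fin n) k) := ⟨idealOfVars (Fin n) k, vars_prime_max⟩
    have hmemQ : ∀ p, p ∈ Q.asIdeal ↔ φ p = 0 := fun p => RingHom.mem_ker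
    have hQM : Q < M := by
      refine lt_of_le_of_ne ?_ ?_
      · intro p hp
        have hp' := (hmemQ p).mp hp
        show p ∈ idealOfVars (Fin n) k
        have := mem_pow_idealOfVars_iff' (σ := Fin n) (R := k) 1 p
        rw [pow_one] at this
        rw [this]
        intro x hx
        have hx0 : x = 0 := by
          rw [← Finsupp.degree_eq_zero_iff]; omega
        rw [hx0]
        have h0 := hφ p 0
        rw [hp', zero_smul] at h0
        rw [← constantCoeff_eq, ← eval_zero]
        simpa using h0.symm
      · intro heq
        have : (X j : MvPolynomial (Fin n) k) ∈ Q.asIdeal := by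
          rw [heq]; exact Ideal.subset_span ⟨j, rfl⟩
        rw [hmemQ] at this
        have h1 := hφ (X j) 1
        rw [this] at h1
        simp at h1
        exact hj (by simpa using h1.symm)
    let p : LTSeries (PrimeSpectrum (MvPolynomial (Fin n) k)) := (RelSeries.singleton _ M).cons Q hQM
    have := h p (by
      intro q hq
      show q ∈ Q.asIdeal
      rw [hmemQ]
      apply Polynomial.funext
      intro t
      rw [hφ, hJ v hv t q hq]; simp) (by
      have : p.last = M := (RelSeries.last_cons _ _ _).trans rfl
      rw [this])
    have h2 : p.length = 1 := RelSeries.cons_length _ _ _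
    omega
  have hrad : idealOfVars (Fin n) k ≤ J.radical := by
    rw [← vanishingIdeal_zeroLocus_eq_radical (K := k), Ideal.span_le]
    rintro _ ⟨j, rfl⟩
    rw [SetLike.mem_coe, mem_vanishingIdeal_iff]
    intro x hx
    rw [hz x (fun p hp => by simpa [MvPolynomial.aeval_eq_eval] using hx p hp)]
    simp
  exact Ideal.exists_pow_le_of_le_radical_of_fg hrad (idealOfVars_fg _ _)

end Noether
end


-- part B3
section


section Unif
variable {n : ℕ} {k : Type*} [Field k]

lemma homComp_mul {A : Type*} [CommRing A] (a e : ℕ) (p q : MvPolynomial (Fin n) A) (hq : q.IsHomogeneous e) :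
    homogeneousComponent (a + e) (p * q) = homogeneousComponent a p * q := by
  classical
  conv_lhs => rw [← sum_homogeneousComponent p, Finset.sum_mul, map_sum]
  have h : ∀ i, homogeneousComponent (a + e) (homogeneousComponent i p * q) =
      if i = a then homogeneousComponent a p * q else 0 := by
    intro i
    have h1 : homogeneousComponent i p * q ∈ homogeneousSubmodule (Fin n) A (i + e) :=
      (homogeneousComponent_isHomogeneous i p).mul hq
    rw [homogeneousComponent_of_mem h1]
    by_cases hi : i = a
    · subst hi; simp
    · rw [if_neg hi, if_neg]; omega
  simp only [h]
  rw [Finset.sum_ite_eq']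
  split_ifs with h2
  · rfl
  · rw [homogeneousComponent_eq_zero, zero_mul]
    simp at h2; omega

def GoodH {ι : Type*} [Fintype ι] (t : ℕ) (q : ι → MvPolynomial (Fin n) k) (e : ι → ℕ) : Prop :=
  (∀ i, e i ≤ t) ∧ ∀ μ : Fin n →₀ ℕ, Finsupp.degree μ = t →
    ∃ c : ι → MvPolynomial (Fin n) k, (∀ i, (c i).IsHomogeneous (t - e i)) ∧
      monomial μ (1 : k) = ∑ i, c i * q i

lemma hom_eq_of_degree {A : Type*} [CommRing A] {p : MvPolynomial (Fin n) A} {e : ℕ} (hp : p.IsHomogeneous e)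
    (m : Fin n →₀ ℕ) (hm : Finsupp.degree m ≠ e) : coeff m p = 0 := by
  apply hp.coeff_eq_zero
  exact hm

lemma GoodH.goodId {ι : Type*} [Fintype ι] {t : ℕ} {q : ι → MvPolynomial (Fin n) k} {e : ι → ℕ}
    (h : GoodH t q e) : GoodId t q e := by
  refine ⟨h.1, fun μ hμ => ?_⟩
  obtain ⟨c, hc1, hc2⟩ := h.2 μ hμ
  exact ⟨c, fun i m hm => hom_eq_of_degree (hc1 i) m (by omega), hc2⟩

lemma goodH_of_ideal {ι : Type*} [Fintype ι] {t t' : ℕ} {q : ι → MvPolynomial (Fin n) k} {e : ι → ℕ}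
    (hq : ∀ i, (q i).IsHomogeneous (e i)) (ht : ∀ i, e i ≤ t') (htt : t ≤ t')
    (hI : idealOfVars (Fin n) k ^ t ≤ Ideal.span (Set.range q)) : GoodH t' q e := by
  refine ⟨ht, fun μ hμ => ?_⟩
  have h1 : monomial μ (1 : k) ∈ Ideal.span (Set.range q) := by
    apply hI
    rw [monomial_mem_pow_idealOfVars_iff _ _ one_ne_zero]
    omega
  obtain ⟨c, hc⟩ := Ideal.mem_span_range_iff_exists_fun.mp h1
  refine ⟨fun i => homogeneousComponent (t' - e i) (c i), fun i => homogeneousComponent_isHomogeneous _ _, ?_⟩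
  have h2 : monomial μ (1 : k) ∈ homogeneousSubmodule (Fin n) k t' := isHomogeneous_monomial _ hμ
  have h3 := homogeneousComponent_of_mem (m := t') h2
  rw [if_pos rfl, ← hc, map_sum] at h3
  rw [← hc, ← h3]
  apply Finset.sum_congr rfl
  intro i _
  have := homComp_mul (t' - e i) (e i) (c i) (q i) (hq i)
  rwa [Nat.sub_add_cancel (ht i)] at this

lemma hom_expand {A : Type*} [CommRing A] {p : MvPolynomial (Fin n) A} {t : ℕ} (hp : p.IsHomogeneous t)
    (T : Finset (Fin n →₀ ℕ)) (hT : ∀ m, m ∈ T ↔ Finsupp.degree m = t) :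
    p = ∑ m : T, C (coeff m.1 p) * monomial m.1 1 := by
  classical
  ext m
  rw [coeff_sum]
  simp only [coeff_C_mul, coeff_monomial]
  by_cases hm : m ∈ T
  · rw [Finset.sum_eq_single (⟨m, hm⟩ : T)]
    · simp
    · intro b _ hb
      rw [if_neg, mul_zero]
      intro h; exact hb (Subtype.ext h)
    · simp
  · rw [hom_eq_of_degree hp m (fun h => hm ((hT m).mpr h)), Finset.sum_eq_zero]
    intro b _
    rw [if_neg, mul_zero]
    intro h; exact hm (h ▸ b.2)

lemma good_open {σ ι : Type*} [Fintype ι] (t : ℕ) (e : ι → ℕ)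
    (q : ι → MvPolynomial (Fin n) (MvPolynomial σ k)) (hq : ∀ i, (q i).IsHomogeneous (e i))
    (a0 : σ → k) (h0 : GoodH t (fun i => MvPolynomial.map (eval a0) (q i)) e) :
    ∃ D : MvPolynomial σ k, eval a0 D ≠ 0 ∧ ∀ a, eval a D ≠ 0 →
      GoodH t (fun i => MvPolynomial.map (eval a) (q i)) e := by
  classical
  have hfin : {m : Fin n →₀ ℕ | Finsupp.degree m = t}.Finite :=
    (Finsupp.finite_of_degree_le t).subset fun m hm => le_of_eq hm
  set T : Finset (Fin n →₀ ℕ) := hfin.toFinset with hTdef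
  have hT : ∀ m, m ∈ T ↔ Finsupp.degree m = t := fun m => by
    rw [hTdef, Set.Finite.mem_toFinset]; rfl
  have h0' : ∀ μ : T, ∃ c : ι → MvPolynomial (Fin n) k, (∀ i, (c i).IsHomogeneous (t - e i)) ∧
      monomial μ.1 (1 : k) = ∑ i, c i * MvPolynomial.map (eval a0) (q i) :=
    fun μ => h0.2 μ.1 ((hT _).mp μ.2)
  choose c hc1 hc2 using h0'
  let B : Matrix T T (MvPolynomial σ k) := fun μ μ' =>
    coeff μ'.1 (∑ i, MvPolynomial.map C (c μ i) * q i)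
  have hmapC : ∀ (a : σ → k) (p : MvPolynomial (Fin n) k),
      MvPolynomial.map (eval a) (MvPolynomial.map (C : k →+* MvPolynomial σ k) p) = p := by
    intro a p
    rw [MvPolynomial.map_map]
    have : (eval a).comp (C : k →+* MvPolynomial σ k) = RingHom.id k := by
      ext x; simp
    rw [this, MvPolynomial.map_id]
  have hB : ∀ a μ μ', eval a (B μ μ') =
      coeff μ'.1 (∑ i, c μ i * MvPolynomial.map (eval a) (q i)) := by
    intro a μ μ'
    show eval a (coeff μ'.1 (∑ i, MvPolynomial.map C (c μ i) * q i)) = _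
    rw [← coeff_map, map_sum]
    simp only [map_mul, hmapC]
  refine ⟨B.det, ?_, ?_⟩
  · rw [RingHom.map_det]
    have : (eval a0).mapMatrix B = 1 := by
      ext μ μ'
      rw [RingHom.mapMatrix_apply, Matrix.map_apply, hB, ← hc2, coeff_monomial, Matrix.one_apply]
      simp only [Subtype.ext_iff]
    rw [this, Matrix.det_one]
    exact one_ne_zero
  · intro a ha
    rw [RingHom.map_det] at ha
    set Ba := (eval a).mapMatrix B with hBa
    have hunit : IsUnit Ba.det := isUnit_iff_ne_zero.mpr ha
    have hinv := Matrix.nonsing_inv_mul Ba hunit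
    refine ⟨h0.1, fun μ hμ => ?_⟩
    let μ' : T := ⟨μ, (hT μ).mpr hμ⟩
    refine ⟨fun i => ∑ ρ : T, C (Ba⁻¹ μ' ρ) * c ρ i, fun i => ?_, ?_⟩
    · apply IsHomogeneous.sum
      intro ρ _
      exact (hc1 ρ i).C_mul _
    · have hF : ∀ ρ : T, ∑ i, c ρ i * MvPolynomial.map (eval a) (q i) =
          ∑ m : T, C (Ba ρ m) * monomial m.1 1 := by
        intro ρ
        have hh : (∑ i, c ρ i * MvPolynomial.map (eval a) (q i)).IsHomogeneous t := by
          apply IsHomogeneous.sum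
          intro i _
          have := (hc1 ρ i).mul ((hq i).map (eval a))
          rwa [Nat.sub_add_cancel (h0.1 i)] at this
        rw [hom_expand hh T hT]
        apply Finset.sum_congr rfl
        intro m _
        rw [← hB]; rfl
      calc monomial μ (1 : k) = ∑ m : T, C ((1 : Matrix T T k) μ' m) * monomial m.1 1 := by
            rw [Finset.sum_eq_single μ']
            · simp [μ']
            · intro b _ hb
              rw [Matrix.one_apply_ne hb.symm]; simp
            · simp
        _ = ∑ ρ : T, C (Ba⁻¹ μ' ρ) * ∑ m : T, C (Ba ρ m) * monomial m.1 1 := by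
            rw [← hinv]
            simp only [Matrix.mul_apply, map_sum, map_mul, Finset.sum_mul, Finset.mul_sum]
            rw [Finset.sum_comm]
            simp only [mul_assoc]
        _ = _ := by
            simp only [← hF, Finset.mul_sum, Finset.sum_mul]
            rw [Finset.sum_comm]
            simp only [mul_assoc]

lemma quasi_compact {σ Λ : Type*} [Finite σ] [Nonempty Λ] (Good : Λ → (σ → k) → Prop)
    (hopen : ∀ l a0, Good l a0 → ∃ D : MvPolynomial σ k, eval a0 D ≠ 0 ∧ ∀ a, eval a D ≠ 0 → Good l a) :
    ∃ L : Finset Λ, ∀ a, (∃ l, Good l a) → ∃ l ∈ L, Good l a := by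
  classical
  let S : Set (MvPolynomial σ k) := {D | ∃ l, ∀ a, eval a D ≠ 0 → Good l a}
  have hfg : (Ideal.span S).FG := IsNoetherian.noetherian _
  obtain ⟨s', hs1, hs2⟩ := (Submodule.fg_span_iff_fg_span_finset_subset S).mp hfg
  have hch : ∀ D : MvPolynomial σ k, D ∈ s' → ∃ l, ∀ a, eval a D ≠ 0 → Good l a := fun D hD => hs1 hD
  choose! l hl using hch
  refine ⟨s'.image l, ?_⟩
  rintro a ⟨l0, hl0⟩
  obtain ⟨D, hD1, hD2⟩ := hopen l0 a hl0
  have hDS : D ∈ Ideal.span S := Ideal.subset_span ⟨l0, hD2⟩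
  by_contra hcon
  push Not at hcon
  have hle : Ideal.span S ≤ RingHom.ker (eval a) := by
    have : Ideal.span S = Ideal.span (s' : Set (MvPolynomial σ k)) := hs2
    rw [this, Ideal.span_le]
    intro E hE
    rw [SetLike.mem_coe, RingHom.mem_ker]
    by_contra hne
    exact hcon (l E) (Finset.mem_image_of_mem _ hE) (hl E hE a hne)
  exact hD1 (hle hDS)

/-- the system of forms: partial derivatives of `g`, and linear forms -/
def sysQ (g : MvPolynomial (Fin n) k) {Δ : ℕ} (l : Fin Δ → Fin n → ℤ) :
    Fin n ⊕ Fin Δ → MvPolynomial (Fin n) k :=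
  Sum.elim (fun j => pderiv j g) (fun s => linF n k (l s))

def sysE (n d Δ : ℕ) : Fin n ⊕ Fin Δ → ℕ := Sum.elim (fun _ => d) (fun _ => 1)

lemma linF_hom (l : Fin n → ℤ) : (linF n k l).IsHomogeneous 1 := by
  apply IsHomogeneous.sum
  intro j _
  exact (isHomogeneous_X k j).C_mul _

lemma hom_eval_smul {p : MvPolynomial (Fin n) k} {e : ℕ} (hp : p.IsHomogeneous e) (v : Fin n → k)
    (t : k) : eval (t • v) p = t ^ e * eval v p := by
  rw [eval_eq, eval_eq, Finset.mul_sum]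
  apply Finset.sum_congr rfl
  intro m hm
  have hdeg : ∑ i ∈ m.support, m i = e := by
    by_contra hne
    exact (mem_support_iff.mp hm) (hom_eq_of_degree hp m (by rwa [Finsupp.degree_apply]))
  simp only [Pi.smul_apply, smul_eq_mul, mul_pow, Finset.prod_mul_distrib]
  rw [Finset.prod_pow_eq_pow_sum, hdeg]
  ring

lemma exists_good (d Δ : ℕ) (g : MvPolynomial (Fin n) Qbar) (hg : g.IsHomogeneous (d + 1))
    (hdim : singDim n g ≤ ((Δ : ℕ∞) : WithBot ℕ∞)) :
    ∃ (t : ℕ) (l : Fin Δ → Fin n → ℤ), GoodH t (sysQ g l) (sysE n d Δ) := by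
  obtain ⟨l, hl⟩ := chain_many Δ _ (chainLe_of_krullDim _ _ hdim)
  have hspan : Ideal.span (Set.range fun j => pderiv j g) ⊔
      Ideal.span (Set.range fun s => linF n Qbar (l s)) = Ideal.span (Set.range (sysQ g l)) := by
    rw [← Ideal.span_union, sysQ, Set.Sum.elim_range]
  rw [hspan] at hl
  have hhom : ∀ i, (sysQ g l i).IsHomogeneous (sysE n d Δ i) := by
    rintro (j | s)
    · exact hg.pderiv
    · exact linF_hom _
  obtain ⟨t, ht⟩ := chain_zero_end _ (by
    intro v hv t p hp
    have : ∀ p ∈ Ideal.span (Set.range (sysQ g l)), p ∈ RingHom.ker (eval (t • v)) := by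
      intro p hp
      revert p
      rw [← SetLike.le_def, Ideal.span_le]
      rintro _ ⟨i, rfl⟩
      rw [SetLike.mem_coe, RingHom.mem_ker, hom_eval_smul (hhom i), hv _ (Ideal.subset_span ⟨i, rfl⟩), mul_zero]
    exact this p hp) hl
  refine ⟨t + d + 1, l, goodH_of_ideal hhom ?_ (by omega) ht⟩
  rintro (j | s) <;> simp [sysE]; omega

lemma exists_good_unif (n d Δ : ℕ) : ∃ L : Finset (ℕ × (Fin Δ → Fin n → ℤ)),
    ∀ g : MvPolynomial (Fin n) Qbar, g.IsHomogeneous (d + 1) →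
      singDim n g ≤ ((Δ : ℕ∞) : WithBot ℕ∞) →
      ∃ l ∈ L, GoodH l.1 (sysQ g l.2) (sysE n d Δ) := by
  classical
  have hfin : {m : Fin n →₀ ℕ | Finsupp.degree m = d + 1}.Finite :=
    (Finsupp.finite_of_degree_le (d + 1)).subset fun m hm => le_of_eq hm
  set T : Finset (Fin n →₀ ℕ) := hfin.toFinset with hTdef
  have hT : ∀ m, m ∈ T ↔ Finsupp.degree m = d + 1 := fun m => by
    rw [hTdef, Set.Finite.mem_toFinset]; rfl
  let G : MvPolynomial (Fin n) (MvPolynomial T Qbar) := ∑ m : T, C (X m) * monomial m.1 1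
  have hG : G.IsHomogeneous (d + 1) := by
    apply IsHomogeneous.sum
    intro m _
    exact (isHomogeneous_monomial _ ((hT _).mp m.2)).C_mul _
  let Gq : (Fin Δ → Fin n → ℤ) → Fin n ⊕ Fin Δ → MvPolynomial (Fin n) (MvPolynomial T Qbar) :=
    fun l => Sum.elim (fun j => pderiv j G) (fun s => MvPolynomial.map C (linF n Qbar (l s)))
  have hGq : ∀ l i, (Gq l i).IsHomogeneous (sysE n d Δ i) := by
    rintro l (j | s)
    · exact hG.pderiv
    · exact (linF_hom _).map _
  have hmap : ∀ l (a : T → Qbar) i, MvPolynomial.map (eval a) (Gq l i) =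
      sysQ (MvPolynomial.map (eval a) G) l i := by
    rintro l a (j | s)
    · show MvPolynomial.map (eval a) (pderiv j G) = pderiv j (MvPolynomial.map (eval a) G)
      rw [pderiv_map]
    · show MvPolynomial.map (eval a) (MvPolynomial.map C (linF n Qbar (l s))) = linF n Qbar (l s)
      rw [MvPolynomial.map_map]
      have : (eval a).comp (C : Qbar →+* MvPolynomial T Qbar) = RingHom.id Qbar := by
        ext x; simp
      rw [this, MvPolynomial.map_id]
  obtain ⟨L, hL⟩ := quasi_compact (k := Qbar) (σ := T) (Λ := ℕ × (Fin Δ → Fin n → ℤ))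
    (fun l a => GoodH l.1 (fun i => MvPolynomial.map (eval a) (Gq l.2 i)) (sysE n d Δ))
    (fun l a0 h => good_open l.1 _ _ (hGq l.2) a0 h)
  refine ⟨L, fun g hg hdim => ?_⟩
  let a : T → Qbar := fun m => coeff m.1 g
  have hga : MvPolynomial.map (eval a) G = g := by
    rw [hom_expand hg T hT, map_sum]
    apply Finset.sum_congr rfl
    intro m _
    rw [map_mul, map_C, map_monomial]
    simp [a]
  have hrew : ∀ l, (fun i => MvPolynomial.map (eval a) (Gq l i)) = sysQ g l := by
    intro l; funext i; rw [hmap, hga]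
  obtain ⟨t, l, h⟩ := exists_good d Δ g hg hdim
  obtain ⟨l', h1, h2⟩ := hL a ⟨(t, l), by rw [hrew]; exact h⟩
  exact ⟨l', h1, by rw [hrew] at h2; exact h2⟩

end Unif
end


-- part B4
section


section Count
variable {n : ℕ}

lemma euler_Tn {A : Type*} [CommRing A] (e : ℕ) : ∀ (F : MvPolynomial (Fin n) A), F.IsHomogeneous e →
    ∑ v : Fin e → Fin n, C (Tn F v) * ∏ i, X (v i) = (e.factorial : MvPolynomial (Fin n) A) * F := by
  induction e with
  | zero =>
    intro F hF
    have h1 : F = C (coeff 0 F) := by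
      ext m
      rw [coeff_C]
      split_ifs with h
      · rw [h]
      · apply hom_eq_of_degree hF
        rw [ne_eq, Finsupp.degree_eq_zero_iff]
        exact fun h' => h h'.symm
    rw [Fintype.sum_unique]
    conv_rhs => rw [h1]
    simp [Tn, fexp, mfac]
  | succ e ih =>
    intro F hF
    rw [sum_fin_cons]
    have h1 : ∀ j : Fin n, ∑ v : Fin e → Fin n, C (Tn F (Fin.cons j v : Fin (e + 1) → Fin n)) *
        ∏ i : Fin (e + 1), X ((Fin.cons j v : Fin (e + 1) → Fin n) i) =
        (e.factorial : MvPolynomial (Fin n) A) * (X j * pderiv j F) := by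
      intro j
      have h2 := ih (pderiv j F) (by simpa using hF.pderiv)
      rw [mul_left_comm, ← h2, Finset.mul_sum]
      apply Finset.sum_congr rfl
      intro v _
      rw [Fin.prod_univ_succ, Tn_pderiv]
      simp only [Fin.cons_zero, Fin.cons_succ]
      ring
    simp only [h1]
    rw [← Finset.mul_sum, hF.sum_X_mul_pderiv, Nat.factorial_succ]
    push_cast
    rw [nsmul_eq_mul]
    push_cast
    ring

lemma prod_X_dlt {A : Type*} [CommRing A] (m : ℕ) (v : Fin m → Fin n) (w : Fin m → A) :
    dlt (m + 1) (∏ i, (X (v i) + C (w i)) : MvPolynomial (Fin n) A) := by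
  induction m with
  | zero => simpa using dlt_C (n := n) (1 : A)
  | succ m ih =>
    rw [Fin.prod_univ_succ]
    have := dlt_mul (k := 1) (dlt_add (dlt_X (A := A) (v 0)) (dlt_mono (by omega) (dlt_C (w 0))))
      (ih (fun i => v i.succ) (fun i => w i.succ))
    exact dlt_mono (by omega) this

lemma prod_X_diff {A : Type*} [CommRing A] (m : ℕ) (v : Fin m → Fin n) (w : Fin m → A) :
    dlt m (∏ i, (X (v i) + C (w i)) - ∏ i, X (v i) : MvPolynomial (Fin n) A) := by
  induction m with
  | zero => simpa using dlt_zero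
  | succ m ih =>
    rw [Fin.prod_univ_succ, Fin.prod_univ_succ]
    have h1 := dlt_mul (k := 1) (dlt_X (A := A) (v 0)) (ih (fun i => v i.succ) (fun i => w i.succ))
    have h2 := dlt_mul (k := 0) (dlt_C (w 0)) (prod_X_dlt m (fun i => v i.succ) (fun i => w i.succ))
    have h3 := dlt_add (dlt_mono (by omega : 1 + m ≤ m + 1) h1) (dlt_mono (by omega : 0 + (m + 1) ≤ m + 1) h2)
    convert h3 using 1
    ring

lemma fibre_count (n k Δ : ℕ) (L : Finset (ℕ × (Fin Δ → Fin n → ℤ))) : ∃ c : ℕ,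
    ∀ l ∈ L, ∀ g : MvPolynomial (Fin n) ℤ, g.IsHomogeneous (k + 2) →
      GoodH l.1 (sysQ (MvPolynomial.map (Int.castRingHom Qbar) g) l.2) (sysE n (k + 1) Δ) →
      ∀ (w : Fin (k + 1) → Fin n → ℤ) (b : Fin Δ → ℤ) (Z : Finset (Fin n → ℤ)),
      (∀ z ∈ Z, (∀ j, Psi g j (fun i => z + w i) = 0) ∧ ∀ s, ∑ j, l.2 s j * z j = b s) → Z.card ≤ c := by
  classical
  choose c hc using fibre_bound n
  refine ⟨L.sup fun l => c l.1, ?_⟩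
  intro l hl g hg hgood w b Z hZ
  have hle : c l.1 ≤ L.sup fun l => c l.1 := Finset.le_sup (f := fun l : ℕ × (Fin Δ → Fin n → ℤ) => c l.1) hl
  refine le_trans ?_ hle
  set gQ := MvPolynomial.map (Int.castRingHom Qbar) g with hgQ
  have hgQh : gQ.IsHomogeneous (k + 2) := hg.map _
  let ι : (Fin n → ℤ) → (Fin n → Qbar) := fun z j => (z j : Qbar)
  have hinj : Function.Injective ι := by
    intro x y h
    funext j
    have h1 : (x j : Qbar) = (y j : Qbar) := congrFun h j
    exact_mod_cast h1
  have hTn : ∀ (v : Fin (k + 2) → Fin n), Tn gQ v = ((Tn g v : ℤ) : Qbar) := by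
    intro v
    unfold Tn
    rw [hgQ, coeff_map]; simp
  let P : Fin n ⊕ Fin Δ → MvPolynomial (Fin n) Qbar := Sum.elim
    (fun j => C (((k + 1).factorial : Qbar)⁻¹) * ∑ v : Fin (k + 1) → Fin n,
      C (Tn gQ (Fin.cons j v : Fin (k + 2) → Fin n)) * ∏ i, (X (v i) + C ((w i (v i) : ℤ) : Qbar)))
    (fun s => linF n Qbar (l.2 s) - C ((b s : ℤ) : Qbar))
  have hfac : ((k + 1).factorial : Qbar) ≠ 0 := by exact_mod_cast (Nat.factorial_pos _).ne'
  have hP : ∀ i, dlt (sysE n (k + 1) Δ i) (P i - sysQ gQ l.2 i) := by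
    rintro (j | s)
    · show dlt (k + 1) (C (((k + 1).factorial : Qbar)⁻¹) * ∑ v : Fin (k + 1) → Fin n,
        C (Tn gQ (Fin.cons j v : Fin (k + 2) → Fin n)) * ∏ i, (X (v i) + C ((w i (v i) : ℤ) : Qbar))
        - pderiv j gQ)
      have h1 := euler_Tn (k + 1) (pderiv j gQ) (by simpa using hgQh.pderiv)
      have h2 : pderiv j gQ = C (((k + 1).factorial : Qbar)⁻¹) * ∑ v : Fin (k + 1) → Fin n,
          C (Tn gQ (Fin.cons j v : Fin (k + 2) → Fin n)) * ∏ i, X (v i) := by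
        simp only [Tn_pderiv] at h1
        rw [h1, ← mul_assoc]
        have : ((k + 1).factorial : MvPolynomial (Fin n) Qbar) = C ((k + 1).factorial : Qbar) := by simp
        rw [this, ← C_mul, inv_mul_cancel₀ hfac, C_1, one_mul]
      rw [h2, ← mul_sub, ← Finset.sum_sub_distrib]
      apply dlt_C_mul
      apply dlt_sum
      intro v _
      rw [← mul_sub]
      exact dlt_C_mul _ (prod_X_diff _ _ _)
    · show dlt 1 (linF n Qbar (l.2 s) - C ((b s : ℤ) : Qbar) - linF n Qbar (l.2 s))
      rw [sub_sub_cancel_left]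
      exact dlt_neg (dlt_C _)
  have h3 := hc l.1 hgood.goodId hP (Z.image ι) (by
    intro z' hz'
    obtain ⟨z, hz, rfl⟩ := Finset.mem_image.mp hz'
    obtain ⟨h1, h2⟩ := hZ z hz
    rintro (j | s)
    · show eval (ι z) (C (((k + 1).factorial : Qbar)⁻¹) * ∑ v : Fin (k + 1) → Fin n,
        C (Tn gQ (Fin.cons j v : Fin (k + 2) → Fin n)) * ∏ i, (X (v i) + C ((w i (v i) : ℤ) : Qbar))) = 0
      rw [map_mul, map_sum]
      have h4 : ∑ v : Fin (k + 1) → Fin n, eval (ι z) (C (Tn gQ (Fin.cons j v : Fin (k + 2) → Fin n)) *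
          ∏ i, (X (v i) + C ((w i (v i) : ℤ) : Qbar))) = ((Psi g j (fun i => z + w i) : ℤ) : Qbar) := by
        unfold Psi
        push_cast
        apply Finset.sum_congr rfl
        intro v _
        rw [map_mul, map_prod, eval_C, hTn]
        simp [ι]
      rw [h4, h1 j]; simp
    · show eval (ι z) (linF n Qbar (l.2 s) - C ((b s : ℤ) : Qbar)) = 0
      rw [map_sub, linF_eval, eval_C, ← h2 s]
      push_cast
      simp [ι])
  rwa [Finset.card_image_of_injective _ hinj] at h3

lemma card_tupZ_le (n k : ℕ) (M : ℝ) (hM : 0 ≤ M) : ((tupZ n k M).card : ℝ) ≤ (2 * M + 1) ^ (n * k) := by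
  unfold tupZ
  rw [Fintype.card_piFinset]
  push_cast
  simp only [Finset.prod_const, Finset.card_univ, Fintype.card_fin]
  rw [pow_mul]
  exact pow_le_pow_left₀ (by positivity) (card_boxZ_le n M hM) k

theorem variety_count (n k Δ : ℕ) : ∃ c : ℝ, 0 < c ∧ ∀ g : MvPolynomial (Fin n) ℤ,
    g.IsHomogeneous (k + 2) →
    singDim n (MvPolynomial.map (Int.castRingHom Qbar) g) ≤ ((Δ : ℕ∞) : WithBot ℕ∞) →
    ∀ H : ℝ, 1 ≤ H → ∀ S : Finset (Fin (k + 1) → Fin n → ℤ), S ⊆ tupZ n (k + 1) H →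
      (∀ h ∈ S, ∀ j, Psi g j h = 0) → (S.card : ℝ) ≤ c * H ^ (n * k + Δ) := by
  classical
  obtain ⟨L, hL⟩ := exists_good_unif n (k + 1) Δ
  obtain ⟨c, hc⟩ := fibre_count n k Δ L
  -- bound for linear forms
  let W : ℕ := L.sup fun l => ∑ s, ∑ j, (l.2 s j).natAbs
  have hW : ∀ l ∈ L, ∀ s, ∑ j, |(l.2 s j : ℝ)| ≤ W := by
    intro l hl s
    have h1 : ∑ j, (l.2 s j).natAbs ≤ ∑ s, ∑ j, (l.2 s j).natAbs :=
      Finset.single_le_sum (f := fun s => ∑ j, (l.2 s j).natAbs) (fun _ _ => Nat.zero_le _) (Finset.mem_univ s)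
    have h2 : ∑ s, ∑ j, (l.2 s j).natAbs ≤ W :=
      Finset.le_sup (f := fun l : ℕ × (Fin Δ → Fin n → ℤ) => ∑ s, ∑ j, (l.2 s j).natAbs) hl
    have h3 : ((∑ j, (l.2 s j).natAbs : ℕ) : ℝ) ≤ W := by exact_mod_cast h1.trans h2
    push_cast at h3
    simpa using h3
  refine ⟨(c + 1) * 5 ^ (n * k) * (2 * W + 1) ^ Δ, by positivity, ?_⟩
  intro g hg hdim H hH S hS hS0
  obtain ⟨l, hl, hgood⟩ := hL _ (hg.map _) hdim
  let f : (Fin (k + 1) → Fin n → ℤ) → (Fin k → Fin n → ℤ) × (Fin Δ → ℤ) :=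
    fun h => (fun i => h i.succ - h 0, fun s => ∑ j, l.2 s j * h 0 j)
  have hmaps : ∀ h ∈ S, f h ∈ tupZ n k (2 * H) ×ˢ boxZ Δ (W * H) := by
    intro h hh
    have hh' := mem_tupZ.mp (hS hh)
    rw [Finset.mem_product]
    constructor
    · rw [mem_tupZ]
      intro i
      rw [mem_boxZ]
      intro j
      have h1 := mem_boxZ.mp (hh' i.succ) j
      have h2 := mem_boxZ.mp (hh' 0) j
      show |(((h i.succ - h 0) j : ℤ) : ℝ)| ≤ _
      rw [Pi.sub_apply]
      push_cast
      calc _ ≤ |(h i.succ j : ℝ)| + |(h 0 j : ℝ)| := abs_sub _ _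
        _ ≤ _ := by linarith
    · rw [mem_boxZ]
      intro s
      show |((∑ j, l.2 s j * h 0 j : ℤ) : ℝ)| ≤ _
      push_cast
      calc _ ≤ ∑ j, |(l.2 s j : ℝ) * (h 0 j : ℝ)| := Finset.abs_sum_le_sum_abs _ _
        _ ≤ ∑ j, |(l.2 s j : ℝ)| * H := by
          apply Finset.sum_le_sum
          intro j _
          rw [abs_mul]
          exact mul_le_mul_of_nonneg_left (mem_boxZ.mp (hh' 0) j) (abs_nonneg _)
        _ = (∑ j, |(l.2 s j : ℝ)|) * H := by rw [Finset.sum_mul]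
        _ ≤ W * H := by
          apply mul_le_mul_of_nonneg_right (hW l hl s) (by linarith)
  have hfib : ∀ y ∈ tupZ n k (2 * H) ×ˢ boxZ Δ (W * H), (S.filter fun h => f h = y).card ≤ c := by
    rintro ⟨u, b⟩ _
    let w : Fin (k + 1) → Fin n → ℤ := Fin.cons 0 u
    have key : ∀ h ∈ S.filter (fun h => f h = (u, b)), h = fun i => h 0 + w i := by
      intro h hh
      have h1 := congrArg Prod.fst (Finset.mem_filter.mp hh).2
      funext i
      refine Fin.cases ?_ (fun i => ?_) i
      · simp [w]
      · have := congrFun h1 i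
        simp only [f] at this
        simp only [w, Fin.cons_succ, ← this]; simp
    have h2 := hc l hl g hg hgood w b ((S.filter fun h => f h = (u, b)).image fun h => h 0) (by
      intro z hz
      obtain ⟨h, hh, rfl⟩ := Finset.mem_image.mp hz
      constructor
      · intro j
        rw [← key h hh]
        exact hS0 h (Finset.mem_filter.mp hh).1 j
      · intro s
        have h1 := congrArg Prod.snd (Finset.mem_filter.mp hh).2
        exact congrFun h1 s)
    rwa [Finset.card_image_of_injOn] at h2
    intro h hh h' hh' heq
    rw [key h hh, key h' hh']
    have : h 0 = h' 0 := heq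
    rw [this]
  have hcard := Finset.card_le_mul_card_image_of_maps_to hmaps c hfib
  rw [Finset.card_product] at hcard
  have hcard' : (S.card : ℝ) ≤ c * ((tupZ n k (2 * H)).card * (boxZ Δ (W * H)).card) := by
    exact_mod_cast hcard
  have h1 := card_tupZ_le n k (2 * H) (by linarith)
  have h2 := card_boxZ_le Δ (W * H) (by positivity)
  have h3 : (2 * (2 * H) + 1) ^ (n * k) ≤ (5 * H) ^ (n * k) := pow_le_pow_left₀ (by linarith) (by linarith) _
  have h4 : (2 * (W * H) + 1) ^ Δ ≤ ((2 * W + 1) * H) ^ Δ := pow_le_pow_left₀ (by positivity) (by linarith) _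
  calc (S.card : ℝ) ≤ c * ((tupZ n k (2 * H)).card * (boxZ Δ (W * H)).card) := hcard'
    _ ≤ (c + 1) * ((5 * H) ^ (n * k) * ((2 * W + 1) * H) ^ Δ) := by
      gcongr
      · linarith
      · exact h1.trans h3
      · exact h2.trans h4
    _ = _ := by rw [mul_pow, mul_pow, pow_add]; ring

end Count
end


-- part C1
section


section Dich

structure Sys (n R k Δ : ℕ) (f : Fin R → MvPolynomial (Fin n) ℤ) (Ct : ℝ) : Prop where
  deg : ∀ i, (f i).totalDegree ≤ k + 2
  one : 1 ≤ Ct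
  coe : ∀ i m, Finsupp.degree m = k + 2 → |((coeff m (f i) : ℤ) : ℝ)| ≤ Ct
  dim : ∀ b : Fin R → ℤ, b ≠ 0 → singDim n (MvPolynomial.map (Int.castRingHom Qbar)
    (∑ i, b i • homogeneousComponent (k + 2) (f i))) ≤ ((Δ : ℕ∞) : WithBot ℕ∞)

def KK (n k Δ : ℕ) : ℝ := ((n : ℝ) - (Δ : ℝ)) / 2 ^ (k + 1)

lemma clear_den {R : ℕ} (b : Fin R → ℚ) (hb : b ≠ 0) : ∃ (D : ℚ) (z : Fin R → ℤ), D ≠ 0 ∧ z ≠ 0 ∧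
    ∀ i, (z i : ℚ) = D * b i := by
  let D : ℕ := ∏ j, (b j).den
  have hD0 : (D : ℚ) ≠ 0 := by
    have : D ≠ 0 := Finset.prod_ne_zero_iff.mpr fun j _ => (b j).den_nz
    exact_mod_cast this
  have hD : ∀ j, ∃ z : ℤ, (z : ℚ) = (D : ℚ) * b j := by
    intro j
    obtain ⟨e, he⟩ : (b j).den ∣ D := Finset.dvd_prod_of_mem (fun j => (b j).den) (Finset.mem_univ j)
    refine ⟨e * (b j).num, ?_⟩
    rw [he]
    have := Rat.den_mul_eq_num (b j)
    push_cast
    rw [← this]; ring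
  choose z hz using hD
  refine ⟨D, z, hD0, ?_, hz⟩
  intro h0
  apply hb
  funext i
  have := hz i
  rw [h0] at this
  simpa [hD0] using this.symm

lemma span_dichotomy {R : ℕ} (V : Set (Fin R → ℤ)) :
    (∃ w : Fin R → Fin R → ℤ, (∀ r, w r ∈ V) ∧ (Matrix.of w).det ≠ 0) ∨
    (∃ b : Fin R → ℤ, b ≠ 0 ∧ ∀ v ∈ V, ∑ i, b i * v i = 0) := by
  let ι : (Fin R → ℤ) → (Fin R → ℚ) := fun v i => (v i : ℚ)
  by_cases hspan : Submodule.span ℚ (ι '' V) = ⊤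
  · left
    obtain ⟨b, hb1, hb2, hb3⟩ := exists_linearIndependent ℚ (ι '' V)
    rw [hspan] at hb2
    have hbasis : Module.Basis b ℚ (Fin R → ℚ) := Module.Basis.mk hb3 (by simp [hb2])
    have : Finite b := hb3.finite
    have := Fintype.ofFinite b
    have hcard : Fintype.card b = R := by
      rw [← Module.finrank_eq_card_basis hbasis]; simp
    let e : Fin R ≃ b := (Fintype.equivFinOfCardEq hcard).symm
    have hch : ∀ r : Fin R, ∃ v ∈ V, ι v = (e r).1 := fun r => hb1 (e r).2
    choose w hw1 hw2 using hch
    refine ⟨w, hw1, ?_⟩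
    have hli : LinearIndependent ℚ (fun r => ι (w r)) := by
      have h1 : (fun r => ι (w r)) = Subtype.val ∘ e := by
        funext r
        exact hw2 r
      rw [h1]
      exact hb3.comp e e.injective
    have hu : IsUnit ((Matrix.of w).map (Int.cast : ℤ → ℚ)) := by
      rw [← Matrix.linearIndependent_rows_iff_isUnit]
      exact hli
    have hdet := (Matrix.isUnit_iff_isUnit_det _).mp hu
    have h2 : ((Matrix.of w).map (Int.cast : ℤ → ℚ)).det = (((Matrix.of w).det : ℤ) : ℚ) := by
      have := (RingHom.map_det (Int.castRingHom ℚ) (Matrix.of w)).symm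
      simpa using this
    intro h0
    rw [h2, h0] at hdet
    simp at hdet
  · right
    obtain ⟨φ, hφ0, hφ⟩ := Submodule.exists_le_ker_of_lt_top _ (lt_top_iff_ne_top.mpr hspan)
    let b : Fin R → ℚ := fun i => φ (Pi.single i 1)
    have hφb : ∀ v, φ v = ∑ i, b i * v i := by
      intro v
      conv_lhs => rw [pi_eq_sum_univ' v]
      rw [map_sum]
      apply Finset.sum_congr rfl
      intro i _
      rw [map_smul, smul_eq_mul, mul_comm]
    have hb0 : b ≠ 0 := by
      intro h
      apply hφ0
      apply LinearMap.ext
      intro v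
      rw [hφb]
      simp [h]
    obtain ⟨D, z, hD, hz0, hz⟩ := clear_den b hb0
    refine ⟨z, hz0, fun v hv => ?_⟩
    have h1 : φ (ι v) = 0 := hφ (Submodule.subset_span ⟨v, hv, rfl⟩)
    rw [hφb] at h1
    have h2 : ((∑ i, z i * v i : ℤ) : ℚ) = D * ∑ i, b i * ι v i := by
      push_cast
      rw [Finset.mul_sum]
      apply Finset.sum_congr rfl
      intro i _
      rw [hz]; ring
    rw [h1, mul_zero] at h2
    exact_mod_cast h2

lemma mfac_le {n k : ℕ} (v : Fin k → Fin n) : mfac (fexp v) ≤ k.factorial ^ n := by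
  unfold mfac
  calc ∏ j, ((fexp v) j).factorial ≤ ∏ _j : Fin n, k.factorial := by
        apply Finset.prod_le_prod' 
        intro j _
        apply Nat.factorial_le
        exact (Finsupp.le_degree j (fexp v)).trans (degree_fexp v).le
    _ = _ := by simp

lemma Psi_bound {n R k Δ : ℕ} {f : Fin R → MvPolynomial (Fin n) ℤ} {Ct : ℝ} (hf : Sys n R k Δ f Ct)
    (i : Fin R) (j : Fin n) (h : Fin (k + 1) → Fin n → ℤ) (H : ℝ) (hH : 0 ≤ H)
    (hh : h ∈ tupZ n (k + 1) H) :
    |((Psi (f i) j h : ℤ) : ℝ)| ≤ (n ^ (k + 1) * (k + 2).factorial ^ n : ℝ) * (Ct * H ^ (k + 1)) := by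
  unfold Psi
  push_cast
  have hh' := mem_tupZ.mp hh
  calc _ ≤ ∑ v : Fin (k + 1) → Fin n, |((Tn (f i) (Fin.cons j v : Fin (k + 2) → Fin n) : ℤ) : ℝ) *
        ∏ r, (h r (v r) : ℝ)| := Finset.abs_sum_le_sum_abs _ _
    _ ≤ ∑ v : Fin (k + 1) → Fin n, ((k + 2).factorial ^ n : ℝ) * Ct * H ^ (k + 1) := by
      apply Finset.sum_le_sum
      intro v _
      rw [abs_mul, Finset.abs_prod]
      have h1 : ∏ r, |(h r (v r) : ℝ)| ≤ H ^ (k + 1) := by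
        calc _ ≤ ∏ _r : Fin (k + 1), H := Finset.prod_le_prod (fun _ _ => abs_nonneg _)
              (fun r _ => mem_boxZ.mp (hh' r) (v r))
          _ = _ := by simp
      have h2 : |((Tn (f i) (Fin.cons j v : Fin (k + 2) → Fin n) : ℤ) : ℝ)| ≤ ((k + 2).factorial ^ n : ℝ) * Ct := by
        unfold Tn
        push_cast
        rw [abs_mul]
        apply mul_le_mul
        · rw [abs_of_nonneg (by positivity)]
          exact_mod_cast mfac_le _
        · exact hf.coe i _ (degree_fexp _)
        · exact abs_nonneg _
        · positivity
      exact mul_le_mul h2 h1 (Finset.prod_nonneg fun _ _ => abs_nonneg _)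
        (le_trans (abs_nonneg _) h2)
    _ = _ := by
      rw [Finset.sum_const, Finset.card_univ]
      simp; ring

lemma Psi_cast {n k : ℕ} (g : MvPolynomial (Fin n) ℤ) (j : Fin n) (h : Fin k → Fin n → ℤ) :
    Psi (MvPolynomial.map (Int.castRingHom ℝ) g) j (toRR h) = ((Psi g j h : ℤ) : ℝ) := by
  unfold Psi Tn
  push_cast
  apply Finset.sum_congr rfl
  intro v _
  rw [coeff_map]
  simp [toRR, toR]

/-- the real polynomial `∑ α_i f_i` -/
def FF {n R : ℕ} (f : Fin R → MvPolynomial (Fin n) ℤ) (α : Fin R → ℝ) : MvPolynomial (Fin n) ℝ :=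
  ∑ i, C (α i) * MvPolynomial.map (Int.castRingHom ℝ) (f i)

lemma FF_eval {n R : ℕ} (f : Fin R → MvPolynomial (Fin n) ℤ) (α : Fin R → ℝ) (x : Fin n → ℤ) :
    eval (toR x) (FF f α) = ∑ i, α i * ((eval x (f i) : ℤ) : ℝ) := by
  unfold FF
  rw [map_sum]
  apply Finset.sum_congr rfl
  intro i _
  rw [map_mul, eval_C, eval_map]
  congr 1
  have := eval₂_comp_right (Int.castRingHom ℝ) (RingHom.id ℤ) x (f i)
  show eval₂ (Int.castRingHom ℝ) (toR x) (f i) = (Int.castRingHom ℝ) (eval₂ (RingHom.id ℤ) x (f i))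
  rw [eval₂_comp_left]
  rfl

lemma FF_Psi {n R k : ℕ} (f : Fin R → MvPolynomial (Fin n) ℤ) (α : Fin R → ℝ) (j : Fin n)
    (h : Fin k → Fin n → ℤ) : Psi (FF f α) j (toRR h) = ∑ i, α i * ((Psi (f i) j h : ℤ) : ℝ) := by
  unfold FF
  rw [Psi_sum_smul]
  simp only [Psi_cast]

lemma FF_dlt {n R k Δ : ℕ} {f : Fin R → MvPolynomial (Fin n) ℤ} {Ct : ℝ} (hf : Sys n R k Δ f Ct)
    (α : Fin R → ℝ) : dlt (k + 3) (FF f α) := by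
  apply dlt_sum
  intro i _
  apply dlt_C_mul
  intro m hm
  rw [coeff_map, dlt_iff_totalDegree (hf.deg i) m hm]; simp

lemma Psi_hc {n k : ℕ} (g : MvPolynomial (Fin n) ℤ) (j : Fin n) (h : Fin (k + 1) → Fin n → ℤ) :
    Psi (homogeneousComponent (k + 2) g) j h = Psi g j h := by
  unfold Psi Tn
  apply Finset.sum_congr rfl
  intro v _
  rw [coeff_homogeneousComponent, if_pos (degree_fexp _)]

lemma cramer_dioph (R : ℕ) (M : Matrix (Fin (R + 1)) (Fin (R + 1)) ℤ) (hM : M.det ≠ 0)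
    (α : Fin (R + 1) → ℝ) (B τ : ℝ) (hB : ∀ i j, |(M i j : ℝ)| ≤ B)
    (hτ : ∀ r, dZ (∑ i, α i * (M r i : ℝ)) ≤ τ) :
    ∃ (q : ℕ) (a : Fin (R + 1) → ℤ), 1 ≤ q ∧ (q : ℝ) ≤ (R + 1).factorial * B ^ (R + 1) ∧
      ∀ i, |(q : ℝ) * α i - a i| ≤ (R + 1) * R.factorial * B ^ R * τ := by
  have hB0 : 0 ≤ B := le_trans (abs_nonneg _) (hB 0 0)
  have hτ0 : 0 ≤ τ := le_trans (dZ_nonneg _) (hτ 0)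
  let MR : Matrix (Fin (R + 1)) (Fin (R + 1)) ℝ := M.map (Int.cast : ℤ → ℝ)
  have hdetR : MR.det = ((M.det : ℤ) : ℝ) := by
    have := (RingHom.map_det (Int.castRingHom ℝ) M).symm
    simpa [MR] using this
  have hadjR : ∀ i r, MR.adjugate i r = ((M.adjugate i r : ℤ) : ℝ) := by
    intro i r
    have := RingHom.map_adjugate (Int.castRingHom ℝ) M
    have := congrFun (congrFun this i) r
    simpa [MR] using this.symm
  have hadj : ∀ i r, |(M.adjugate i r : ℝ)| ≤ R.factorial * B ^ R := by
    intro i r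
    rw [← hadjR, Matrix.adjugate_fin_succ_eq_det_submatrix, abs_mul, abs_pow, abs_neg, abs_one, one_pow, one_mul]
    have := Matrix.det_le (A := MR.submatrix r.succAbove i.succAbove) (abv := AbsoluteValue.abs) (x := B)
      (fun a b => hB _ _)
    simpa using this
  let y : Fin (R + 1) → ℤ := fun r => round (∑ i, α i * (M r i : ℝ))
  let η : Fin (R + 1) → ℝ := fun r => ∑ i, α i * (M r i : ℝ) - y r
  have hη : ∀ r, |η r| ≤ τ := hτ
  have hsolve : ∀ i, (M.det : ℝ) * α i = ∑ r, (M.adjugate i r : ℝ) * (∑ i, α i * (M r i : ℝ)) := by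
    intro i
    have h1 : MR.adjugate.mulVec (MR.mulVec α) = MR.det • α := by
      rw [Matrix.mulVec_mulVec, Matrix.adjugate_mul, Matrix.smul_mulVec, Matrix.one_mulVec]
    have h2 := congrFun h1 i
    rw [Pi.smul_apply, smul_eq_mul, hdetR] at h2
    rw [← h2]
    simp only [Matrix.mulVec, dotProduct, hadjR]
    apply Finset.sum_congr rfl
    intro r _
    congr 1
    apply Finset.sum_congr rfl
    intro i' _
    simp [MR, mul_comm]
  have hmain : ∀ i, |(M.det : ℝ) * α i - (∑ r, M.adjugate i r * y r : ℤ)| ≤ (R + 1) * R.factorial * B ^ R * τ := by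
    intro i
    rw [hsolve]
    push_cast
    rw [← Finset.sum_sub_distrib]
    calc _ ≤ ∑ r, |(M.adjugate i r : ℝ) * (∑ i, α i * (M r i : ℝ)) - (M.adjugate i r : ℝ) * (y r : ℝ)| :=
          Finset.abs_sum_le_sum_abs _ _
      _ ≤ ∑ r : Fin (R + 1), R.factorial * B ^ R * τ := by
        apply Finset.sum_le_sum
        intro r _
        rw [← mul_sub, abs_mul]
        exact mul_le_mul (hadj i r) (hη r) (abs_nonneg _) (by positivity)
      _ = _ := by simp; ring
  have hdetb : |(M.det : ℝ)| ≤ (R + 1).factorial * B ^ (R + 1) := by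
    rw [← hdetR]
    have := Matrix.det_le (A := MR) (abv := AbsoluteValue.abs) (x := B) (fun a b => hB _ _)
    simpa using this
  refine ⟨M.det.natAbs, fun i => M.det.sign * ∑ r, M.adjugate i r * y r, Int.natAbs_pos.mpr hM, ?_, ?_⟩
  · rw [Nat.cast_natAbs, Int.cast_abs]; exact hdetb
  · intro i
    have h1 : ((M.det.natAbs : ℕ) : ℝ) = (M.det.sign : ℝ) * (M.det : ℝ) := by
      rw [Nat.cast_natAbs, ← Int.sign_mul_self_eq_abs]
      push_cast; ring
    rw [h1, Int.cast_mul, mul_assoc, ← mul_sub, abs_mul]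
    have h2 : |(M.det.sign : ℝ)| = 1 := by
      rw [← Int.cast_abs, Int.abs_sign_of_ne_zero hM]; simp
    rw [h2, one_mul]
    exact hmain i

lemma one_add_log_le (ε : ℝ) (hε : 0 < ε) (N : ℝ) (hN : 1 ≤ N) :
    1 + Real.log N ≤ (1 + 1 / ε) * N ^ ε := by
  have h1 := Real.log_le_rpow_div (by linarith : 0 ≤ N) hε
  have h2 : 1 ≤ N ^ ε := Real.one_le_rpow hN hε.le
  calc _ ≤ N ^ ε + N ^ ε / ε := by linarith
    _ = _ := by field_simp

theorem weyl_dich (n R k Δ : ℕ) (hΔ : Δ ≤ n) (ε : ℝ) (hε : 0 < ε) : ∃ c : ℝ, 1 ≤ c ∧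
    ∀ (f : Fin (R + 1) → MvPolynomial (Fin n) ℤ) (Ct : ℝ), Sys n (R + 1) k Δ f Ct →
    ∀ N H : ℝ, 1 ≤ H → H ≤ N → ∀ lo hi : Fin n → ℤ, (∀ j, (hi j - lo j + 1 : ℝ) ≤ N) →
    ∀ α : Fin (R + 1) → ℝ,
    ‖∑ x ∈ Finset.Icc lo hi, eC (∑ i, α i * ((eval x (f i) : ℤ) : ℝ))‖ ≤
        c * N ^ ((n : ℝ) + ε) * H ^ (- KK n k Δ) ∨
    ∃ (q : ℕ) (a : Fin (R + 1) → ℤ), 1 ≤ q ∧ (q : ℝ) ≤ c * Ct ^ (R + 1) * H ^ ((R + 1) * (k + 1)) ∧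
      ∀ i, |(q : ℝ) * α i - a i| ≤ c * Ct ^ R * H ^ ((R + 1) * (k + 1)) / N ^ (k + 2) := by
  classical
  obtain ⟨c1, hc1, hW⟩ := weyl_count n k
  obtain ⟨c2, hc2, hV⟩ := variety_count n k Δ
  set cp : ℝ := (n ^ (k + 1) * (k + 2).factorial ^ n : ℝ) with hcp
  have hcp0 : 0 ≤ cp := by positivity
  set D : ℕ := 2 ^ (k + 1) with hD
  have hD0 : D ≠ 0 := by positivity
  have hDR : (0 : ℝ) < D := by positivity
  set ε' : ℝ := ε * D / (n + 1) with hε'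
  have hε'0 : 0 < ε' := by positivity
  set c3 : ℝ := c1 * c2 * (1 + 1 / ε') ^ n with hc3
  have hc30 : 0 < c3 := by positivity
  set c : ℝ := 1 + c3 ^ ((1 : ℝ) / D) + (R + 1).factorial * cp ^ (R + 1) + (R + 1) * R.factorial * cp ^ R with hc
  have hp1 : 0 ≤ c3 ^ ((1 : ℝ) / D) := by positivity
  have hp2 : 0 ≤ (R + 1).factorial * cp ^ (R + 1) := by positivity
  have hp3 : 0 ≤ (R + 1) * R.factorial * cp ^ R := by positivity
  refine ⟨c, by rw [hc]; linarith, ?_⟩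
  intro f Ct hf N H hH hHN lo hi hbox α
  have hN1 : 1 ≤ N := hH.trans hHN
  have hCt := hf.one
  set τ : ℝ := H ^ (k + 1) / N ^ (k + 2) with hτ
  set T := TC (fun (h : Fin (k + 1) → Fin n → ℤ) j => Psi (FF f α) j (toRR h)) H τ with hT
  have hW' := hW (FF f α) (FF_dlt hf α) N H hH hHN lo hi hbox
  simp only [FF_eval] at hW'
  have hTmem : ∀ h ∈ T, h ∈ tupZ n (k + 1) H ∧ ∀ j, dZ (∑ i, α i * ((Psi (f i) j h : ℤ) : ℝ)) ≤ τ := by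
    intro h hh
    have := Finset.mem_filter.mp hh
    refine ⟨this.1, fun j => ?_⟩
    rw [← FF_Psi]; exact this.2 j
  rcases span_dichotomy {v : Fin (R + 1) → ℤ | ∃ h ∈ T, ∃ j, v = fun i => Psi (f i) j h} with ⟨w, hw, hdet⟩ | ⟨b, hb0, hb⟩
  · right
    have hwb : ∀ r i, |((w r i : ℤ) : ℝ)| ≤ cp * (Ct * H ^ (k + 1)) := by
      intro r i
      obtain ⟨h, hh, j, hv⟩ := hw r
      rw [hv]
      exact Psi_bound hf i j h H (by linarith) (hTmem h hh).1
    obtain ⟨q, a, hq1, hq2, ha⟩ := cramer_dioph R (Matrix.of w) hdet α _ τ (fun i j => hwb i j) (by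
      intro r
      obtain ⟨h, hh, j, hv⟩ := hw r
      have : ∀ i, (Matrix.of w) r i = Psi (f i) j h := fun i => congrFun hv i
      simp only [this]
      exact (hTmem h hh).2 j)
    refine ⟨q, a, hq1, hq2.trans ?_, fun i => (ha i).trans ?_⟩
    · rw [mul_pow, mul_pow, ← pow_mul, mul_comm (k + 1) (R + 1)]
      calc _ = ((R + 1).factorial * cp ^ (R + 1)) * (Ct ^ (R + 1) * H ^ ((R + 1) * (k + 1))) := by ring
        _ ≤ c * (Ct ^ (R + 1) * H ^ ((R + 1) * (k + 1))) := by
          apply mul_le_mul_of_nonneg_right _ (by positivity)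
          rw [hc]; linarith
        _ = _ := by ring
    · rw [mul_pow, mul_pow, ← pow_mul, hτ]
      have : H ^ ((k + 1) * R) * H ^ (k + 1) = H ^ ((R + 1) * (k + 1)) := by
        rw [← pow_add]; congr 1; ring
      calc _ = ((R + 1) * R.factorial * cp ^ R) * (Ct ^ R * (H ^ ((k + 1) * R) * H ^ (k + 1)) / N ^ (k + 2)) := by
            ring
        _ ≤ c * (Ct ^ R * (H ^ ((k + 1) * R) * H ^ (k + 1)) / N ^ (k + 2)) := by
          apply mul_le_mul_of_nonneg_right _ (by positivity)
          rw [hc]; linarith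
        _ = _ := by rw [this]; ring
  · left
    have hcount := hV (∑ i, b i • homogeneousComponent (k + 2) (f i)) (by
        apply IsHomogeneous.sum
        intro i _
        rw [zsmul_eq_mul]
        have : ((b i : ℤ) : MvPolynomial (Fin n) ℤ) = C (b i) := by simp
        rw [this]
        exact (homogeneousComponent_isHomogeneous _ _).C_mul _) (hf.dim b hb0) H hH T
        (Finset.filter_subset _ _) (by
      intro h hh j
      have h1 := hb _ ⟨h, hh, j, rfl⟩
      have h2 : (∑ i, b i • homogeneousComponent (k + 2) (f i)) =
          ∑ i, C (b i) * homogeneousComponent (k + 2) (f i) := by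
        apply Finset.sum_congr rfl
        intro i _
        rw [zsmul_eq_mul]; simp
      rw [h2, Psi_sum_smul]
      simp only [Psi_hc]
      exact h1)
    set S := ‖∑ x ∈ Finset.Icc lo hi, eC (∑ i, α i * ((eval x (f i) : ℤ) : ℝ))‖ with hS
    have hlog : 0 ≤ 1 + Real.log N := by linarith [Real.log_nonneg hN1]
    have h1 : S ^ D ≤ c3 * (N ^ ((n : ℝ) + ε)) ^ D * H ^ (-((n : ℝ) - Δ)) := by
      have hl2 : (1 + Real.log N) ^ n ≤ (1 + 1 / ε') ^ n * N ^ (ε * D) := by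
        calc (1 + Real.log N) ^ n ≤ ((1 + 1 / ε') * N ^ ε') ^ n :=
              pow_le_pow_left₀ hlog (one_add_log_le ε' hε'0 N hN1) n
          _ = (1 + 1 / ε') ^ n * N ^ (ε' * n) := by
            rw [mul_pow, ← Real.rpow_natCast (N ^ ε'), ← Real.rpow_mul (by linarith)]
          _ ≤ (1 + 1 / ε') ^ n * N ^ (ε * D) := by
            apply mul_le_mul_of_nonneg_left _ (by positivity)
            apply Real.rpow_le_rpow_of_exponent_le hN1
            rw [hε', div_mul_eq_mul_div, div_le_iff₀ (by positivity)]
            have : 0 ≤ ε * D := by positivity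
            nlinarith
      have hH2 : (H ^ (n * (k + 1)))⁻¹ * H ^ (n * k + Δ) = H ^ (-((n : ℝ) - Δ)) := by
        rw [← Real.rpow_natCast, ← Real.rpow_natCast, ← Real.rpow_neg (by linarith), ← Real.rpow_add (by linarith)]
        congr 1
        push_cast; ring
      have hN2 : (N ^ ((n : ℝ) + ε)) ^ D = N ^ (n * D) * N ^ (ε * D) := by
        rw [← Real.rpow_natCast, ← Real.rpow_mul (by linarith), ← Real.rpow_natCast N, ← Real.rpow_add (by linarith)]
        congr 1
        push_cast; ring
      calc S ^ D ≤ c1 * N ^ (n * D) * (1 + Real.log N) ^ n * (H ^ (n * (k + 1)))⁻¹ * (T.card : ℝ) := hW'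
        _ ≤ c1 * N ^ (n * D) * ((1 + 1 / ε') ^ n * N ^ (ε * D)) * (H ^ (n * (k + 1)))⁻¹ * (c2 * H ^ (n * k + Δ)) := by
          gcongr
        _ = c3 * (N ^ (n * D) * N ^ (ε * D)) * ((H ^ (n * (k + 1)))⁻¹ * H ^ (n * k + Δ)) := by
          rw [hc3]; ring
        _ = _ := by rw [hH2, hN2]
    have h2 : c3 * (N ^ ((n : ℝ) + ε)) ^ D * H ^ (-((n : ℝ) - Δ)) =
        (c3 ^ ((1 : ℝ) / D) * N ^ ((n : ℝ) + ε) * H ^ (- KK n k Δ)) ^ D := by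
      rw [mul_pow, mul_pow]
      congr 1
      · congr 1
        rw [← Real.rpow_natCast, ← Real.rpow_mul hc30.le, one_div, inv_mul_cancel₀ hDR.ne', Real.rpow_one]
      · rw [← Real.rpow_natCast, ← Real.rpow_mul (by linarith)]
        congr 1
        rw [KK, hD]
        push_cast
        field_simp
    rw [h2] at h1
    have h3 := le_of_pow_le_pow_left₀ hD0 (by positivity) h1
    refine h3.trans ?_
    apply mul_le_mul_of_nonneg_right _ (by positivity)
    apply mul_le_mul_of_nonneg_right _ (by positivity)
    rw [hc]; linarith

end Dich
end


-- part C2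
section


section Gauss

/-- `κ = K / (R (d-1))` (with `R + 1` equations, `d = k + 2`). -/
def kap (n R k Δ : ℕ) : ℝ := KK n k Δ / (((R + 1) * (k + 1) : ℕ) : ℝ)

theorem weyl_X (n R k Δ : ℕ) (hΔ : Δ ≤ n) (ε : ℝ) (hε : 0 < ε) : ∃ c : ℝ, 1 ≤ c ∧
    ∀ (f : Fin (R + 1) → MvPolynomial (Fin n) ℤ) (Ct : ℝ), Sys n (R + 1) k Δ f Ct →
    ∀ N X : ℝ, 1 ≤ N → 1 ≤ X → X ≤ N ^ ((R + 1) * (k + 1)) →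
    ∀ lo hi : Fin n → ℤ, (∀ j, (hi j - lo j + 1 : ℝ) ≤ N) →
    ∀ α : Fin (R + 1) → ℝ,
    ‖∑ x ∈ Finset.Icc lo hi, eC (∑ i, α i * ((eval x (f i) : ℤ) : ℝ))‖ ≤
        c * N ^ ((n : ℝ) + ε) * X ^ (- kap n R k Δ) ∨
    ∃ (q : ℕ) (a : Fin (R + 1) → ℤ), 1 ≤ q ∧ (q : ℝ) ≤ c * Ct ^ (R + 1) * X ∧
      ∀ i, |(q : ℝ) * α i - a i| ≤ c * Ct ^ R * X / N ^ (k + 2) := by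
  obtain ⟨c, hc, h⟩ := weyl_dich n R k Δ hΔ ε hε
  refine ⟨c, hc, fun f Ct hf N X hN hX hXN lo hi hlh α => ?_⟩
  have hm0 : ((R + 1) * (k + 1)) ≠ 0 := by positivity
  have hm0' : (((R + 1) * (k + 1) : ℕ) : ℝ) ≠ 0 := by exact_mod_cast hm0
  generalize hm : (R + 1) * (k + 1) = m at *
  have hX0 : 0 ≤ X := by linarith
  have hH1 : 1 ≤ X ^ ((m : ℝ)⁻¹) := Real.one_le_rpow hX (by positivity)
  have hHm : (X ^ ((m : ℝ)⁻¹)) ^ m = X := Real.rpow_inv_natCast_pow hX0 hm0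
  have hHN : X ^ ((m : ℝ)⁻¹) ≤ N := by
    rw [← pow_le_pow_iff_left₀ (by positivity) (by linarith) hm0, hHm]
    exact hXN
  have := h f Ct hf N _ hH1 hHN lo hi hlh α
  rw [hHm, ← Real.rpow_mul hX0] at this
  have e : (m : ℝ)⁻¹ * -KK n k Δ = - kap n R k Δ := by
    unfold kap; rw [hm]; ring
  rwa [e] at this

/-- coprimality in the form needed -/
def Cop {R : ℕ} (q : ℕ) (a : Fin R → ℤ) : Prop := ∀ p : ℕ, (∀ i, (q : ℤ) ∣ p * a i) → q ∣ p

lemma cop_of_resSet {R q : ℕ} {a : Fin R → Fin q} (ha : a ∈ resSet R q q) :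
    Cop q (fun i => ((a i : ℕ) : ℤ) + 1) := by
  intro p hp
  unfold resSet at ha
  rw [Finset.mem_filter] at ha
  have h1 : q ∣ Finset.univ.gcd (fun i => p * ((a i : ℕ) + 1)) := by
    apply Finset.dvd_gcd
    intro i _
    have := hp i
    simp only at this
    exact_mod_cast this
  rw [Finset.gcd_mul_left] at h1
  have h2 : Nat.Coprime q (Finset.univ.gcd fun i => (a i : ℕ) + 1) := by
    rw [Nat.coprime_comm]; exact ha.2
  exact h2.dvd_of_dvd_mul_right (by simpa using h1)

lemma eval_modEq {n : ℕ} (q : ℤ) (F : MvPolynomial (Fin n) ℤ) (x y : Fin n → ℤ)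
    (h : ∀ j, x j ≡ y j [ZMOD q]) : eval x F ≡ eval y F [ZMOD q] := by
  induction F using MvPolynomial.induction_on with
  | C a => simp [Int.ModEq]
  | add p r hp hr => simpa using hp.add hr
  | mul_X p j hp => simpa using hp.mul (h j)

/-- Sums over `Fin q` boxes as sums over integer intervals. -/
lemma sum_fin_box {n q : ℕ} {M : Type*} [AddCommMonoid M] (g : (Fin n → ℤ) → M) :
    ∑ x : Fin n → Fin q, g (fun j => ((x j : ℕ) : ℤ)) =
      ∑ x ∈ Finset.Icc (fun _ : Fin n => (0 : ℤ)) (fun _ => (q : ℤ) - 1), g x := by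
  refine Finset.sum_bij' (i := fun (x : Fin n → Fin q) _ => (fun j => ((x j : ℕ) : ℤ)))
    (j := fun x hx => fun j => ⟨(x j).toNat, by
      rw [Finset.mem_Icc] at hx
      have h1 := hx.1 j
      have h2 := hx.2 j
      simp only at h1 h2
      omega⟩) ?_ ?_ ?_ ?_ ?_
  · intro x _
    rw [Finset.mem_Icc]
    constructor
    · intro j; simp
    · intro j
      have := (x j).2
      simp only
      omega
  · intro x hx; simp
  · intro x hx; funext j; simp
  · intro x hx
    have hx' := Finset.mem_Icc.mp hx
    funext j
    have h1 := hx'.1 j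
    simp only at h1
    simp [h1]
  · intro x hx; rfl

lemma norm_sum_eC_le {ι : Type*} (s : Finset ι) (φ : ι → ℝ) : ‖∑ x ∈ s, eC (φ x)‖ ≤ s.card := by
  calc _ ≤ ∑ x ∈ s, ‖eC (φ x)‖ := norm_sum_le _ _
    _ = _ := by simp [norm_eC]

lemma norm_Sgauss_le {n R : ℕ} (f : Fin R → MvPolynomial (Fin n) ℤ) (q : ℕ) (a : Fin R → ℤ) :
    ‖Sgauss f q a‖ ≤ (q : ℝ) ^ n := by
  unfold Sgauss
  refine (norm_sum_eC_le _ _).trans ?_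
  simp

theorem gauss_bound (n R k Δ : ℕ) (hΔ : Δ ≤ n) (ε : ℝ) (hε : 0 < ε) : ∃ c : ℝ, 1 ≤ c ∧
    ∀ (f : Fin (R + 1) → MvPolynomial (Fin n) ℤ) (Ct : ℝ), Sys n (R + 1) k Δ f Ct →
    ∀ (q : ℕ) (a : Fin (R + 1) → ℤ), 1 ≤ q → Cop q a →
    ‖Sgauss f q a‖ ≤ c * Ct ^ (((R : ℝ) + 1) * kap n R k Δ) * (q : ℝ) ^ ((n : ℝ) - kap n R k Δ + ε) := by
  obtain ⟨c, hc, h⟩ := weyl_X n R k Δ hΔ ε hε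
  have hκ : 0 ≤ kap n R k Δ := by
    unfold kap KK
    have : (0 : ℝ) ≤ (n : ℝ) - Δ := by
      rw [sub_nonneg]; exact_mod_cast hΔ
    positivity
  set κ := kap n R k Δ with hκdef
  have hc0 : 0 < c := by linarith
  refine ⟨c * (2 * c) ^ κ, one_le_mul_of_one_le_of_one_le hc
    (Real.one_le_rpow (by linarith) hκ), fun f Ct hf q a hq hcop => ?_⟩
  have hCt := hf.one
  have hCt0 : 0 < Ct := by linarith
  have hq1 : (1 : ℝ) ≤ q := by exact_mod_cast hq
  have hq0 : (0 : ℝ) < q := by linarith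
  set X : ℝ := q / (2 * c * Ct ^ (R + 1)) with hX
  have hX0 : 0 < X := by positivity
  have hXpow : X ^ (-κ) = (2 * c) ^ κ * Ct ^ (((R : ℝ) + 1) * κ) * (q : ℝ) ^ (-κ) := by
    rw [hX, Real.div_rpow hq0.le (by positivity), Real.mul_rpow (by positivity) (by positivity),
      Real.rpow_neg (by positivity : 0 ≤ 2 * c), Real.rpow_neg (by positivity : 0 ≤ Ct ^ (R + 1)),
      ← Real.rpow_natCast Ct, ← Real.rpow_mul hCt0.le]
    push_cast
    field_simp
  have htarget : c * (2 * c) ^ κ * Ct ^ (((R : ℝ) + 1) * κ) * (q : ℝ) ^ ((n : ℝ) - κ + ε) =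
      c * (q : ℝ) ^ ((n : ℝ) + ε) * X ^ (-κ) := by
    rw [hXpow, show (n : ℝ) - κ + ε = (n + ε) + (-κ) by ring, Real.rpow_add hq0]
    ring
  rw [htarget]
  by_cases hX1 : 1 ≤ X
  · have hXN : X ≤ (q : ℝ) ^ ((R + 1) * (k + 1)) := by
      calc X ≤ q := by
            rw [hX]
            apply div_le_self hq0.le
            have : 1 ≤ Ct ^ (R + 1) := one_le_pow₀ hCt
            nlinarith
        _ ≤ _ := le_self_pow₀ hq1 (by positivity)
    rcases h f Ct hf q X hq1 hX1 hXN (fun _ => 0) (fun _ => (q : ℤ) - 1) (by intro j; simp)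
      (fun i => (a i : ℝ) / q) with h1 | ⟨q', a', hq', hq'2, ha'⟩
    · refine le_trans (le_of_eq ?_) h1
      unfold Sgauss
      rw [← sum_fin_box (fun x => eC (∑ i, (a i : ℝ) / q * ((eval x (f i) : ℤ) : ℝ)))]
      congr 1
      apply Finset.sum_congr rfl
      intro x _
      congr 1
      rw [Finset.sum_div]
      apply Finset.sum_congr rfl
      intro i _
      ring
    · exfalso
      have e1 : c * Ct ^ (R + 1) * X = q / 2 := by
        rw [hX]; field_simp
      have hlt : (q' : ℝ) < q := by rw [e1] at hq'2; linarith
      have e2 : c * Ct ^ R * X / (q : ℝ) ^ (k + 2) ≤ 1 / (2 * q) := by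
        have : c * Ct ^ R * X ≤ c * Ct ^ (R + 1) * X := by
          have : Ct ^ R ≤ Ct ^ (R + 1) := pow_le_pow_right₀ hCt (by omega)
          gcongr
        rw [e1] at this
        have h2 : (q : ℝ) ^ 2 ≤ (q : ℝ) ^ (k + 2) := pow_le_pow_right₀ hq1 (by omega)
        calc _ ≤ (q / 2 : ℝ) / (q : ℝ) ^ 2 := by gcongr
          _ = _ := by field_simp
      have hdiv : ∀ i, (q : ℤ) ∣ q' * a i := by
        intro i
        have h3 := (ha' i).trans e2
        have h4 : |((q' * a i - q * a' i : ℤ) : ℝ)| < 1 := by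
          have : ((q' * a i - q * a' i : ℤ) : ℝ) = q * ((q' : ℝ) * ((a i : ℝ) / q) - a' i) := by
            push_cast; field_simp
          rw [this, abs_mul, abs_of_pos hq0]
          calc _ ≤ (q : ℝ) * (1 / (2 * q)) := by gcongr
            _ < 1 := by field_simp; norm_num
        have h5 : (q' * a i - q * a' i : ℤ) = 0 := by
          rw [← Int.abs_lt_one_iff]
          exact_mod_cast h4
        exact ⟨a' i, by linarith⟩
      have := Nat.le_of_dvd hq' (hcop q' hdiv)
      have : (q : ℝ) ≤ q' := by exact_mod_cast this
      linarith
  · have h1 : 1 ≤ X ^ (-κ) := by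
      apply Real.one_le_rpow_of_pos_of_le_one_of_nonpos hX0 (by linarith) (by linarith)
    calc _ ≤ (q : ℝ) ^ n := norm_Sgauss_le _ _ _
      _ = (q : ℝ) ^ (n : ℝ) := (Real.rpow_natCast _ _).symm
      _ ≤ (q : ℝ) ^ ((n : ℝ) + ε) := Real.rpow_le_rpow_of_exponent_le hq1 (by linarith)
      _ ≤ _ := by
        have : 0 ≤ (q : ℝ) ^ ((n : ℝ) + ε) := by positivity
        calc _ = 1 * (q : ℝ) ^ ((n : ℝ) + ε) * 1 := by ring
          _ ≤ _ := by gcongr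

end Gauss
end


-- part C3
section


section MajorApprox

def Mon (n d : ℕ) : Finset (Fin n →₀ ℕ) :=
  Finset.Icc 0 (Finsupp.equivFunOnFinite.symm fun _ => d)

lemma mem_Mon_of_degree {n d : ℕ} {m : Fin n →₀ ℕ} (h : Finsupp.degree m ≤ d) : m ∈ Mon n d := by
  unfold Mon
  rw [Finset.mem_Icc]
  refine ⟨bot_le, fun j => ?_⟩
  exact (Finsupp.le_degree j m).trans h

lemma aeval_Mon {n d : ℕ} (F : MvPolynomial (Fin n) ℤ) (hF : F.totalDegree ≤ d) (y : Fin n → ℝ) :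
    aeval y F = ∑ m ∈ Mon n d, ((coeff m F : ℤ) : ℝ) * ∏ j, y j ^ m j := by
  rw [aeval_def, eval₂_eq']
  simp only [algebraMap_int_eq, eq_intCast]
  apply Finset.sum_subset
  · intro m hm
    apply mem_Mon_of_degree
    have := le_totalDegree hm
    refine le_trans (le_of_eq ?_) (this.trans hF)
    rfl
  · intro m _ hm
    rw [notMem_support_iff] at hm
    simp [hm]

lemma eval_cast {n : ℕ} (F : MvPolynomial (Fin n) ℤ) (x : Fin n → ℤ) :
    ((eval x F : ℤ) : ℝ) = aeval (toR x) F := by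
  induction F using MvPolynomial.induction_on with
  | C a => simp
  | add p r hp hr => simp [hp, hr]
  | mul_X p j hp => simp [hp, toR]

lemma mon_abs {n : ℕ} (x : Fin n → ℝ) (L : ℝ) (hx : ∀ j, |x j| ≤ L) (m : Fin n →₀ ℕ) :
    |∏ j, x j ^ m j| ≤ L ^ (Finsupp.degree m) := by
  rw [Finset.abs_prod, Finsupp.degree_eq_sum, ← Finset.prod_pow_eq_pow_sum]
  apply Finset.prod_le_prod
  · intro j _; positivity
  · intro j _; rw [abs_pow]; exact pow_le_pow_left₀ (abs_nonneg _) (hx j) _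

lemma mon_diff {n : ℕ} (x y : Fin n → ℝ) (L q : ℝ) (hL : 0 ≤ L) (hx : ∀ j, |x j| ≤ L)
    (hy : ∀ j, |y j| ≤ L) (hxy : ∀ j, |x j - y j| ≤ q) (m : Fin n →₀ ℕ) :
    L * |∏ j, x j ^ m j - ∏ j, y j ^ m j| ≤ Finsupp.degree m * L ^ (Finsupp.degree m) * q := by
  have pw : ∀ j, ∀ k : ℕ, L * |x j ^ k - y j ^ k| ≤ k * L ^ k * q := by
    intro j k
    induction k with
    | zero => simp
    | succ k ih =>
      have e : x j ^ (k + 1) - y j ^ (k + 1) = (x j ^ k - y j ^ k) * x j + y j ^ k * (x j - y j) := by ring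
      rw [e]
      calc _ ≤ L * (|x j ^ k - y j ^ k| * |x j| + |y j| ^ k * |x j - y j|) := by
            gcongr
            refine (abs_add_le _ _).trans ?_
            rw [abs_mul, abs_mul, abs_pow]
        _ ≤ (L * |x j ^ k - y j ^ k|) * L + L * (L ^ k * q) := by
            have := mul_le_mul_of_nonneg_left (hx j) (abs_nonneg (x j ^ k - y j ^ k))
            have h2 : |y j| ^ k * |x j - y j| ≤ L ^ k * q :=
              mul_le_mul (pow_le_pow_left₀ (abs_nonneg _) (hy j) _) (hxy j) (abs_nonneg _) (by positivity)
            calc _ ≤ L * (|x j ^ k - y j ^ k| * L + L ^ k * q) := by gcongr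
              _ = _ := by ring
        _ ≤ (k * L ^ k * q) * L + L * (L ^ k * q) := by gcongr
        _ = _ := by push_cast; ring
  rw [Finsupp.degree_eq_sum]
  have key : ∀ s : Finset (Fin n), L * |∏ j ∈ s, x j ^ m j - ∏ j ∈ s, y j ^ m j| ≤
      ((∑ j ∈ s, m j : ℕ) : ℝ) * L ^ (∑ j ∈ s, m j) * q := by
    intro s
    induction s using Finset.induction_on with
    | empty => simp
    | insert a s ha ih =>
      rw [Finset.prod_insert ha, Finset.prod_insert ha, Finset.sum_insert ha]
      have e : x a ^ m a * ∏ j ∈ s, x j ^ m j - y a ^ m a * ∏ j ∈ s, y j ^ m j =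
        (x a ^ m a - y a ^ m a) * ∏ j ∈ s, x j ^ m j +
          y a ^ m a * (∏ j ∈ s, x j ^ m j - ∏ j ∈ s, y j ^ m j) := by ring
      rw [e]
      have hp : |∏ j ∈ s, x j ^ m j| ≤ L ^ (∑ j ∈ s, m j) := by
        rw [Finset.abs_prod, ← Finset.prod_pow_eq_pow_sum]
        apply Finset.prod_le_prod
        · intro j _; positivity
        · intro j _; rw [abs_pow]; exact pow_le_pow_left₀ (abs_nonneg _) (hx j) _
      have hya : |y a ^ m a| ≤ L ^ m a := by
        rw [abs_pow]; exact pow_le_pow_left₀ (abs_nonneg _) (hy a) _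
      calc _ ≤ L * (|x a ^ m a - y a ^ m a| * |∏ j ∈ s, x j ^ m j| +
            |y a ^ m a| * |∏ j ∈ s, x j ^ m j - ∏ j ∈ s, y j ^ m j|) := by
            gcongr
            refine (abs_add_le _ _).trans ?_
            rw [abs_mul, abs_mul]
        _ = (L * |x a ^ m a - y a ^ m a|) * |∏ j ∈ s, x j ^ m j| +
            |y a ^ m a| * (L * |∏ j ∈ s, x j ^ m j - ∏ j ∈ s, y j ^ m j|) := by ring
        _ ≤ (m a * L ^ m a * q) * L ^ (∑ j ∈ s, m j) +
            L ^ m a * (((∑ j ∈ s, m j : ℕ) : ℝ) * L ^ (∑ j ∈ s, m j) * q) := by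
            have h1 := (mul_nonneg hL (abs_nonneg (x a ^ m a - y a ^ m a))).trans (pw a (m a))
            exact add_le_add (mul_le_mul (pw a _) hp (abs_nonneg _) h1)
              (mul_le_mul hya ih (by positivity) (by positivity))
        _ = _ := by push_cast; ring
  exact key Finset.univ

lemma f_diff {n D : ℕ} (F : MvPolynomial (Fin n) ℤ) (hF : F.totalDegree ≤ D + 1) (C : ℝ)
    (hC : ∀ m, |((coeff m F : ℤ) : ℝ)| ≤ C) (x : Fin n → ℤ) (y : Fin n → ℝ) (L q : ℝ) (hL : 1 ≤ L)
    (hq : 1 ≤ q) (hx : ∀ j, |(x j : ℝ)| ≤ L) (hy : ∀ j, |y j| ≤ L) (hxy : ∀ j, |(x j : ℝ) - y j| ≤ q) :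
    |((eval x F : ℤ) : ℝ) - aeval y (homogeneousComponent (D + 1) F)| ≤
      (Mon n (D + 1)).card * (D + 1) * C * L ^ D * q := by
  have hC0 : 0 ≤ C := (abs_nonneg _).trans (hC 0)
  rw [eval_cast, aeval_Mon F hF, aeval_Mon (d := D + 1) _ (homogeneousComponent_isHomogeneous _ _).totalDegree_le,
    ← Finset.sum_sub_distrib]
  calc _ ≤ ∑ m ∈ Mon n (D + 1), |((coeff m F : ℤ) : ℝ) * ∏ j, toR x j ^ m j -
        ((coeff m (homogeneousComponent (D + 1) F) : ℤ) : ℝ) * ∏ j, y j ^ m j| :=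
        Finset.abs_sum_le_sum_abs _ _
    _ ≤ ∑ m ∈ Mon n (D + 1), (D + 1) * C * L ^ D * q := by
      apply Finset.sum_le_sum
      intro m _
      rw [coeff_homogeneousComponent]
      by_cases hm : Finsupp.degree m = D + 1
      · rw [if_pos hm, ← mul_sub, abs_mul]
        have := mon_diff (toR x) y L q (by linarith) hx hy hxy m
        rw [hm, pow_succ] at this
        have h2 : |∏ j, toR x j ^ m j - ∏ j, y j ^ m j| ≤ (D + 1) * L ^ D * q := by
          have hL0 : 0 < L := by linarith
          rw [← mul_le_mul_iff_right₀ hL0]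
          refine this.trans (le_of_eq ?_)
          push_cast; ring
        calc _ ≤ C * ((D + 1) * L ^ D * q) := mul_le_mul (hC m) h2 (abs_nonneg _) hC0
          _ = _ := by ring
      · rw [if_neg hm]
        simp only [Int.cast_zero, zero_mul, sub_zero]
        by_cases hm2 : Finsupp.degree m ≤ D
        · rw [abs_mul]
          have h1 := (mon_abs (toR x) L hx m).trans (pow_le_pow_right₀ hL hm2)
          calc _ ≤ C * L ^ D := mul_le_mul (hC m) h1 (abs_nonneg _) hC0
            _ = 1 * C * L ^ D * 1 := by ring
            _ ≤ _ := by
              gcongr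
              linarith [(Nat.cast_nonneg D : (0 : ℝ) ≤ D)]
        · have : coeff m F = 0 := by
            by_contra h0
            have := le_totalDegree (mem_support_iff.mpr h0)
            have h3 : Finsupp.degree m ≤ D + 1 := le_trans (le_of_eq rfl) (this.trans hF)
            omega
          rw [this]
          simp only [Int.cast_zero, zero_mul, abs_zero]
          positivity
    _ = _ := by simp; ring

lemma mem_boxPts {n : ℕ} {aB bB : Fin n → ℝ} {P : ℝ} {x : Fin n → ℤ} :
    x ∈ boxPts aB bB P ↔ ∀ j, P * aB j ≤ x j ∧ (x j : ℝ) ≤ P * bB j := by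
  unfold boxPts
  rw [Finset.mem_Icc, Pi.le_def, Pi.le_def]
  simp only [Int.ceil_le, Int.le_floor]
  exact forall_and.symm

/-- boundary slab -/
def slab (n : ℕ) (P q : ℝ) (j : Fin n) (e : ℝ) : Set (Fin n → ℝ) :=
  Set.univ.pi fun i => if i = j then Set.Icc (e - q) (e + q) else Set.Icc (-(2 * P)) (2 * P)

def cube {n : ℕ} (q : ℕ) (x : Fin n → ℤ) : Set (Fin n → ℝ) :=
  Set.univ.pi fun j => Set.Ico (x j : ℝ) (x j + q)

lemma slab_vol (n : ℕ) (P q : ℝ) (hP : 0 ≤ P) (hq : 0 ≤ q) (j : Fin n) (e : ℝ) :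
    volume (slab n P q j e) = ENNReal.ofReal (2 * q * (4 * P) ^ (n - 1)) := by
  unfold slab
  rw [volume_pi_pi]
  have : ∀ i : Fin n, volume (if i = j then Set.Icc (e - q) (e + q) else Set.Icc (-(2 * P)) (2 * P)) =
      if i = j then ENNReal.ofReal (2 * q) else ENNReal.ofReal (4 * P) := by
    intro i
    split_ifs
    · rw [Real.volume_Icc]; congr 1; ring
    · rw [Real.volume_Icc]; congr 1; ring
  rw [Finset.prod_congr rfl (fun i _ => this i), Finset.prod_ite]
  simp only [Finset.prod_const]
  rw [Finset.filter_eq', if_pos (Finset.mem_univ j), Finset.card_singleton, pow_one,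
    Finset.filter_ne', Finset.card_erase_of_mem (Finset.mem_univ j), Finset.card_univ, Fintype.card_fin,
    ENNReal.ofReal_mul (p := 2 * q) (by positivity), ENNReal.ofReal_pow (by positivity)]

lemma cube_vol {n : ℕ} (q : ℕ) (x : Fin n → ℤ) : volume (cube q x) = ENNReal.ofReal ((q : ℝ) ^ n) := by
  unfold cube
  rw [volume_pi_pi]
  simp [Real.volume_Ico]

lemma box_vol {n : ℕ} (A B : Fin n → ℝ) (P : ℝ) (h : ∀ j, B j - A j ≤ P) (hP : 0 ≤ P) :
    volume (boxSet A B) ≤ ENNReal.ofReal (P ^ n) := by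
  unfold boxSet
  rw [volume_pi_pi, ENNReal.ofReal_pow hP]
  calc _ ≤ ∏ _j : Fin n, ENNReal.ofReal P := by
        apply Finset.prod_le_prod'
        intro j _
        rw [Real.volume_Icc]
        exact ENNReal.ofReal_le_ofReal (h j)
    _ = _ := by simp

lemma meas_slab (n : ℕ) (P q : ℝ) (j : Fin n) (e : ℝ) : MeasurableSet (slab n P q j e) := by
  unfold slab
  apply MeasurableSet.univ_pi
  intro i
  split_ifs <;> exact measurableSet_Icc

lemma meas_cube {n : ℕ} (q : ℕ) (x : Fin n → ℤ) : MeasurableSet (cube q x) :=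
  MeasurableSet.univ_pi fun _ => measurableSet_Ico

lemma meas_box {n : ℕ} (A B : Fin n → ℝ) : MeasurableSet (boxSet A B) :=
  MeasurableSet.univ_pi fun _ => measurableSet_Icc

lemma mem_cube {n : ℕ} {q : ℕ} {x : Fin n → ℤ} {ζ : Fin n → ℝ} :
    ζ ∈ cube q x ↔ ∀ j, (x j : ℝ) ≤ ζ j ∧ ζ j < x j + q := by
  simp [cube, Set.mem_pi]

lemma mem_slab {n : ℕ} {P q : ℝ} {j : Fin n} {e : ℝ} {ζ : Fin n → ℝ} (hζ : ∀ i, |ζ i| ≤ 2 * P)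
    (h : |ζ j - e| ≤ q) : ζ ∈ slab n P q j e := by
  simp only [slab, Set.mem_pi]
  intro i _
  split_ifs with hi
  · subst hi; rw [abs_le] at h; constructor <;> linarith [h.1, h.2]
  · have := abs_le.mp (hζ i); exact ⟨this.1, this.2⟩

end MajorApprox
end


-- part C4
section


section MajorApprox2

lemma cell_pointwise {n : ℕ} (aB bB : Fin n → ℝ) (P : ℝ)
    (hB : ∀ j, -1 ≤ aB j ∧ 0 < bB j - aB j ∧ bB j - aB j < 1 ∧ bB j ≤ 1)
    (q : ℕ) (hq : 1 ≤ q) (hqP : (q : ℝ) ≤ P) (z : Fin n → ℤ) (hz : ∀ j, 0 ≤ z j ∧ z j < q)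
    (w : (Fin n → ℤ) → ℂ) (h : (Fin n → ℝ) → ℂ) (hw : ∀ x, ‖w x‖ ≤ 1) (hh : ∀ ζ, ‖h ζ‖ ≤ 1)
    (η : ℝ) (hη0 : 0 ≤ η)
    (hη : ∀ x ζ, (∀ j, |(x j : ℝ)| ≤ P) → (∀ j, |ζ j| ≤ P) → (∀ j, |(x j : ℝ) - ζ j| ≤ q) → ‖w x - h ζ‖ ≤ η)
    (ζ : Fin n → ℝ) :
    ‖∑ x ∈ (boxPts aB bB P).filter (fun x => ∀ j, x j % q = z j), (cube q x).indicator (fun _ => w x) ζ -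
      (boxSet (fun j => P * aB j) (fun j => P * bB j)).indicator h ζ‖ ≤
    (boxSet (fun j => P * aB j) (fun j => P * bB j)).indicator (fun _ => η) ζ +
      ∑ j, ((slab n P q j (P * aB j)).indicator (fun _ => (1 : ℝ)) ζ +
        (slab n P q j (P * bB j)).indicator (fun _ => (1 : ℝ)) ζ) := by
  classical
  have hq0 : (0 : ℝ) < q := by exact_mod_cast hq
  have hP0 : 0 < P := by linarith
  have hqZ : (0 : ℤ) < q := by exact_mod_cast hq
  set x0 : Fin n → ℤ := fun j => z j + q * ⌊(ζ j - z j) / q⌋ with hx0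
  have hx0c : ∀ j, (x0 j : ℝ) ≤ ζ j ∧ ζ j < x0 j + q := by
    intro j
    have h1 := Int.floor_le ((ζ j - z j) / q)
    have h2 := Int.lt_floor_add_one ((ζ j - z j) / q)
    rw [le_div_iff₀ hq0] at h1
    rw [div_lt_iff₀ hq0] at h2
    simp only [hx0]
    push_cast
    constructor <;> nlinarith
  have hx0m : ∀ j, x0 j % q = z j := by
    intro j
    simp only [hx0, Int.add_mul_emod_self_left]
    exact Int.emod_eq_of_lt (hz j).1 (hz j).2
  have huniq : ∀ x : Fin n → ℤ, (∀ j, x j % q = z j) → ζ ∈ cube q x → x = x0 := by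
    intro x hx hc
    rw [mem_cube] at hc
    funext j
    have h1 : (q : ℤ) ∣ x j - x0 j := by
      apply Int.ModEq.dvd
      show x0 j % q = x j % q
      rw [hx, hx0m]
    have h2 : |x j - x0 j| < q := by
      have : |((x j - x0 j : ℤ) : ℝ)| < q := by
        push_cast
        rw [abs_lt]
        constructor <;> linarith [(hc j).1, (hc j).2, (hx0c j).1, (hx0c j).2]
      exact_mod_cast this
    have := Int.eq_zero_of_abs_lt_dvd h1 h2
    linarith
  have hU : ∑ x ∈ (boxPts aB bB P).filter (fun x => ∀ j, x j % q = z j),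
      (cube q x).indicator (fun _ => w x) ζ = if x0 ∈ boxPts aB bB P then w x0 else 0 := by
    split_ifs with hm
    · rw [Finset.sum_eq_single_of_mem x0]
      · rw [Set.indicator_of_mem (mem_cube.mpr hx0c)]
      · rw [Finset.mem_filter]; exact ⟨hm, hx0m⟩
      · intro x hx hne
        rw [Finset.mem_filter] at hx
        apply Set.indicator_of_notMem
        intro hc
        exact hne (huniq x hx.2 hc)
    · apply Finset.sum_eq_zero
      intro x hx
      rw [Finset.mem_filter] at hx
      apply Set.indicator_of_notMem
      intro hc
      rw [huniq x hx.2 hc] at hx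
      exact hm hx.1
  rw [hU]
  have hmemB : ζ ∈ boxSet (fun j => P * aB j) (fun j => P * bB j) ↔ ∀ j, P * aB j ≤ ζ j ∧ ζ j ≤ P * bB j := by
    simp only [boxSet, Set.mem_pi, Set.mem_univ, true_imp_iff, Set.mem_Icc]
  have hnn : ∀ j e, 0 ≤ (slab n P q j e).indicator (fun _ => (1 : ℝ)) ζ := by
    intro j e; exact Set.indicator_nonneg (fun _ _ => zero_le_one) ζ
  have hsum0 : 0 ≤ ∑ j, ((slab n P q j (P * aB j)).indicator (fun _ => (1 : ℝ)) ζ +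
        (slab n P q j (P * bB j)).indicator (fun _ => (1 : ℝ)) ζ) :=
    Finset.sum_nonneg fun j _ => add_nonneg (hnn _ _) (hnn _ _)
  have hbd : ∀ t : ℝ, ∀ j, P * aB j ≤ t → t ≤ P * bB j → |t| ≤ P := by
    intro t j h1 h2
    have h3 := (hB j).1
    have h4 := (hB j).2.2.2
    rw [abs_le]; constructor <;> nlinarith
  by_cases hm : x0 ∈ boxPts aB bB P
  · rw [if_pos hm]
    rw [mem_boxPts] at hm
    by_cases hζ : ζ ∈ boxSet (fun j => P * aB j) (fun j => P * bB j)
    · rw [Set.indicator_of_mem hζ, Set.indicator_of_mem hζ]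
      rw [hmemB] at hζ
      have := hη x0 ζ (fun j => hbd _ j (hm j).1 (hm j).2) (fun j => hbd _ j (hζ j).1 (hζ j).2)
        (fun j => by rw [abs_le]; constructor <;> linarith [(hx0c j).1, (hx0c j).2])
      linarith
    · rw [Set.indicator_of_notMem hζ, Set.indicator_of_notMem hζ, sub_zero, zero_add]
      rw [hmemB] at hζ
      push Not at hζ
      obtain ⟨j, hj⟩ := hζ
      have hj1 : P * bB j < ζ j := hj ((hm j).1.trans (hx0c j).1)
      have hs : ζ ∈ slab n P q j (P * bB j) := by
        apply mem_slab
        · intro i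
          have := abs_le.mp (hbd _ i (hm i).1 (hm i).2)
          rw [abs_le]
          constructor <;> linarith [(hx0c i).1, (hx0c i).2, this.1, this.2]
        · rw [abs_le]; constructor <;> linarith [(hx0c j).2, (hm j).2]
      calc _ ≤ (1 : ℝ) := hw _
        _ ≤ (slab n P q j (P * aB j)).indicator (fun _ => (1 : ℝ)) ζ +
            (slab n P q j (P * bB j)).indicator (fun _ => (1 : ℝ)) ζ := by
            rw [Set.indicator_of_mem hs]; linarith [hnn j (P * aB j)]
        _ ≤ _ := Finset.single_le_sum (f := fun j => (slab n P q j (P * aB j)).indicator (fun _ => (1 : ℝ)) ζ +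
            (slab n P q j (P * bB j)).indicator (fun _ => (1 : ℝ)) ζ)
            (fun j _ => add_nonneg (hnn _ _) (hnn _ _)) (Finset.mem_univ j)
  · rw [if_neg hm]
    by_cases hζ : ζ ∈ boxSet (fun j => P * aB j) (fun j => P * bB j)
    · rw [Set.indicator_of_mem hζ, Set.indicator_of_mem hζ]
      rw [hmemB] at hζ
      rw [mem_boxPts] at hm
      push Not at hm
      obtain ⟨j, hj⟩ := hm
      have hj1 : (x0 j : ℝ) < P * aB j := by
        by_contra hc
        push Not at hc
        have := hj hc
        linarith [(hx0c j).1, (hζ j).2]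
      have hs : ζ ∈ slab n P q j (P * aB j) := by
        apply mem_slab
        · intro i
          have := hbd _ i (hζ i).1 (hζ i).2
          linarith
        · rw [abs_le]; constructor <;> linarith [(hx0c j).2, (hζ j).1]
      have h1 : (1 : ℝ) ≤ ∑ j, ((slab n P q j (P * aB j)).indicator (fun _ => (1 : ℝ)) ζ +
          (slab n P q j (P * bB j)).indicator (fun _ => (1 : ℝ)) ζ) := by
        calc (1 : ℝ) ≤ (slab n P q j (P * aB j)).indicator (fun _ => (1 : ℝ)) ζ +
            (slab n P q j (P * bB j)).indicator (fun _ => (1 : ℝ)) ζ := by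
              rw [Set.indicator_of_mem hs]; linarith [hnn j (P * bB j)]
          _ ≤ _ := Finset.single_le_sum (f := fun j => (slab n P q j (P * aB j)).indicator (fun _ => (1 : ℝ)) ζ +
              (slab n P q j (P * bB j)).indicator (fun _ => (1 : ℝ)) ζ)
              (fun j _ => add_nonneg (hnn _ _) (hnn _ _)) (Finset.mem_univ j)
      have h2 := hh ζ
      rw [zero_sub, norm_neg]
      linarith
    · rw [Set.indicator_of_notMem hζ, Set.indicator_of_notMem hζ, sub_zero, norm_zero, zero_add]
      exact hsum0

lemma cell_int {n : ℕ} (aB bB : Fin n → ℝ) (P : ℝ)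
    (hB : ∀ j, -1 ≤ aB j ∧ 0 < bB j - aB j ∧ bB j - aB j < 1 ∧ bB j ≤ 1)
    (q : ℕ) (hq : 1 ≤ q) (hqP : (q : ℝ) ≤ P) (z : Fin n → ℤ) (hz : ∀ j, 0 ≤ z j ∧ z j < q)
    (w : (Fin n → ℤ) → ℂ) (h : (Fin n → ℝ) → ℂ) (hw : ∀ x, ‖w x‖ ≤ 1) (hh : ∀ ζ, ‖h ζ‖ ≤ 1)
    (hcont : Continuous h)
    (η : ℝ) (hη0 : 0 ≤ η)
    (hη : ∀ x ζ, (∀ j, |(x j : ℝ)| ≤ P) → (∀ j, |ζ j| ≤ P) → (∀ j, |(x j : ℝ) - ζ j| ≤ q) → ‖w x - h ζ‖ ≤ η) :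
    ‖((q : ℂ) ^ n) * ∑ x ∈ (boxPts aB bB P).filter (fun x => ∀ j, x j % q = z j), w x -
      ∫ ζ in boxSet (fun j => P * aB j) (fun j => P * bB j), h ζ‖ ≤
    η * P ^ n + 4 * n * q * (4 * P) ^ (n - 1) := by
  classical
  have hq0 : (0 : ℝ) < q := by exact_mod_cast hq
  have hP0 : 0 < P := by linarith
  have hpt := cell_pointwise aB bB P hB q hq hqP z hz w h hw hh η hη0 hη
  set F := (boxPts aB bB P).filter (fun x => ∀ j, x j % q = z j) with hF
  set D := boxSet (fun j => P * aB j) (fun j => P * bB j) with hD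
  have hDm : MeasurableSet D := meas_box _ _
  have hDv : volume D ≤ ENNReal.ofReal (P ^ n) := box_vol _ _ P
    (fun j => by have := (hB j).2.2.1; nlinarith) hP0.le
  have hDfin : volume D < ⊤ := hDv.trans_lt ENNReal.ofReal_lt_top
  have hint1 : ∀ x ∈ F, Integrable ((cube q x).indicator (fun _ => w x)) volume := by
    intro x _
    rw [integrable_indicator_iff (meas_cube q x)]
    apply integrableOn_const
    · rw [cube_vol]; exact ENNReal.ofReal_ne_top
    · simp
  have hint2 : Integrable (D.indicator h) volume := by
    rw [integrable_indicator_iff hDm]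
    apply Measure.integrableOn_of_bounded (M := 1) hDfin.ne hcont.aestronglyMeasurable
    exact Eventually.of_forall hh
  have hint3 : Integrable (D.indicator (fun _ => η)) volume := by
    rw [integrable_indicator_iff hDm]
    exact integrableOn_const hDfin.ne
  have hslabi : ∀ j e, Integrable ((slab n P q j e).indicator (fun _ => (1 : ℝ))) volume := by
    intro j e
    rw [integrable_indicator_iff (meas_slab _ _ _ _ _)]
    apply integrableOn_const
    · rw [slab_vol n P q hP0.le hq0.le]; exact ENNReal.ofReal_ne_top
    · simp
  have hslabv : ∀ j e, ∫ ζ, (slab n P q j e).indicator (fun _ => (1 : ℝ)) ζ = 2 * q * (4 * P) ^ (n - 1) := by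
    intro j e
    rw [integral_indicator (meas_slab _ _ _ _ _), setIntegral_const, measureReal_def,
      slab_vol n P q hP0.le hq0.le, ENNReal.toReal_ofReal (by positivity)]
    simp
  have hadd : ∀ j ∈ (Finset.univ : Finset (Fin n)),
      Integrable (fun ζ => (slab n P q j (P * aB j)).indicator (fun _ => (1 : ℝ)) ζ +
        (slab n P q j (P * bB j)).indicator (fun _ => (1 : ℝ)) ζ) volume :=
    fun j _ => (hslabi j _).add (hslabi j _)
  have e1 : ((q : ℂ) ^ n) * ∑ x ∈ F, w x - ∫ ζ in D, h ζ =
      ∫ ζ, (∑ x ∈ F, (cube q x).indicator (fun _ => w x) ζ - D.indicator h ζ) := by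
    rw [integral_sub (integrable_finsetSum _ hint1) hint2, integral_finsetSum _ hint1,
      integral_indicator hDm, Finset.mul_sum]
    congr 1
    apply Finset.sum_congr rfl
    intro x _
    rw [integral_indicator (meas_cube _ _), setIntegral_const, measureReal_def, cube_vol,
      ENNReal.toReal_ofReal (by positivity)]
    simp
  rw [e1]
  refine (norm_integral_le_integral_norm _).trans ?_
  calc _ ≤ ∫ ζ, (D.indicator (fun _ => η) ζ + ∑ j, ((slab n P q j (P * aB j)).indicator (fun _ => (1 : ℝ)) ζ +
        (slab n P q j (P * bB j)).indicator (fun _ => (1 : ℝ)) ζ)) := by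
        apply integral_mono_of_nonneg
        · exact Eventually.of_forall fun _ => norm_nonneg _
        · exact hint3.add (integrable_finsetSum _ hadd)
        · exact Eventually.of_forall hpt
    _ = η * volume.real D + 4 * n * q * (4 * P) ^ (n - 1) := by
        rw [integral_add hint3 (integrable_finsetSum _ hadd),
          integral_finsetSum _ hadd, integral_indicator hDm,
          setIntegral_const]
        simp_rw [integral_add (hslabi _ _) (hslabi _ _), hslabv]
        simp
        ring
    _ ≤ _ := by
        gcongr
        rw [measureReal_def]
        exact ENNReal.toReal_le_of_le_ofReal (by positivity) hDv

end MajorApprox2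
end


-- part C5
section


section MajorApprox3

lemma aeval_hom_smul {n D : ℕ} (g : MvPolynomial (Fin n) ℤ) (hg : g.IsHomogeneous D) (P : ℝ)
    (ζ : Fin n → ℝ) : aeval (P • ζ) g = P ^ D * aeval ζ g := by
  rw [aeval_def, aeval_def, eval₂_eq', eval₂_eq', Finset.mul_sum]
  apply Finset.sum_congr rfl
  intro m hm
  have h1 : Finsupp.degree m = D := by
    have := hg (mem_support_iff.mp hm)
    rw [← this, Finsupp.degree_eq_weight_one]
    rfl
  have h2 : ∏ i, (P • ζ) i ^ m i = P ^ D * ∏ i, ζ i ^ m i := by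
    simp only [Pi.smul_apply, smul_eq_mul, mul_pow]
    rw [Finset.prod_mul_distrib, Finset.prod_pow_eq_pow_sum, ← h1, Finsupp.degree_eq_sum]
  rw [h2]; ring

open scoped Pointwise in
lemma Iosc_scale {n R D : ℕ} (g : Fin R → MvPolynomial (Fin n) ℤ) (hg : ∀ i, (g i).IsHomogeneous D)
    (aB bB : Fin n → ℝ) (P : ℝ) (hP : 0 < P) (β : Fin R → ℝ) :
    ∫ ζ in boxSet (fun j => P * aB j) (fun j => P * bB j), eC (∑ i, β i * aeval ζ (g i)) =
      (P : ℂ) ^ n * Iosc g (boxSet aB bB) (fun i => P ^ D * β i) := by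
  have h1 := Measure.setIntegral_comp_smul_of_pos (volume : Measure (Fin n → ℝ))
    (fun ζ => eC (∑ i, β i * aeval ζ (g i))) (boxSet aB bB) hP
  have h2 : P • boxSet aB bB = boxSet (fun j => P * aB j) (fun j => P * bB j) := by
    ext ζ
    rw [Set.mem_smul_set_iff_inv_smul_mem₀ hP.ne']
    simp only [boxSet, Set.mem_pi, Set.mem_univ, true_imp_iff, Set.mem_Icc, Pi.smul_apply, smul_eq_mul]
    apply forall_congr'
    intro j
    rw [← div_eq_inv_mul, le_div_iff₀ hP, div_le_iff₀ hP, mul_comm (aB j), mul_comm (bB j)]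
  rw [h2] at h1
  have h3 : Iosc g (boxSet aB bB) (fun i => P ^ D * β i) =
      ∫ ζ in boxSet aB bB, eC (∑ i, β i * aeval (P • ζ) (g i)) := by
    unfold Iosc
    congr 1
    funext ζ
    congr 1
    apply Finset.sum_congr rfl
    intro i _
    rw [aeval_hom_smul (g i) (hg i)]; ring
  rw [h3, h1]
  rw [Module.finrank_fin_fun]
  rw [Complex.real_smul]
  push_cast
  rw [← mul_assoc, mul_inv_cancel₀, one_mul]
  exact pow_ne_zero _ (by exact_mod_cast hP.ne')

lemma continuous_phase {n R : ℕ} (g : Fin R → MvPolynomial (Fin n) ℤ) :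
    Continuous (fun p : (Fin R → ℝ) × (Fin n → ℝ) => eC (∑ i, p.1 i * aeval p.2 (g i))) := by
  apply continuous_eC.comp
  apply continuous_finsetSum
  intro i _
  apply Continuous.mul (by fun_prop)
  have : Continuous (fun ζ : Fin n → ℝ => aeval ζ (g i)) := by
    simp only [aeval_def, eval₂_eq']
    fun_prop
  exact this.comp continuous_snd

lemma norm_Iosc_le_one {n R : ℕ} (g : Fin R → MvPolynomial (Fin n) ℤ) (aB bB : Fin n → ℝ)
    (hB : ∀ j, -1 ≤ aB j ∧ 0 < bB j - aB j ∧ bB j - aB j < 1 ∧ bB j ≤ 1) (γ : Fin R → ℝ) :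
    ‖Iosc g (boxSet aB bB) γ‖ ≤ 1 := by
  unfold Iosc
  have hv : volume (boxSet aB bB) ≤ ENNReal.ofReal (1 ^ n) :=
    box_vol _ _ 1 (fun j => (hB j).2.2.1.le) zero_le_one
  have := norm_setIntegral_le_of_norm_le_const (μ := volume) (s := boxSet aB bB) (C := 1)
    (f := fun ζ => eC (∑ i, γ i * aeval ζ (g i))) (hv.trans_lt ENNReal.ofReal_lt_top)
    (fun ζ _ => (norm_eC _).le)
  refine this.trans ?_
  rw [one_mul, measureReal_def]
  exact ENNReal.toReal_le_of_le_ofReal zero_le_one (by simpa using hv)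

lemma boxPts_len {aB bB P : ℝ} (h : bB - aB < 1) (hP : 1 ≤ P) :
    ((⌊P * bB⌋ : ℝ) - (⌈P * aB⌉ : ℝ) + 1) ≤ 2 * P := by
  have h1 := Int.floor_le (P * bB)
  have h2 := Int.le_ceil (P * aB)
  nlinarith

lemma card_boxPts_le {n : ℕ} (aB bB : Fin n → ℝ) (P : ℝ) (hP : 1 ≤ P)
    (hB : ∀ j, -1 ≤ aB j ∧ 0 < bB j - aB j ∧ bB j - aB j < 1 ∧ bB j ≤ 1) :
    ((boxPts aB bB P).card : ℝ) ≤ (2 * P) ^ n := by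
  unfold boxPts
  rw [Pi.card_Icc]
  push_cast
  calc _ ≤ ∏ _j : Fin n, (2 * P) := by
        apply Finset.prod_le_prod
        · intro j _; positivity
        · intro j _
          rw [Int.card_Icc]
          have h1 := boxPts_len (hB j).2.2.1 hP
          rcases le_total 0 (⌊P * bB j⌋ + 1 - ⌈P * aB j⌉) with h | h
          · have : (((⌊P * bB j⌋ + 1 - ⌈P * aB j⌉).toNat : ℕ) : ℝ) =
                ((⌊P * bB j⌋ + 1 - ⌈P * aB j⌉ : ℤ) : ℝ) := by
              exact_mod_cast congrArg (Int.cast : ℤ → ℝ) (Int.toNat_of_nonneg h)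
            rw [this]; push_cast; linarith
          · rw [Int.toNat_of_nonpos h]; simp; linarith
    _ = _ := by simp

theorem major_approx (n R k : ℕ) (hn : 0 < n) : ∃ c : ℝ, 1 ≤ c ∧
    ∀ (f : Fin R → MvPolynomial (Fin n) ℤ) (C : ℝ), (∀ i, (f i).totalDegree ≤ k + 2) →
    0 ≤ C → (∀ i m, |((coeff m (f i) : ℤ) : ℝ)| ≤ C) →
    ∀ aB bB : Fin n → ℝ, (∀ j, -1 ≤ aB j ∧ 0 < bB j - aB j ∧ bB j - aB j < 1 ∧ bB j ≤ 1) →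
    ∀ P : ℝ, 1 ≤ P → ∀ (q : ℕ) (a : Fin R → ℤ) (β : Fin R → ℝ), 1 ≤ q →
    ‖Sexp f aB bB P (fun i => (a i : ℝ) / q + β i) -
      ((q : ℂ) ^ n)⁻¹ * Sgauss f q a * ((P : ℂ) ^ n *
        Iosc (fun i => homogeneousComponent (k + 2) (f i)) (boxSet aB bB) (fun i => P ^ (k + 2) * β i))‖ ≤
    c * (P ^ n / P) * q * (1 + C * (∑ i, |β i|) * P ^ (k + 2)) := by
  classical
  set Mc : ℝ := (Mon n (k + 2)).card * (k + 2) with hMc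
  have hMc0 : 0 ≤ Mc := by positivity
  set c : ℝ := 2 ^ n + 1 + 2 * Real.pi * Mc + 4 * n * 4 ^ n with hc
  have hpi := Real.pi_pos
  have hc1 : 1 ≤ c := by
    have : (0 : ℝ) ≤ 2 ^ n := by positivity
    have : (0 : ℝ) ≤ 4 * n * 4 ^ n := by positivity
    have : 0 ≤ 2 * Real.pi * Mc := by positivity
    linarith
  refine ⟨c, hc1, fun f C hdeg hC0 hC aB bB hB P hP q a β hq => ?_⟩
  have hq0 : (0 : ℝ) < q := by exact_mod_cast hq
  have hq1 : (1 : ℝ) ≤ q := by exact_mod_cast hq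
  have hP0 : 0 < P := by linarith
  set g : Fin R → MvPolynomial (Fin n) ℤ := fun i => homogeneousComponent (k + 2) (f i) with hg
  set sb : ℝ := ∑ i, |β i| with hsb
  have hsb0 : 0 ≤ sb := Finset.sum_nonneg fun i _ => abs_nonneg _
  have hqn : ‖(q : ℂ) ^ n‖ = (q : ℝ) ^ n := by simp
  have hqne : (q : ℂ) ^ n ≠ 0 := pow_ne_zero _ (by exact_mod_cast hq0.ne')
  rcases lt_or_ge P q with hPq | hqP
  · -- trivial
    have h1 : ‖Sexp f aB bB P (fun i => (a i : ℝ) / q + β i)‖ ≤ (2 * P) ^ n :=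
      (norm_sum_eC_le _ _).trans (card_boxPts_le aB bB P hP hB)
    have h2 : ‖((q : ℂ) ^ n)⁻¹ * Sgauss f q a * ((P : ℂ) ^ n *
        Iosc g (boxSet aB bB) (fun i => P ^ (k + 2) * β i))‖ ≤ P ^ n := by
      rw [norm_mul, norm_mul, norm_mul, norm_inv, hqn, norm_pow, Complex.norm_real, Real.norm_of_nonneg hP0.le]
      have h3 := norm_Sgauss_le f q a
      have h4 := norm_Iosc_le_one g aB bB hB (fun i => P ^ (k + 2) * β i)
      calc _ ≤ ((q : ℝ) ^ n)⁻¹ * (q : ℝ) ^ n * (P ^ n * 1) := by gcongr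
        _ = _ := by rw [inv_mul_cancel₀ (by positivity)]; ring
    have h5 : P ^ n ≤ P ^ n / P * q := by
      rw [div_mul_eq_mul_div, le_div_iff₀ hP0]
      gcongr
    calc _ ≤ (2 * P) ^ n + P ^ n := (norm_sub_le _ _).trans (add_le_add h1 h2)
      _ = (2 ^ n + 1) * P ^ n := by rw [mul_pow]; ring
      _ ≤ c * (P ^ n / P * q) := by
          apply mul_le_mul _ h5 (by positivity) (by linarith)
          have : (0 : ℝ) ≤ 4 * n * 4 ^ n := by positivity
          have : 0 ≤ 2 * Real.pi * Mc := by positivity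
          linarith
      _ = c * (P ^ n / P) * q * 1 := by ring
      _ ≤ _ := by
          gcongr
          have : 0 ≤ C * sb * P ^ (k + 2) := by positivity
          linarith
  · -- main case
    set w : (Fin n → ℤ) → ℂ := fun x => eC (∑ i, β i * ((eval x (f i) : ℤ) : ℝ)) with hw
    set h : (Fin n → ℝ) → ℂ := fun ζ => eC (∑ i, β i * aeval ζ (g i)) with hh
    set η : ℝ := 2 * Real.pi * (sb * (Mc * C * P ^ (k + 1) * q)) with hη
    have hη0 : 0 ≤ η := by positivity
    have hηb : ∀ x ζ, (∀ j, |(x j : ℝ)| ≤ P) → (∀ j, |ζ j| ≤ P) → (∀ j, |(x j : ℝ) - ζ j| ≤ q) →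
        ‖w x - h ζ‖ ≤ η := by
      intro x ζ hx hζ hxζ
      refine (norm_eC_sub_le _ _).trans ?_
      rw [hη]
      gcongr
      rw [← Finset.sum_sub_distrib, hsb, Finset.sum_mul]
      refine (Finset.abs_sum_le_sum_abs _ _).trans ?_
      apply Finset.sum_le_sum
      intro i _
      rw [← mul_sub, abs_mul]
      gcongr
      have := f_diff (D := k + 1) (f i) (hdeg i) C (hC i) x ζ P q hP hq1 hx hζ hxζ
      refine this.trans (le_of_eq ?_)
      rw [hMc]; push_cast; ring
    have hcont : Continuous h := (continuous_phase g).comp (Continuous.prodMk_right β)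
    set zz : (Fin n → Fin q) → (Fin n → ℤ) := fun z j => ((z j : ℕ) : ℤ) with hzz
    have hcell : ∀ z : Fin n → Fin q, ‖((q : ℂ) ^ n) * ∑ x ∈ (boxPts aB bB P).filter
        (fun x => ∀ j, x j % q = zz z j), w x - ∫ ζ in boxSet (fun j => P * aB j) (fun j => P * bB j), h ζ‖ ≤
        η * P ^ n + 4 * n * q * (4 * P) ^ (n - 1) := by
      intro z
      apply cell_int aB bB P hB q hq hqP (zz z) _ w h (fun x => (norm_eC _).le) (fun ζ => (norm_eC _).le)
        hcont η hη0 hηb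
      intro j
      have := (z j).2
      simp only [hzz]
      omega
    rw [← Iosc_scale g (fun i => homogeneousComponent_isHomogeneous _ _) aB bB P hP0 β]
    change ‖_ - _ * ∫ ζ in boxSet (fun j => P * aB j) (fun j => P * bB j), h ζ‖ ≤ _
    set J := ∫ ζ in boxSet (fun j => P * aB j) (fun j => P * bB j), h ζ with hJ
    set A : (Fin n → ℤ) → ℂ := fun x => eC ((∑ i, (a i : ℝ) * ((eval x (f i) : ℤ) : ℝ)) / q) with hA
    have hAmod : ∀ x y : Fin n → ℤ, (∀ j, x j ≡ y j [ZMOD q]) → A x = A y := by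
      intro x y hxy
      have h1 : (∑ i, a i * eval x (f i)) ≡ (∑ i, a i * eval y (f i)) [ZMOD q] := by
        apply Int.ModEq.sum
        intro i _
        exact (eval_modEq q (f i) x y hxy).mul_left _
      obtain ⟨t, ht⟩ := h1.dvd
      have h2 : (∑ i, (a i : ℝ) * ((eval y (f i) : ℤ) : ℝ)) / q =
          (∑ i, (a i : ℝ) * ((eval x (f i) : ℤ) : ℝ)) / q + (t : ℤ) := by
        have h3 : (((∑ i, a i * eval y (f i)) - (∑ i, a i * eval x (f i)) : ℤ) : ℝ) = ((q * t : ℤ) : ℝ) := by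
          rw [ht]
        push_cast at h3
        field_simp
        linarith
      simp only [hA]
      rw [h2, eC_add_int]
    have hS : Sexp f aB bB P (fun i => (a i : ℝ) / q + β i) =
        ∑ z : Fin n → Fin q, A (zz z) * ∑ x ∈ (boxPts aB bB P).filter (fun x => ∀ j, x j % q = zz z j), w x := by
      unfold Sexp
      have hqZ : (0 : ℤ) < q := by exact_mod_cast hq
      set φ : (Fin n → ℤ) → (Fin n → Fin q) := fun x j => ⟨(x j % q).toNat, by
        have h1 := Int.emod_lt_of_pos (x j) hqZ
        have h2 := Int.emod_nonneg (x j) hqZ.ne'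
        omega⟩ with hφ
      have hφz : ∀ x z, φ x = z ↔ ∀ j, x j % q = zz z j := by
        intro x z
        rw [funext_iff]
        apply forall_congr'
        intro j
        rw [Fin.ext_iff]
        simp only [hφ, hzz]
        have h2 := Int.emod_nonneg (x j) hqZ.ne'
        omega
      rw [← Finset.sum_fiberwise (s := boxPts aB bB P) (g := φ)]
      apply Finset.sum_congr rfl
      intro z _
      rw [Finset.mul_sum]
      have : (boxPts aB bB P).filter (fun x => φ x = z) =
          (boxPts aB bB P).filter (fun x => ∀ j, x j % q = zz z j) := by
        apply Finset.filter_congr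
        intro x _
        exact hφz x z
      rw [this]
      apply Finset.sum_congr rfl
      intro x hx
      rw [Finset.mem_filter] at hx
      have hAx : A (zz z) = A x := by
        apply hAmod
        intro j
        rw [← hx.2 j]
        exact Int.mod_modEq _ _
      rw [hAx]
      simp only [hA, hw]
      rw [← eC_add]
      congr 1
      rw [Finset.sum_div, ← Finset.sum_add_distrib]
      apply Finset.sum_congr rfl
      intro i _
      ring
    have hG : Sgauss f q a = ∑ z : Fin n → Fin q, A (zz z) := rfl
    have hdiff : Sexp f aB bB P (fun i => (a i : ℝ) / q + β i) - ((q : ℂ) ^ n)⁻¹ * Sgauss f q a * J =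
        ((q : ℂ) ^ n)⁻¹ * ∑ z : Fin n → Fin q, A (zz z) * (((q : ℂ) ^ n) * ∑ x ∈ (boxPts aB bB P).filter
        (fun x => ∀ j, x j % q = zz z j), w x - J) := by
      simp_rw [mul_sub]
      rw [Finset.sum_sub_distrib, mul_sub, ← Finset.sum_mul, ← hG]
      congr 1
      · rw [hS, Finset.mul_sum]
        apply Finset.sum_congr rfl
        intro z _
        field_simp
      · ring
    rw [hdiff, norm_mul, norm_inv, hqn]
    have hsumle : ‖∑ z : Fin n → Fin q, A (zz z) * (((q : ℂ) ^ n) * ∑ x ∈ (boxPts aB bB P).filter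
        (fun x => ∀ j, x j % q = zz z j), w x - J)‖ ≤
        (q : ℝ) ^ n * (η * P ^ n + 4 * n * q * (4 * P) ^ (n - 1)) := by
      calc _ ≤ ∑ z : Fin n → Fin q, (η * P ^ n + 4 * n * q * (4 * P) ^ (n - 1)) := by
            refine (norm_sum_le _ _).trans (Finset.sum_le_sum fun z _ => ?_)
            rw [norm_mul, norm_eC, one_mul]
            exact hcell z
        _ = _ := by simp; ring
    calc _ ≤ ((q : ℝ) ^ n)⁻¹ * ((q : ℝ) ^ n * (η * P ^ n + 4 * n * q * (4 * P) ^ (n - 1))) := by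
          gcongr
      _ = η * P ^ n + 4 * n * q * (4 * P) ^ (n - 1) := by
          rw [← mul_assoc, inv_mul_cancel₀ (by positivity), one_mul]
      _ ≤ 2 * Real.pi * Mc * ((P ^ n / P) * q * (C * sb * P ^ (k + 2))) +
          4 * n * 4 ^ n * ((P ^ n / P) * q) := by
          apply add_le_add
          · rw [hη]
            apply le_of_eq
            field_simp
            ring
          · have : (4 * P) ^ (n - 1) ≤ 4 ^ n * (P ^ n / P) := by
              obtain ⟨m, rfl⟩ : ∃ m, n = m + 1 := ⟨n - 1, by omega⟩
              have e : P ^ (m + 1) / P = P ^ m := by field_simp; ring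
              rw [Nat.add_sub_cancel, mul_pow, e]
              exact mul_le_mul_of_nonneg_right (pow_le_pow_right₀ (by norm_num) (by omega))
                (by positivity)
            calc _ ≤ 4 * n * q * (4 ^ n * (P ^ n / P)) := by gcongr
              _ = _ := by ring
      _ ≤ c * (P ^ n / P * q * (C * sb * P ^ (k + 2))) + c * (P ^ n / P * q) := by
          have h1 : (0 : ℝ) ≤ 4 * n * 4 ^ n := by positivity
          have h2 : 0 ≤ 2 * Real.pi * Mc := by positivity
          have h3 : (0 : ℝ) ≤ 2 ^ n := by positivity
          gcongr <;> linarith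
      _ = _ := by ring

end MajorApprox3
end


-- part C6
section


section OscBound

/-- top degree parts -/
def topp {n r : ℕ} (k : ℕ) (f : Fin r → MvPolynomial (Fin n) ℤ) : Fin r → MvPolynomial (Fin n) ℤ :=
  fun i => homogeneousComponent (k + 2) (f i)

lemma topp_coeff {n r k Δ : ℕ} {f : Fin r → MvPolynomial (Fin n) ℤ} {Ct : ℝ} (h : Sys n r k Δ f Ct)
    (i : Fin r) (m : Fin n →₀ ℕ) : |((coeff m (topp k f i) : ℤ) : ℝ)| ≤ Ct := by
  unfold topp
  rw [coeff_homogeneousComponent]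
  split_ifs with hm
  · exact h.coe i m hm
  · simp; linarith [h.one]

lemma topp_topp {n r k : ℕ} (f : Fin r → MvPolynomial (Fin n) ℤ) (i : Fin r) :
    homogeneousComponent (k + 2) (topp k f i) = topp k f i := by
  unfold topp
  rw [homogeneousComponent_of_mem (homogeneousComponent_mem (k + 2) (f i))]
  simp

lemma sys_topp {n r k Δ : ℕ} {f : Fin r → MvPolynomial (Fin n) ℤ} {Ct : ℝ} (h : Sys n r k Δ f Ct) :
    Sys n r k Δ (topp k f) Ct where
  deg := fun i => (homogeneousComponent_isHomogeneous (k + 2) (f i)).totalDegree_le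
  one := h.one
  coe := fun i m _ => topp_coeff h i m
  dim := fun b hb => by
    simp only [topp_topp]
    exact h.dim b hb

theorem weyl_P (n R k Δ : ℕ) (hΔ : Δ ≤ n) (ε : ℝ) (hε : 0 < ε) : ∃ c : ℝ, 1 ≤ c ∧
    ∀ (f : Fin (R + 1) → MvPolynomial (Fin n) ℤ) (Ct : ℝ), Sys n (R + 1) k Δ f Ct →
    ∀ aB bB : Fin n → ℝ, (∀ j, -1 ≤ aB j ∧ 0 < bB j - aB j ∧ bB j - aB j < 1 ∧ bB j ≤ 1) →
    ∀ P X : ℝ, 1 ≤ P → 1 ≤ X → X ≤ P ^ ((R + 1) * (k + 1)) →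
    ∀ α : Fin (R + 1) → ℝ,
    ‖Sexp f aB bB P α‖ ≤ c * P ^ ((n : ℝ) + ε) * X ^ (- kap n R k Δ) ∨
    ∃ (q : ℕ) (a : Fin (R + 1) → ℤ), 1 ≤ q ∧ (q : ℝ) ≤ c * Ct ^ (R + 1) * X ∧
      ∀ i, |(q : ℝ) * α i - a i| ≤ c * Ct ^ R * X / P ^ (k + 2) := by
  obtain ⟨c, hc, h⟩ := weyl_X n R k Δ hΔ ε hε
  have h2 : (1 : ℝ) ≤ 2 ^ ((n : ℝ) + ε) := Real.one_le_rpow (by norm_num) (by positivity)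
  refine ⟨c * 2 ^ ((n : ℝ) + ε), by nlinarith, fun f Ct hf aB bB hB P X hP hX hXP α => ?_⟩
  have hP0 : 0 ≤ P := by linarith
  have hX0 : 0 ≤ X := by linarith
  have hCt := hf.one
  have hCt0 : 0 ≤ Ct := by linarith
  have hPP : P ≤ 2 * P := by linarith
  rcases h f Ct hf (2 * P) X (by linarith) hX (hXP.trans (pow_le_pow_left₀ hP0 hPP _))
    (fun j => ⌈P * aB j⌉) (fun j => ⌊P * bB j⌋) (fun j => boxPts_len (hB j).2.2.1 hP) α with h1 | h1
  · left
    refine h1.trans (le_of_eq ?_)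
    rw [Real.mul_rpow (by norm_num) hP0]; ring
  · right
    obtain ⟨q, a, hq, hqc, ha⟩ := h1
    have hcc : c ≤ c * 2 ^ ((n : ℝ) + ε) := by nlinarith
    refine ⟨q, a, hq, hqc.trans (by gcongr), fun i => (ha i).trans ?_⟩
    gcongr

lemma kap_nonneg (n R k Δ : ℕ) (hΔ : Δ ≤ n) : 0 ≤ kap n R k Δ := by
  unfold kap KK
  have : (Δ : ℝ) ≤ n := by exact_mod_cast hΔ
  have : (0 : ℝ) ≤ n - Δ := by linarith
  positivity

lemma Sgauss_one {n r : ℕ} (f : Fin r → MvPolynomial (Fin n) ℤ) : Sgauss f 1 0 = 1 := by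
  simp [Sgauss, eC_zero]

set_option maxHeartbeats 2000000 in
theorem osc_bound (n R k Δ : ℕ) (hn : 0 < n) (hΔ : Δ ≤ n) (ε : ℝ) (hε : 0 < ε) (hε1 : ε ≤ 1) :
    ∃ c : ℝ, 1 ≤ c ∧
    ∀ (f : Fin (R + 1) → MvPolynomial (Fin n) ℤ) (Ct : ℝ), Sys n (R + 1) k Δ f Ct →
    ∀ aB bB : Fin n → ℝ, (∀ j, -1 ≤ aB j ∧ 0 < bB j - aB j ∧ bB j - aB j < 1 ∧ bB j ≤ 1) →
    ∀ γ : Fin (R + 1) → ℝ,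
    ‖Iosc (topp k f) (boxSet aB bB) γ‖ ≤
      c * Ct ^ ε * (1 + ‖γ‖ / Ct ^ R) ^ (-(kap n R k Δ - ε)) := by
  have hκ := kap_nonneg n R k Δ hΔ
  generalize hκe : kap n R k Δ = κ at hκ
  obtain ⟨A, hA⟩ : ∃ A : ℕ, A = ⌈κ⌉₊ + 2 := ⟨_, rfl⟩
  have hAκ : κ + 2 ≤ A := by rw [hA]; push_cast; linarith [Nat.le_ceil κ]
  have hε' : 0 < ε / ((2 * R + 1 : ℕ) + A) := by positivity
  obtain ⟨c1, hc1, hw⟩ := weyl_P n R k Δ hΔ _ hε'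
  obtain ⟨c2, hc2, hm⟩ := major_approx n (R + 1) k hn
  rw [hκe] at hw
  generalize hepsE : ε / ((2 * R + 1 : ℕ) + A) = ε1 at *
  have hε1' : ε1 * (2 * R + 1 : ℕ) + ε1 * A = ε := by
    rw [← hepsE]; field_simp
  have hepsLe : ε1 ≤ 1 := by
    have h1 : (0:ℝ) ≤ ε1 * A := by positivity
    have h2 : (1:ℝ) ≤ (2 * R + 1 : ℕ) := by exact_mod_cast (by omega)
    nlinarith
  have hc10 : 0 < c1 := by linarith
  have h4c : (1 : ℝ) ≤ (4 * c1) ^ κ := Real.one_le_rpow (by linarith) hκ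
  refine ⟨4 * c1 * (4 * c1) ^ κ + c2 * (R + 2), by nlinarith, fun f Ct hf aB bB hB γ => ?_⟩
  have hCt := hf.one
  have hCt0 : 0 < Ct := by linarith
  obtain ⟨E, hE⟩ : ∃ E, E = Ct ^ R := ⟨_, rfl⟩
  have hE1 : 1 ≤ E := hE ▸ one_le_pow₀ hCt
  rw [← hE]
  have hE0 : 0 < E := by linarith
  obtain ⟨G, hG⟩ : ∃ G, G = ‖γ‖ := ⟨_, rfl⟩
  have hG0 : 0 ≤ G := hG ▸ norm_nonneg γ
  rw [← hG]
  obtain ⟨y, hy⟩ : ∃ y, y = 1 + G / E := ⟨_, rfl⟩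
  have hGE0 : 0 ≤ G / E := by positivity
  have hy1 : 1 ≤ y := by linarith
  have hy0 : 0 < y := by linarith
  rw [← hy]
  have hCε : 1 ≤ Ct ^ ε := Real.one_le_rpow hCt hε.le
  have hI1 := norm_Iosc_le_one (topp k f) aB bB hB γ
  have hyκ : y ^ (-κ) ≤ y ^ (-(κ - ε)) := Real.rpow_le_rpow_of_exponent_le hy1 (by linarith)
  rcases lt_or_ge (G / E) (2 * c1) with hX | hX
  · -- trivial range
    have h1 : 1 ≤ (4 * c1) ^ κ * y ^ (-κ) := by
      rw [Real.rpow_neg hy0.le, ← div_eq_mul_inv, one_le_div (by positivity)]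
      exact Real.rpow_le_rpow hy0.le (by linarith) hκ
    calc _ ≤ 1 * 1 * ((4 * c1) ^ κ * y ^ (-κ)) := by linarith
      _ ≤ (4 * c1) * Ct ^ ε * ((4 * c1) ^ κ * y ^ (-(κ - ε))) := by gcongr; linarith
      _ = (4 * c1 * (4 * c1) ^ κ) * Ct ^ ε * y ^ (-(κ - ε)) := by ring
      _ ≤ _ := by gcongr; linarith [show (0:ℝ) ≤ c2 * (R + 2) by positivity]
  · obtain ⟨X, hXe⟩ : ∃ X, X = G / E / (2 * c1) := ⟨_, rfl⟩
    have hX1 : 1 ≤ X := by rw [hXe, le_div_iff₀ (by positivity)]; linarith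
    have hGX : G = 2 * c1 * E * X := by rw [hXe]; field_simp
    have hXy : X ≤ y := by
      rw [hy, hXe]
      have : G / E / (2 * c1) ≤ G / E := div_le_self hGE0 (by linarith)
      linarith
    have hyX : y ≤ 4 * c1 * X := by
      have : G / E = 2 * c1 * X := by rw [hXe]; field_simp
      rw [hy, this]
      linarith [one_le_mul_of_one_le_of_one_le hc1 hX1]
    have hGEy : G ≤ E * y := by rw [hy, mul_add, mul_div_cancel₀ _ hE0.ne']; linarith
    obtain ⟨P, hP⟩ : ∃ P, P = 4 * Ct ^ (2 * R + 1) * y ^ A := ⟨_, rfl⟩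
    have hCp : 1 ≤ Ct ^ (2 * R + 1) := one_le_pow₀ hCt
    have hyA : y ^ 2 ≤ y ^ A := pow_le_pow_right₀ hy1 (by omega)
    have hyy : y ≤ y ^ 2 := le_self_pow₀ hy1 (by omega)
    have hPy : y ≤ P := by
      rw [hP]
      calc y ≤ 1 * 1 * y ^ A := by linarith
        _ ≤ _ := by gcongr; norm_num
    have hP1 : 1 ≤ P := hy1.trans hPy
    have hP0 : 0 < P := by linarith
    have hCG : 4 * Ct * G ^ 2 ≤ P := by
      calc 4 * Ct * G ^ 2 ≤ 4 * Ct * (E * y) ^ 2 := by gcongr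
        _ = 4 * Ct ^ (2 * R + 1) * y ^ 2 := by rw [hE]; ring
        _ ≤ _ := by rw [hP]; gcongr
    have hPd : P ≤ P ^ (k + 2) := le_self_pow₀ hP1 (by omega)
    have hG2 : 2 ≤ G := by 
      rw [hGX]
      linarith [one_le_mul_of_one_le_of_one_le (one_le_mul_of_one_le_of_one_le hc1 hE1) hX1]
    obtain ⟨α, hα⟩ : ∃ α : Fin (R + 1) → ℝ, α = fun i => γ i / P ^ (k + 2) := ⟨_, rfl⟩
    have hγi : ∀ i, |γ i| ≤ G := fun i => by rw [hG]; exact norm_le_pi_norm γ i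
    have hXP : X ≤ P ^ ((R + 1) * (k + 1)) :=
      (hXy.trans hPy).trans (le_self_pow₀ hP1 (by positivity))
    have hS : ‖Sexp (topp k f) aB bB P α‖ ≤ c1 * P ^ ((n : ℝ) + ε1) * X ^ (-κ) := by
      rcases hw (topp k f) Ct (sys_topp hf) aB bB hB P X hP1 hX1 hXP α with h | h
      · exact h
      · exfalso
        obtain ⟨q, a, hq, hqc, ha⟩ := h
        have hq1 : (1 : ℝ) ≤ q := by exact_mod_cast hq
        have hPd0 : 0 < P ^ (k + 2) := by positivity
        have e1 : c1 * Ct ^ R * X = G / 2 := by rw [hGX, hE]; ring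
        rw [e1] at ha
        have e2 : (q : ℝ) ≤ Ct * G / 2 := by
          refine hqc.trans (le_of_eq ?_)
          rw [hGX, hE]; ring
        have ha0 : ∀ i, a i = 0 := by
          intro i
          have h1 := ha i
          have h2 : |(q : ℝ) * α i| ≤ 1 / 8 := by
            rw [hα, abs_mul, abs_div, abs_of_pos hPd0, Nat.abs_cast, ← mul_div_assoc,
              div_le_iff₀ hPd0]
            calc (q : ℝ) * |γ i| ≤ (Ct * G / 2) * G := by gcongr; exact hγi i
              _ = 1 / 8 * (4 * Ct * G ^ 2) := by ring
              _ ≤ _ := by gcongr; exact hCG.trans hPd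
          have h3 : G / 2 / P ^ (k + 2) ≤ 1 / 8 := by
            rw [div_le_iff₀ hPd0]
            have : G * 1 ≤ Ct * G ^ 2 := by
              have h7 : 1 ≤ Ct * G := one_le_mul_of_one_le_of_one_le hCt (by linarith)
              have h8 := mul_le_mul_of_nonneg_right h7 hG0
              calc G * 1 = 1 * G := by ring
                _ ≤ _ := h8
                _ = _ := by ring
            linarith
          have h4 : |(a i : ℝ)| < 1 := by
            have h5 := abs_le.mp (h1.trans h3)
            have h6 := abs_le.mp h2
            rw [abs_lt]
            constructor <;> linarith [h5.1, h5.2, h6.1, h6.2]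
          have h5 : |a i| < 1 := by exact_mod_cast h4
          exact Int.abs_lt_one_iff.mp h5
        have : G ≤ G / 2 := by
          conv_lhs => rw [hG]
          rw [pi_norm_le_iff_of_nonneg (by linarith)]
          intro i
          have h1 := ha i
          rw [ha0 i, Int.cast_zero, sub_zero, hα, abs_mul, abs_div, abs_of_pos hPd0, Nat.abs_cast,
            ← mul_div_assoc, div_le_div_iff_of_pos_right hPd0] at h1
          rw [Real.norm_eq_abs]
          exact le_trans (le_mul_of_one_le_left (abs_nonneg _) hq1) h1
        linarith
    have hM := hm (topp k f) Ct (sys_topp hf).deg hCt0.le (topp_coeff hf) aB bB hB P hP1 1 0 α le_rfl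
    simp only [topp_topp] at hM
    have e1 : (fun i => ((0 : Fin (R + 1) → ℤ) i : ℝ) / ((1 : ℕ) : ℝ) + α i) = α := by
      funext i; simp
    have e2 : (fun i => P ^ (k + 2) * α i) = γ := by
      funext i; rw [hα]; field_simp
    have e3 : (∑ i, |α i|) * P ^ (k + 2) ≤ (R + 1) * G := by
      rw [Finset.sum_mul]
      calc _ ≤ ∑ i : Fin (R + 1), G := by
            apply Finset.sum_le_sum
            intro i _
            rw [hα, abs_div, abs_of_pos (show 0 < P ^ (k + 2) by positivity),
              div_mul_cancel₀ _ (by positivity)]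
            exact hγi i
        _ = _ := by simp
    rw [e1, e2, Sgauss_one] at hM
    have hPn : 0 < P ^ n := by positivity
    have hlow : P ^ n * ‖Iosc (topp k f) (boxSet aB bB) γ‖ ≤
        c1 * P ^ ((n : ℝ) + ε1) * X ^ (-κ) + c2 * (P ^ n / P) * (1 + Ct * ((R + 1) * G)) := by
      have h1 : ‖(P : ℂ) ^ n * Iosc (topp k f) (boxSet aB bB) γ‖ =
          P ^ n * ‖Iosc (topp k f) (boxSet aB bB) γ‖ := by
        rw [norm_mul, norm_pow, Complex.norm_real, Real.norm_of_nonneg hP0.le]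
      rw [← h1]
      have h2 : ((((1 : ℕ) : ℂ)) ^ n)⁻¹ * 1 * ((P : ℂ) ^ n * Iosc (topp k f) (boxSet aB bB) γ) =
          (P : ℂ) ^ n * Iosc (topp k f) (boxSet aB bB) γ := by simp
      have hM2 : ‖Sexp (topp k f) aB bB P α - (P : ℂ) ^ n * Iosc (topp k f) (boxSet aB bB) γ‖ ≤
          c2 * (P ^ n / P) * (1 + Ct * ((R + 1) * G)) := by
        have h3 := hM
        rw [← h2]
        refine h3.trans ?_
        rw [Nat.cast_one, mul_one, mul_assoc Ct]
        gcongr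
      have h4 := norm_sub_norm_le ((P : ℂ) ^ n * Iosc (topp k f) (boxSet aB bB) γ)
        (Sexp (topp k f) aB bB P α)
      rw [norm_sub_rev] at h4
      linarith
    have hup : c1 * P ^ ((n : ℝ) + ε1) * X ^ (-κ) + c2 * (P ^ n / P) * (1 + Ct * ((R + 1) * G)) =
        P ^ n * (c1 * P ^ ε1 * X ^ (-κ) + c2 * ((1 + Ct * ((R + 1) * G)) / P)) := by
      rw [Real.rpow_add hP0, Real.rpow_natCast]; ring
    rw [hup] at hlow
    have hlow2 := le_of_mul_le_mul_left hlow hPn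
    have t1 : P ^ ε1 ≤ 4 * Ct ^ ε * y ^ ε := by
      rw [hP, Real.mul_rpow (by positivity) (by positivity), Real.mul_rpow (by positivity) (by positivity),
        ← Real.rpow_natCast, ← Real.rpow_natCast, ← Real.rpow_mul (by positivity),
        ← Real.rpow_mul (by positivity)]
      gcongr
      · calc (4 : ℝ) ^ ε1 ≤ 4 ^ (1 : ℝ) := Real.rpow_le_rpow_of_exponent_le (by norm_num) hepsLe
          _ = 4 := Real.rpow_one _
      · have : (0:ℝ) ≤ ε1 * A := by positivity
        linarith
      · have : (0:ℝ) ≤ ε1 * (2 * R + 1 : ℕ) := by positivity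
        linarith
    have t2 : X ^ (-κ) ≤ (4 * c1) ^ κ * y ^ (-κ) := by
      rw [Real.rpow_neg (by linarith), Real.rpow_neg hy0.le, ← div_eq_mul_inv,
        le_div_iff₀ (by positivity), inv_mul_le_iff₀ (by positivity), mul_comm,
        ← Real.mul_rpow (by positivity) (by linarith)]
      exact Real.rpow_le_rpow hy0.le hyX hκ
    have t3 : (1 + Ct * ((R + 1) * G)) / P ≤ (R + 2) * y ^ (-(κ - ε)) := by
      rw [div_le_iff₀ hP0]
      have h1 : 1 + Ct * ((R + 1) * G) ≤ (R + 2) * (Ct ^ (2 * R + 1) * y) := by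
        have h2 : Ct * G ≤ Ct ^ (2 * R + 1) * y := by
          calc Ct * G ≤ Ct * (E * y) := by gcongr
            _ = Ct ^ (R + 1) * y := by rw [hE]; ring
            _ ≤ _ := by gcongr; omega
        have h3 : 1 ≤ Ct ^ (2 * R + 1) * y := one_le_mul_of_one_le_of_one_le hCp hy1
        have h4 := mul_le_mul_of_nonneg_left h2 (show (0:ℝ) ≤ R + 1 by positivity)
        linarith
      have h4 : y ≤ y ^ (-(κ - ε)) * y ^ A := by
        rw [← Real.rpow_natCast y A, ← Real.rpow_add hy0]
        calc y = y ^ (1 : ℝ) := (Real.rpow_one y).symm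
          _ ≤ _ := Real.rpow_le_rpow_of_exponent_le hy1 (by linarith)
      calc _ ≤ _ := h1
        _ ≤ (R + 2) * (Ct ^ (2 * R + 1) * (y ^ (-(κ - ε)) * y ^ A)) := by gcongr
        _ = 1 * ((R + 2) * y ^ (-(κ - ε)) * (Ct ^ (2 * R + 1) * y ^ A)) := by ring
        _ ≤ 4 * ((R + 2) * y ^ (-(κ - ε)) * (Ct ^ (2 * R + 1) * y ^ A)) := by gcongr; norm_num
        _ = _ := by rw [hP]; ring
    have t4 : y ^ ε * y ^ (-κ) = y ^ (-(κ - ε)) := by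
      rw [← Real.rpow_add hy0]; ring_nf
    calc _ ≤ _ := hlow2
      _ ≤ c1 * (4 * Ct ^ ε * y ^ ε) * ((4 * c1) ^ κ * y ^ (-κ)) + c2 * ((R + 2) * y ^ (-(κ - ε))) := by
          gcongr
      _ = (4 * c1 * (4 * c1) ^ κ) * Ct ^ ε * (y ^ ε * y ^ (-κ)) + c2 * (R + 2) * 1 * y ^ (-(κ - ε)) := by ring
      _ ≤ (4 * c1 * (4 * c1) ^ κ) * Ct ^ ε * y ^ (-(κ - ε)) + c2 * (R + 2) * Ct ^ ε * y ^ (-(κ - ε)) := by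
          rw [t4]; gcongr
      _ = _ := by ring

end OscBound
end


-- part C7
section


section SingInt

lemma continuous_Iosc {n r : ℕ} (g : Fin r → MvPolynomial (Fin n) ℤ) (aB bB : Fin n → ℝ) :
    Continuous (Iosc g (boxSet aB bB)) := by
  have hK : IsCompact (boxSet aB bB) := isCompact_univ_pi fun j => isCompact_Icc
  have := continuous_parametric_integral_of_continuous (μ := (volume : Measure (Fin n → ℝ)))
    (f := fun (γ : Fin r → ℝ) (ζ : Fin n → ℝ) => eC (∑ i, γ i * aeval ζ (g i)))
    (s := boxSet aB bB) (continuous_phase g) hK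
  exact this

lemma setOf_abs_le {r : ℕ} (Φ : ℝ) (hΦ : 0 ≤ Φ) :
    {γ : Fin r → ℝ | ∀ i, |γ i| ≤ Φ} = Metric.closedBall 0 Φ := by
  ext γ
  simp [pi_norm_le_iff_of_nonneg hΦ]

lemma weight_int (r : ℕ) (s : ℝ) (hs : (r : ℝ) < s) : ∃ c : ℝ, 0 ≤ c ∧ ∀ E : ℝ, 0 < E →
    Integrable (fun γ : Fin r → ℝ => (1 + ‖γ‖ / E) ^ (-s)) ∧
    ∫ γ : Fin r → ℝ, (1 + ‖γ‖ / E) ^ (-s) = c * E ^ r := by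
  have h1 : Integrable (fun γ : Fin r → ℝ => (1 + ‖γ‖) ^ (-s)) :=
    integrable_one_add_norm (by simpa using hs)
  refine ⟨∫ γ : Fin r → ℝ, (1 + ‖γ‖) ^ (-s), integral_nonneg fun γ => by positivity,
    fun E hE => ?_⟩
  have e : (fun γ : Fin r → ℝ => (1 + ‖γ‖ / E) ^ (-s)) = fun γ => (1 + ‖E⁻¹ • γ‖) ^ (-s) := by
    funext γ
    rw [norm_smul, norm_inv, Real.norm_of_nonneg hE.le, inv_mul_eq_div]
  constructor
  · rw [e]
    exact h1.comp_smul (inv_ne_zero hE.ne')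
  · rw [e, Measure.integral_comp_inv_smul_of_nonneg volume (fun γ : Fin r → ℝ => (1 + ‖γ‖) ^ (-s)) hE.le]
    simp [mul_comm]

theorem sing_int (n R k Δ : ℕ) (hn : 0 < n) (hΔ : Δ ≤ n) (ε : ℝ) (hε : 0 < ε) (hε1 : ε ≤ 1)
    (hκ : (R : ℝ) + 1 + 2 * ε < kap n R k Δ) :
    ∃ c : ℝ, 1 ≤ c ∧
    ∀ (f : Fin (R + 1) → MvPolynomial (Fin n) ℤ) (Ct : ℝ), Sys n (R + 1) k Δ f Ct →
    ∀ aB bB : Fin n → ℝ, (∀ j, -1 ≤ aB j ∧ 0 < bB j - aB j ∧ bB j - aB j < 1 ∧ bB j ≤ 1) →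
    ∀ μ : Fin (R + 1) → ℝ,
      ‖Jlim (topp k f) aB bB μ‖ ≤ c * (Ct ^ ε * (Ct ^ R) ^ (R + 1)) ∧
      ∀ Φ : ℝ, 0 < Φ → ‖Jlim (topp k f) aB bB μ - Jint (topp k f) aB bB μ Φ‖ ≤
        c * (Ct ^ ε * (Ct ^ R) ^ (R + 1)) * (Φ / Ct ^ R) ^ (-(kap n R k Δ - (R + 1) - 2 * ε)) := by
  obtain ⟨c1, hc1, h1⟩ := osc_bound n R k Δ hn hΔ ε hε hε1
  obtain ⟨c2, hc2, h2⟩ := weight_int (R + 1) ((R : ℝ) + 1 + ε) (by push_cast; linarith)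
  generalize kap n R k Δ = κ at *
  refine ⟨c1 * c2 + 1, by nlinarith, fun f Ct hf aB bB hB μ => ?_⟩
  have hCt := hf.one
  have hE1 : 1 ≤ Ct ^ R := one_le_pow₀ hCt
  have hI := h1 f Ct hf aB bB hB
  generalize Ct ^ R = E at *
  have hE0 : 0 < E := by linarith
  obtain ⟨h3, h4⟩ := h2 E hE0
  obtain ⟨D, hD⟩ : ∃ D, D = Ct ^ ε := ⟨_, rfl⟩
  have hD0 : 0 < D := by rw [hD]; positivity
  rw [← hD] at hI ⊢
  set W : (Fin (R + 1) → ℝ) → ℝ := fun γ => (1 + ‖γ‖ / E) ^ (-((R : ℝ) + 1 + ε)) with hW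
  have hW0 : ∀ γ, 0 ≤ W γ := fun γ => by positivity
  set F : (Fin (R + 1) → ℝ) → ℂ := fun γ => Iosc (topp k f) (boxSet aB bB) γ * eC (-(∑ i, γ i * μ i))
    with hF
  have hFn : ∀ γ, ‖F γ‖ = ‖Iosc (topp k f) (boxSet aB bB) γ‖ := fun γ => by
    rw [hF]; simp only; rw [norm_mul, norm_eC, mul_one]
  have hFc : Continuous F := (continuous_Iosc _ _ _).mul (continuous_eC.comp (by fun_prop))
  -- pointwise bound
  have hb0 : ∀ γ, ‖F γ‖ ≤ c1 * D * W γ := by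
    intro γ
    rw [hFn]
    refine (hI γ).trans ?_
    have : 1 ≤ 1 + ‖γ‖ / E := by have : 0 ≤ ‖γ‖ / E := by positivity
                                 linarith
    gcongr
    exact Real.rpow_le_rpow_of_exponent_le this (by linarith)
  have hFi : Integrable F := (h3.const_mul (c1 * D)).mono' hFc.aestronglyMeasurable
    (Eventually.of_forall hb0)
  have hJ : Jlim (topp k f) aB bB μ = ∫ γ, F γ := by
    unfold Jlim
    apply Tendsto.limUnder_eq
    have h5 : Tendsto (fun Φ : ℝ => ∫ γ in Metric.closedBall (0 : Fin (R + 1) → ℝ) Φ, F γ) atTop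
        (nhds (∫ γ, F γ)) :=
      (aecover_closedBall tendsto_id).integral_tendsto_of_countably_generated hFi
    refine h5.congr' ?_
    filter_upwards [eventually_ge_atTop 0] with Φ hΦ
    unfold Jint
    rw [setOf_abs_le Φ hΦ]
  constructor
  · rw [hJ]
    calc _ ≤ ∫ γ, c1 * D * W γ := norm_integral_le_of_norm_le (h3.const_mul _) (Eventually.of_forall hb0)
      _ = c1 * c2 * (D * E ^ (R + 1)) := by rw [integral_const_mul, h4]; ring
      _ ≤ _ := by gcongr; linarith
  · intro Φ hΦ
    have h6 : Jlim (topp k f) aB bB μ - Jint (topp k f) aB bB μ Φ =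
        ∫ γ in (Metric.closedBall (0 : Fin (R + 1) → ℝ) Φ)ᶜ, F γ := by
      rw [hJ, ← integral_add_compl (Metric.isClosed_closedBall (x := (0 : Fin (R + 1) → ℝ)) (ε := Φ)).measurableSet hFi]
      unfold Jint
      rw [setOf_abs_le Φ hΦ.le, add_sub_cancel_left]
    rw [h6]
    set T : ℝ := (Φ / E) ^ (-(κ - (R + 1) - 2 * ε)) with hT
    have hT0 : 0 ≤ T := by positivity
    calc _ ≤ ∫ γ in (Metric.closedBall (0 : Fin (R + 1) → ℝ) Φ)ᶜ, c1 * D * T * W γ := by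
          apply norm_integral_le_of_norm_le (h3.const_mul _).integrableOn
          filter_upwards [ae_restrict_mem Metric.isClosed_closedBall.measurableSet.compl] with γ hγ
          have hγ' : Φ < ‖γ‖ := by simpa using hγ
          rw [hFn]
          refine (hI γ).trans ?_
          have hy : Φ / E ≤ 1 + ‖γ‖ / E := by
            have : Φ / E ≤ ‖γ‖ / E := by gcongr
            linarith
          have hy0 : 0 < Φ / E := by positivity
          have e1 : -(κ - ε) = -(κ - (R + 1) - 2 * ε) + -((R : ℝ) + 1 + ε) := by ring
          rw [e1, Real.rpow_add (by positivity), mul_assoc (c1 * D)]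
          have : (1 + ‖γ‖ / E) ^ (-(κ - (R + 1) - 2 * ε)) ≤ T := by
            rw [hT]
            exact Real.rpow_le_rpow_of_nonpos hy0 hy (by linarith)
          gcongr
      _ ≤ ∫ γ, c1 * D * T * W γ := by
          apply setIntegral_le_integral (h3.const_mul _)
          exact Eventually.of_forall fun γ => mul_nonneg (by positivity) (hW0 γ)
      _ = c1 * c2 * (D * E ^ (R + 1)) * T := by rw [integral_const_mul, h4]; ring
      _ ≤ _ := by gcongr; linarith

end SingInt
end


-- part C8
section


section SingSer

def Aq {n r : ℕ} (f : Fin r → MvPolynomial (Fin n) ℤ) (ν : Fin r → ℤ) (q : ℕ) : ℂ :=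
  ((q : ℂ) ^ n)⁻¹ * ∑ a ∈ resSet r q q, SgaussNu f q (fun i => ((a i : ℕ) : ℤ) + 1) ν

theorem Aq_bound (n R k Δ : ℕ) (hn : 0 < n) (hΔ : Δ ≤ n) (ε : ℝ) (hε : 0 < ε) : ∃ c : ℝ, 1 ≤ c ∧
    ∀ (f : Fin (R + 1) → MvPolynomial (Fin n) ℤ) (Ct : ℝ), Sys n (R + 1) k Δ f Ct →
    ∀ (ν : Fin (R + 1) → ℤ) (q : ℕ),
    ‖Aq f ν q‖ ≤ c * Ct ^ (((R : ℝ) + 1) * kap n R k Δ) * (q : ℝ) ^ ((R : ℝ) + 1 - kap n R k Δ + ε) := by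
  obtain ⟨c, hc, h⟩ := gauss_bound n R k Δ hΔ ε hε
  refine ⟨c, hc, fun f Ct hf ν q => ?_⟩
  have hCt0 : 0 < Ct := by linarith [hf.one]
  rcases Nat.eq_zero_or_pos q with rfl | hq
  · have : Aq f ν 0 = 0 := by simp [Aq, hn.ne']
    rw [this, norm_zero]
    have : (0 : ℝ) ≤ ((0 : ℕ) : ℝ) ^ ((R : ℝ) + 1 - kap n R k Δ + ε) :=
      Real.rpow_nonneg (by simp) _
    positivity
  · have hq0 : (0 : ℝ) < q := by exact_mod_cast hq
    unfold Aq
    rw [norm_mul, norm_inv, norm_pow, Complex.norm_natCast]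
    have hcard : ((resSet (R + 1) q q).card : ℝ) ≤ (q : ℝ) ^ (R + 1) := by
      have : (resSet (R + 1) q q).card ≤ q ^ (R + 1) := by
        refine (Finset.card_filter_le _ _).trans (le_of_eq ?_)
        simp
      exact_mod_cast this
    obtain ⟨B, hB⟩ : ∃ B, B = c * Ct ^ (((R : ℝ) + 1) * kap n R k Δ) := ⟨_, rfl⟩
    have hB0 : 0 ≤ B := by rw [hB]; positivity
    have hs : ‖∑ a ∈ resSet (R + 1) q q, SgaussNu f q (fun i => ((a i : ℕ) : ℤ) + 1) ν‖ ≤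
        (q : ℝ) ^ (R + 1) * (B * (q : ℝ) ^ ((n : ℝ) - kap n R k Δ + ε)) := by
      calc _ ≤ ∑ a ∈ resSet (R + 1) q q, B * (q : ℝ) ^ ((n : ℝ) - kap n R k Δ + ε) := by
            refine (norm_sum_le _ _).trans (Finset.sum_le_sum fun a ha => ?_)
            unfold SgaussNu
            rw [norm_mul, norm_eC, mul_one, hB]
            exact h f Ct hf q _ hq (cop_of_resSet ha)
        _ = (resSet (R + 1) q q).card * (B * (q : ℝ) ^ ((n : ℝ) - kap n R k Δ + ε)) := by
            rw [Finset.sum_const, nsmul_eq_mul]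
        _ ≤ _ := by gcongr
    rw [← hB]
    calc _ ≤ ((q : ℝ) ^ n)⁻¹ * ((q : ℝ) ^ (R + 1) * (B * (q : ℝ) ^ ((n : ℝ) - kap n R k Δ + ε))) := by
          gcongr
      _ = B * (((q : ℝ) ^ n)⁻¹ * (q : ℝ) ^ (R + 1) * (q : ℝ) ^ ((n : ℝ) - kap n R k Δ + ε)) := by ring
      _ = _ := by
          rw [← Real.rpow_natCast, ← Real.rpow_natCast, ← Real.rpow_neg hq0.le, ← Real.rpow_add hq0,
            ← Real.rpow_add hq0]
          congr 2
          push_cast; ring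

set_option maxHeartbeats 1000000 in
theorem main_term (n R k Δ : ℕ) (hn : 0 < n) (hΔ : Δ ≤ n) (ε : ℝ) (hε : 0 < ε) (hε1 : ε ≤ 1)
    (hκ : (R : ℝ) + 2 + 2 * ε < kap n R k Δ) (c0 : ℝ) (hc0 : 1 ≤ c0) :
    ∃ c : ℝ, 1 ≤ c ∧
    ∀ (f : Fin (R + 1) → MvPolynomial (Fin n) ℤ) (Ct : ℝ), Sys n (R + 1) k Δ f Ct →
    ∀ aB bB : Fin n → ℝ, (∀ j, -1 ≤ aB j ∧ 0 < bB j - aB j ∧ bB j - aB j < 1 ∧ bB j ≤ 1) →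
    ∀ (ν : Fin (R + 1) → ℤ) (μ : Fin (R + 1) → ℝ),
      ‖singularSeries f ν * Jlim (topp k f) aB bB μ‖ ≤
        c * Ct ^ (((R : ℝ) + 1) * kap n R k Δ) * (Ct ^ ε * (Ct ^ R) ^ (R + 1)) ∧
      ∀ X : ℝ, 1 ≤ X →
      ‖singularSeries f ν * Jlim (topp k f) aB bB μ -
        ∑ q ∈ Finset.Icc 1 ⌊c0 * Ct ^ (R + 1) * X⌋₊,
          Aq f ν q * Jint (topp k f) aB bB μ (c0 * Ct ^ R * X / q)‖ ≤
        c * Ct ^ (((R : ℝ) + 1) * kap n R k Δ) * (Ct ^ ε * (Ct ^ R) ^ (R + 1)) * Ct ^ (R + 1) *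
          X ^ (-(kap n R k Δ - (R + 2) - 2 * ε)) := by
  obtain ⟨c1, hc1, h1⟩ := Aq_bound n R k Δ hn hΔ ε hε
  obtain ⟨c2, hc2, h2⟩ := sing_int n R k Δ hn hΔ ε hε hε1 (by linarith)
  generalize kap n R k Δ = κ at *
  have hus : Summable (fun q : ℕ => (q : ℝ) ^ (-1 - ε)) :=
    Real.summable_nat_rpow.mpr (by linarith)
  set Z : ℝ := ∑' q : ℕ, (q : ℝ) ^ (-1 - ε) with hZ
  have hZ0 : 0 ≤ Z := tsum_nonneg fun q => by positivity
  refine ⟨c1 * c2 * Z + 1, by linarith [show 0 ≤ c1 * c2 * Z by positivity],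
    fun f Ct hf aB bB hB ν μ => ?_⟩
  have hCt := hf.one
  have hCt0 : 0 < Ct := by linarith
  obtain ⟨hJ, hJt⟩ := h2 f Ct hf aB bB hB μ
  have hA := h1 f Ct hf ν
  obtain ⟨D, hD⟩ : ∃ D, D = Ct ^ ε * (Ct ^ R) ^ (R + 1) := ⟨_, rfl⟩
  have hD0 : 0 < D := by rw [hD]; positivity
  obtain ⟨G, hG⟩ : ∃ G, G = Ct ^ (((R : ℝ) + 1) * κ) := ⟨_, rfl⟩
  have hG0 : 0 < G := by rw [hG]; positivity
  simp only [← hD, ← hG] at hJ hJt hA ⊢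
  have hAu : ∀ q, ‖Aq f ν q‖ ≤ c1 * G * (q : ℝ) ^ (-1 - ε) := by
    intro q
    rcases Nat.eq_zero_or_pos q with rfl | hq
    · have : Aq f ν 0 = 0 := by simp [Aq, hn.ne']
      rw [this, norm_zero]; positivity
    · have hq1 : (1 : ℝ) ≤ q := by exact_mod_cast hq
      refine (hA q).trans ?_
      gcongr
      linarith
  have hAs : Summable (fun q => ‖Aq f ν q‖) :=
    Summable.of_nonneg_of_le (fun q => norm_nonneg _) hAu (hus.mul_left _)
  have hS : singularSeries f ν = ∑' q, Aq f ν q := rfl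
  have hAs' : Summable (fun q => Aq f ν q) := hAs.of_norm
  have hSn : ‖singularSeries f ν‖ ≤ c1 * G * Z := by
    rw [hS]
    refine (norm_tsum_le_tsum_norm hAs).trans ?_
    rw [hZ, ← tsum_mul_left]
    exact hAs.tsum_le_tsum hAu (hus.mul_left _)
  constructor
  · rw [norm_mul]
    calc _ ≤ (c1 * G * Z) * (c2 * D) := by gcongr
      _ = c1 * c2 * Z * G * D := by ring
      _ ≤ _ := by gcongr; linarith
  · intro X hX
    have hX0 : 0 < X := by linarith
    set J := Jlim (topp k f) aB bB μ with hJdef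
    set Q0 : ℝ := c0 * Ct ^ (R + 1) * X with hQ0
    have hCR : 1 ≤ Ct ^ (R + 1) := one_le_pow₀ hCt
    have hXQ : X ≤ Q0 := by
      rw [hQ0]
      exact le_mul_of_one_le_left hX0.le (one_le_mul_of_one_le_of_one_le hc0 hCR)
    set t : ℕ → ℂ := fun q => if q ∈ Finset.Icc 1 ⌊Q0⌋₊ then
      Jint (topp k f) aB bB μ (c0 * Ct ^ R * X / q) else 0 with ht
    have e1 : ∑ q ∈ Finset.Icc 1 ⌊Q0⌋₊, Aq f ν q * Jint (topp k f) aB bB μ (c0 * Ct ^ R * X / q) =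
        ∑' q, Aq f ν q * t q := by
      rw [tsum_eq_sum (s := Finset.Icc 1 ⌊Q0⌋₊)]
      · apply Finset.sum_congr rfl
        intro q hq
        rw [ht]; simp only; rw [if_pos hq]
      · intro q hq
        rw [ht]; simp only; rw [if_neg hq, mul_zero]
    have hts : Summable (fun q => Aq f ν q * t q) := by
      apply summable_of_ne_finset_zero (s := Finset.Icc 1 ⌊Q0⌋₊)
      intro q hq
      rw [ht]; simp only; rw [if_neg hq, mul_zero]
    have e2 : singularSeries f ν * J - ∑ q ∈ Finset.Icc 1 ⌊Q0⌋₊,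
        Aq f ν q * Jint (topp k f) aB bB μ (c0 * Ct ^ R * X / q) = ∑' q, Aq f ν q * (J - t q) := by
      rw [e1, hS, ← tsum_mul_right, ← (hAs'.mul_right J).tsum_sub hts]
      congr 1
      funext q
      ring
    rw [e2]
    have hb : ∀ q, ‖Aq f ν q * (J - t q)‖ ≤
        (c1 * c2 * G * D * Ct ^ (R + 1) * X ^ (-(κ - (R + 2) - 2 * ε))) * (q : ℝ) ^ (-1 - ε) := by
      intro q
      rw [norm_mul]
      rcases Nat.eq_zero_or_pos q with rfl | hq
      · have : Aq f ν 0 = 0 := by simp [Aq, hn.ne']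
        rw [this, norm_zero, zero_mul]; positivity
      have hq1 : (1 : ℝ) ≤ q := by exact_mod_cast hq
      have hq0 : (0 : ℝ) < q := by linarith
      by_cases hm : q ∈ Finset.Icc 1 ⌊Q0⌋₊
      · have hqQ : (q : ℝ) ≤ Q0 := by
          rw [Finset.mem_Icc, Nat.le_floor_iff (by linarith)] at hm
          exact hm.2
        have : t q = Jint (topp k f) aB bB μ (c0 * Ct ^ R * X / q) := by
          rw [ht]; simp only; rw [if_pos hm]
        rw [this]
        have h5 := hJt (c0 * Ct ^ R * X / q) (by positivity)
        have e3 : c0 * Ct ^ R * X / q / Ct ^ R = (c0 * X) / q := by field_simp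
        rw [e3] at h5
        have hcX : 0 < c0 * X := by positivity
        have h6 : (c0 * X / q) ^ (-(κ - (R + 1) - 2 * ε)) =
            (c0 * X) ^ (-(κ - (R + 2) - 2 * ε)) * (c0 * X)⁻¹ * (q : ℝ) ^ (κ - (R + 1) - 2 * ε) := by
          rw [Real.div_rpow hcX.le hq0.le, Real.rpow_neg hq0.le, div_inv_eq_mul, ← Real.rpow_neg_one (c0 * X),
            ← Real.rpow_add hcX]
          congr 2; ring
        have h7 : (c0 * X) ^ (-(κ - (R + 2) - 2 * ε)) ≤ X ^ (-(κ - (R + 2) - 2 * ε)) :=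
          Real.rpow_le_rpow_of_nonpos hX0 (le_mul_of_one_le_left hX0.le hc0) (by linarith)
        have h8 : (q : ℝ) ^ ((R : ℝ) + 1 - κ + ε) * (q : ℝ) ^ (κ - (R + 1) - 2 * ε) =
            (q : ℝ) ^ (-1 - ε) * q := by
          rw [← Real.rpow_add hq0, ← Real.rpow_add_one hq0.ne']
          congr 1; ring
        calc _ ≤ (c1 * G * (q : ℝ) ^ ((R : ℝ) + 1 - κ + ε)) * (c2 * D *
              ((c0 * X) ^ (-(κ - (R + 2) - 2 * ε)) * (c0 * X)⁻¹ * (q : ℝ) ^ (κ - (R + 1) - 2 * ε))) := by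
              rw [← h6]
              exact mul_le_mul (hA q) h5 (norm_nonneg _) (by positivity)
          _ = c1 * c2 * G * D * (q * (c0 * X)⁻¹) * (c0 * X) ^ (-(κ - (R + 2) - 2 * ε)) *
              (q : ℝ) ^ (-1 - ε) := by
              rw [show (q : ℝ) ^ (-1 - ε) = (q : ℝ) ^ ((R : ℝ) + 1 - κ + ε) *
                (q : ℝ) ^ (κ - (R + 1) - 2 * ε) / q by rw [h8]; field_simp]
              field_simp
          _ ≤ c1 * c2 * G * D * Ct ^ (R + 1) * X ^ (-(κ - (R + 2) - 2 * ε)) * (q : ℝ) ^ (-1 - ε) := by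
              gcongr
              rw [← div_eq_mul_inv, div_le_iff₀ hcX]
              refine hqQ.trans (le_of_eq ?_)
              rw [hQ0]; ring
      · have hqQ : Q0 < q := by
          rw [Finset.mem_Icc, not_and_or] at hm
          rcases hm with hm | hm
          · omega
          · exact (Nat.floor_lt (by linarith)).mp (by omega)
        have : t q = 0 := by
          rw [ht]; simp only; rw [if_neg hm]
        rw [this, sub_zero]
        have h8 : (q : ℝ) ^ ((R : ℝ) + 1 - κ + ε) =
            (q : ℝ) ^ (-(κ - (R + 2) - 2 * ε)) * (q : ℝ) ^ (-1 - ε) := by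
          rw [← Real.rpow_add hq0]
          congr 1; ring
        have h9 : (q : ℝ) ^ (-(κ - (R + 2) - 2 * ε)) ≤ X ^ (-(κ - (R + 2) - 2 * ε)) :=
          Real.rpow_le_rpow_of_nonpos hX0 (by linarith) (by linarith)
        calc _ ≤ (c1 * G * (q : ℝ) ^ ((R : ℝ) + 1 - κ + ε)) * (c2 * D) :=
              mul_le_mul (hA q) hJ (norm_nonneg _) (by positivity)
          _ = c1 * c2 * G * D * 1 * (q : ℝ) ^ (-(κ - (R + 2) - 2 * ε)) * (q : ℝ) ^ (-1 - ε) := by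
              rw [h8]; ring
          _ ≤ _ := by gcongr
    have hsn : Summable (fun q => ‖Aq f ν q * (J - t q)‖) :=
      Summable.of_nonneg_of_le (fun q => norm_nonneg _) hb (hus.mul_left _)
    calc _ ≤ ∑' q, ‖Aq f ν q * (J - t q)‖ := norm_tsum_le_tsum_norm hsn
      _ ≤ (c1 * c2 * G * D * Ct ^ (R + 1) * X ^ (-(κ - (R + 2) - 2 * ε))) * Z := by
          rw [hZ, ← tsum_mul_left]
          exact hsn.tsum_le_tsum hb (hus.mul_left _)
      _ = (c1 * c2 * Z) * G * D * Ct ^ (R + 1) * X ^ (-(κ - (R + 2) - 2 * ε)) := by ring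
      _ ≤ _ := by gcongr; linarith

end SingSer
end


-- part C9
section


section Minor

def ucube (r : ℕ) (t : ℝ) : Set (Fin r → ℝ) := Set.univ.pi fun _ => Set.Ioc t (t + 1)

def arcq {r : ℕ} (B : ℝ) (q : ℕ) (a : Fin r → ℤ) : Set (Fin r → ℝ) :=
  {α | ∀ i, |(q : ℝ) * α i - a i| ≤ B}

def Arc (r : ℕ) (Q B : ℝ) : Set (Fin r → ℝ) :=
  {α | ∃ (q : ℕ) (a : Fin r → ℤ), 1 ≤ q ∧ (q : ℝ) ≤ Q ∧ α ∈ arcq B q a}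

lemma measurableSet_arcq {r : ℕ} (B : ℝ) (q : ℕ) (a : Fin r → ℤ) : MeasurableSet (arcq B q a) := by
  apply IsClosed.measurableSet
  unfold arcq
  simp only [Set.ofPred_forall]
  apply isClosed_iInter
  intro i
  exact isClosed_le (by fun_prop) continuous_const

lemma measurableSet_Arc (r : ℕ) (Q B : ℝ) : MeasurableSet (Arc r Q B) := by
  have : Arc r Q B = ⋃ (q : ℕ) (a : Fin r → ℤ) (_ : 1 ≤ q ∧ (q : ℝ) ≤ Q), arcq B q a := by
    ext α
    simp only [Arc, Set.mem_iUnion, Set.mem_ofPred_eq, exists_prop, and_assoc]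
  rw [this]
  exact MeasurableSet.iUnion fun q => MeasurableSet.iUnion fun a => MeasurableSet.iUnion fun _ =>
    measurableSet_arcq B q a

lemma measurableSet_ucube (r : ℕ) (t : ℝ) : MeasurableSet (ucube r t) :=
  MeasurableSet.univ_pi fun _ => measurableSet_Ioc

lemma volume_ucube (r : ℕ) (t : ℝ) : volume (ucube r t) = 1 := by
  unfold ucube
  rw [volume_pi_pi]
  simp

lemma arc1_vol (t B : ℝ) (hB : 0 ≤ B) (q : ℕ) (hq : 1 ≤ q) :
    volume {x : ℝ | x ∈ Set.Ioc t (t + 1) ∧ ∃ a : ℤ, |(q : ℝ) * x - a| ≤ B} ≤ ENNReal.ofReal (6 * B) := by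
  have hq1 : (1 : ℝ) ≤ q := by exact_mod_cast hq
  have hq0 : (0 : ℝ) < q := by linarith
  rcases le_or_gt B (1 / 2) with h | h
  · have hsub : {x : ℝ | x ∈ Set.Ioc t (t + 1) ∧ ∃ a : ℤ, |(q : ℝ) * x - a| ≤ B} ⊆
        ⋃ a ∈ Finset.Icc ⌈q * t - B⌉ ⌊q * (t + 1) + B⌋, Set.Icc (((a : ℝ) - B) / q) ((a + B) / q) := by
      rintro x ⟨⟨hx1, hx2⟩, a, ha⟩
      rw [abs_le] at ha
      have h1 : q * t ≤ q * x := by gcongr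
      have h2 : q * x ≤ q * (t + 1) := by gcongr
      simp only [Set.mem_iUnion]
      refine ⟨a, ?_, ?_, ?_⟩
      · rw [Finset.mem_Icc, Int.ceil_le, Int.le_floor]
        constructor <;> linarith
      · rw [div_le_iff₀ hq0]; linarith
      · rw [le_div_iff₀ hq0]; linarith
    refine (measure_mono hsub).trans ((measure_biUnion_finset_le _ _).trans ?_)
    have e : ∀ a : ℤ, volume (Set.Icc (((a : ℝ) - B) / q) ((a + B) / q)) = ENNReal.ofReal (2 * B / q) := by
      intro a
      rw [Real.volume_Icc]
      congr 1; ring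
    simp only [e]
    rw [Finset.sum_const, nsmul_eq_mul, ← ENNReal.ofReal_natCast, ← ENNReal.ofReal_mul (by positivity)]
    apply ENNReal.ofReal_le_ofReal
    have hc : ((Finset.Icc ⌈q * t - B⌉ ⌊q * (t + 1) + B⌋).card : ℝ) ≤ q + 2 * B + 1 := by
      rw [Int.card_Icc]
      have h1 := Int.floor_le (q * (t + 1) + B)
      have h2 := Int.le_ceil (q * t - B)
      rcases le_total 0 (⌊q * (t + 1) + B⌋ + 1 - ⌈q * t - B⌉) with h | h
      · have : (((⌊q * (t + 1) + B⌋ + 1 - ⌈q * t - B⌉).toNat : ℕ) : ℝ) =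
            ((⌊q * (t + 1) + B⌋ + 1 - ⌈q * t - B⌉ : ℤ) : ℝ) := by
          exact_mod_cast congrArg (Int.cast : ℤ → ℝ) (Int.toNat_of_nonneg h)
        rw [this]; push_cast; linarith
      · rw [Int.toNat_of_nonpos h]; simp; linarith
    calc _ ≤ (q + 2 * B + 1) * (2 * B / q) := by gcongr
      _ ≤ (3 * q) * (2 * B / q) := by gcongr; linarith
      _ = 6 * B := by field_simp; ring
  · calc _ ≤ volume (Set.Ioc t (t + 1)) := measure_mono fun x hx => hx.1
      _ = ENNReal.ofReal 1 := by rw [Real.volume_Ioc]; congr 1; ring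
      _ ≤ _ := ENNReal.ofReal_le_ofReal (by linarith)

lemma Arc_vol (r : ℕ) (Q B t : ℝ) (hQ : 0 ≤ Q) (hB : 0 ≤ B) :
    volume (Arc r Q B ∩ ucube r t) ≤ ENNReal.ofReal (Q * (6 * B) ^ r) := by
  have hsub : Arc r Q B ∩ ucube r t ⊆ ⋃ q ∈ Finset.Icc 1 ⌊Q⌋₊,
      Set.univ.pi fun _ : Fin r => {x : ℝ | x ∈ Set.Ioc t (t + 1) ∧ ∃ a : ℤ, |(q : ℝ) * x - a| ≤ B} := by
    rintro α ⟨⟨q, a, hq, hqQ, ha⟩, hα⟩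
    simp only [Set.mem_iUnion]
    refine ⟨q, ?_, ?_⟩
    · rw [Finset.mem_Icc, Nat.le_floor_iff hQ]
      exact ⟨hq, hqQ⟩
    · intro i _
      exact ⟨hα i trivial, a i, ha i⟩
  refine (measure_mono hsub).trans ((measure_biUnion_finset_le _ _).trans ?_)
  calc _ ≤ ∑ q ∈ Finset.Icc 1 ⌊Q⌋₊, ENNReal.ofReal ((6 * B) ^ r) := by
        apply Finset.sum_le_sum
        intro q hq
        rw [volume_pi_pi]
        calc _ ≤ ∏ _i : Fin r, ENNReal.ofReal (6 * B) :=
              Finset.prod_le_prod' fun i _ => arc1_vol t B hB q (Finset.mem_Icc.mp hq).1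
          _ = _ := by simp [ENNReal.ofReal_pow (show 0 ≤ 6 * B by positivity)]
    _ ≤ _ := by
        rw [Finset.sum_const, nsmul_eq_mul, ← ENNReal.ofReal_natCast, ← ENNReal.ofReal_mul (by positivity)]
        apply ENNReal.ofReal_le_ofReal
        gcongr
        simp only [Nat.card_Icc, Nat.add_sub_cancel]
        exact Nat.floor_le hQ

lemma continuous_Sexp {n r : ℕ} (f : Fin r → MvPolynomial (Fin n) ℤ) (aB bB : Fin n → ℝ) (P : ℝ) :
    Continuous (Sexp f aB bB P) := by
  unfold Sexp
  apply continuous_finsetSum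
  intro x _
  exact continuous_eC.comp (by fun_prop)

lemma norm_Sexp_le {n r : ℕ} (f : Fin r → MvPolynomial (Fin n) ℤ) (aB bB : Fin n → ℝ) (P : ℝ)
    (α : Fin r → ℝ) : ‖Sexp f aB bB P α‖ ≤ (boxPts aB bB P).card := by
  unfold Sexp
  exact norm_sum_eC_le _ _

lemma integrableOn_Sexp {n r : ℕ} (f : Fin r → MvPolynomial (Fin n) ℤ) (aB bB : Fin n → ℝ) (P t : ℝ) :
    IntegrableOn (Sexp f aB bB P) (ucube r t) := by
  apply Measure.integrableOn_of_bounded (M := (boxPts aB bB P).card)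
  · rw [volume_ucube]; simp
  · exact (continuous_Sexp f aB bB P).aestronglyMeasurable
  · exact Eventually.of_forall fun α => norm_Sexp_le f aB bB P α

/-- the Weyl alternative with constant `c` -/
def WeylP (n R k Δ : ℕ) (ε c : ℝ) : Prop :=
    ∀ (f : Fin (R + 1) → MvPolynomial (Fin n) ℤ) (Ct : ℝ), Sys n (R + 1) k Δ f Ct →
    ∀ aB bB : Fin n → ℝ, (∀ j, -1 ≤ aB j ∧ 0 < bB j - aB j ∧ bB j - aB j < 1 ∧ bB j ≤ 1) →
    ∀ P X : ℝ, 1 ≤ P → 1 ≤ X → X ≤ P ^ ((R + 1) * (k + 1)) →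
    ∀ α : Fin (R + 1) → ℝ,
    ‖Sexp f aB bB P α‖ ≤ c * P ^ ((n : ℝ) + ε) * X ^ (- kap n R k Δ) ∨
    α ∈ Arc (R + 1) (c * Ct ^ (R + 1) * X) (c * Ct ^ R * X / P ^ (k + 2))

lemma exists_WeylP (n R k Δ : ℕ) (hΔ : Δ ≤ n) (ε : ℝ) (hε : 0 < ε) : ∃ c : ℝ, 1 ≤ c ∧
    WeylP n R k Δ ε c := by
  obtain ⟨c, hc, h⟩ := weyl_P n R k Δ hΔ ε hε
  exact ⟨c, hc, h⟩

lemma Arc_mono {r : ℕ} {Q Q' B B' : ℝ} (hQ : Q ≤ Q') (hB : B ≤ B') : Arc r Q B ⊆ Arc r Q' B' := by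
  rintro α ⟨q, a, h1, h2, h3⟩
  exact ⟨q, a, h1, h2.trans hQ, fun i => (h3 i).trans hB⟩

theorem minor_arcs (n R k Δ : ℕ) (hΔ : Δ ≤ n) (ε c0 : ℝ) (hc0 : 1 ≤ c0) (hw : WeylP n R k Δ ε c0)
    (hκ : (R : ℝ) + 2 < kap n R k Δ) :
    ∃ c : ℝ, 1 ≤ c ∧
    ∀ (f : Fin (R + 1) → MvPolynomial (Fin n) ℤ) (Ct : ℝ), Sys n (R + 1) k Δ f Ct →
    ∀ aB bB : Fin n → ℝ, (∀ j, -1 ≤ aB j ∧ 0 < bB j - aB j ∧ bB j - aB j < 1 ∧ bB j ≤ 1) →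
    ∀ P : ℝ, 1 ≤ P → ∀ t X : ℝ, 1 ≤ X → X ≤ P ^ ((R + 1) * (k + 1)) →
    ∫ α in ucube (R + 1) t \ Arc (R + 1) (c0 * Ct ^ (R + 1) * X) (c0 * Ct ^ R * X / P ^ (k + 2)),
      ‖Sexp f aB bB P α‖ ≤
    c * (Ct ^ (R + 1) * (Ct ^ R) ^ (R + 1) * P ^ ((n : ℝ) + ε) / (P ^ (k + 2)) ^ (R + 1) *
        X ^ (-(kap n R k Δ - (R + 2))) +
      P ^ ((n : ℝ) + ε) * (P ^ ((R + 1) * (k + 1))) ^ (-kap n R k Δ)) := by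
  unfold WeylP at hw
  generalize kap n R k Δ = κ at *
  have hR0 : (0 : ℝ) ≤ R := by positivity
  obtain ⟨η, hη⟩ : ∃ η, η = κ - (R + 2) := ⟨_, rfl⟩
  have hη0 : 0 < η := by linarith
  have h2η : (2 : ℝ) ^ (-η) < 1 := Real.rpow_lt_one_of_one_lt_of_neg (by norm_num) (by linarith)
  obtain ⟨D, hD⟩ : ∃ D : ℝ, D = (1 - 2 ^ (-η))⁻¹ := ⟨_, rfl⟩
  have hD0 : 0 < D := by rw [hD]; exact inv_pos.mpr (by linarith)
  have hDeq : 1 + D * 2 ^ (-η) = D := by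
    rw [hD]
    have : (1 : ℝ) - 2 ^ (-η) ≠ 0 := by linarith
    field_simp
    ring
  obtain ⟨s, hs⟩ : ∃ s : ℝ, s = c0 * (2 * c0 * (12 * c0) ^ (R + 1)) := ⟨_, rfl⟩
  have hs0 : 0 < s := by rw [hs]; positivity
  have h2κ : (1 : ℝ) ≤ 2 ^ κ := Real.one_le_rpow (by norm_num) (by linarith)
  refine ⟨D * s + c0 * 2 ^ κ, by nlinarith [mul_pos hD0 hs0], fun f Ct hf aB bB hB P hP t X hX hXP => ?_⟩
  have hCt := hf.one
  have hCt0 : 0 < Ct := by linarith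
  have hP0 : 0 < P := by linarith
  have hw' := hw f Ct hf aB bB hB P
  set M := P ^ ((R + 1) * (k + 1)) with hM
  have hM0 : 0 < M := by positivity
  have hMκ0 : 0 < M ^ (-κ) := by positivity
  rw [← hη]
  set Y := P ^ ((n : ℝ) + ε) with hY
  have hY0 : 0 < Y := by positivity
  set V := Ct ^ (R + 1) * (Ct ^ R) ^ (R + 1) * Y / (P ^ (k + 2)) ^ (R + 1) with hV
  have hV0 : 0 < V := by positivity
  set U := ucube (R + 1) t with hU
  set N : ℝ → Set (Fin (R + 1) → ℝ) := fun X =>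
    Arc (R + 1) (c0 * Ct ^ (R + 1) * X) (c0 * Ct ^ R * X / P ^ (k + 2)) with hN
  have hNm : ∀ X, MeasurableSet (N X) := fun X => measurableSet_Arc _ _ _
  have hUm : MeasurableSet U := measurableSet_ucube _ _
  have hUv : volume U = 1 := volume_ucube _ _
  have hintS : IntegrableOn (fun α => ‖Sexp f aB bB P α‖) U := (integrableOn_Sexp f aB bB P t).norm
  -- sup bound integrals
  have hsup : ∀ (A : Set (Fin (R + 1) → ℝ)) (b v : ℝ), 0 ≤ b → 0 ≤ v → A ⊆ U → MeasurableSet A →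
      volume A ≤ ENNReal.ofReal v → (∀ α ∈ A, ‖Sexp f aB bB P α‖ ≤ b) →
      ∫ α in A, ‖Sexp f aB bB P α‖ ≤ b * v := by
    intro A b v hb hv hAU hAm hAv hAb
    have hfin : volume A < ⊤ := hAv.trans_lt ENNReal.ofReal_lt_top
    have h1 := norm_setIntegral_le_of_norm_le_const (μ := volume) (s := A) (C := b)
      (f := fun α => ‖Sexp f aB bB P α‖) hfin (fun α hα => by rw [norm_norm]; exact hAb α hα)
    refine (le_abs_self _).trans ?_
    rw [← Real.norm_eq_abs]
    refine h1.trans ?_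
    gcongr
    rw [measureReal_def]
    exact ENNReal.toReal_le_of_le_ofReal hv hAv
  have key : ∀ j : ℕ, ∀ X : ℝ, 1 ≤ X → X ≤ M → M < 2 ^ j * X →
      ∫ α in U \ N X, ‖Sexp f aB bB P α‖ ≤ D * s * (V * X ^ (-η)) + c0 * 2 ^ κ * (Y * M ^ (-κ)) := by
    intro j
    induction j with
    | zero => intro X _ h1 h2; rw [pow_zero, one_mul] at h2; linarith
    | succ j ih =>
      intro X hX hXM hj
      have hX0 : 0 < X := by linarith
      have hbd : ∀ α ∉ N X, ‖Sexp f aB bB P α‖ ≤ c0 * Y * X ^ (-κ) := by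
        intro α hα
        exact (hw' X hP hX hXM α).resolve_right hα
      rcases lt_or_ge M (2 * X) with h2 | h2
      · have h3 := hsup (U \ N X) (c0 * Y * X ^ (-κ)) 1 (by positivity) zero_le_one Set.sdiff_subset
          (hUm.diff (hNm X)) (by rw [ENNReal.ofReal_one, ← hUv]; exact measure_mono Set.sdiff_subset)
          (fun α hα => hbd α hα.2)
        have h4 : X ^ (-κ) ≤ 2 ^ κ * M ^ (-κ) := by
          rw [Real.rpow_neg hX0.le, Real.rpow_neg hM0.le, ← div_eq_mul_inv, le_div_iff₀ (by positivity),
            inv_mul_le_iff₀ (by positivity), mul_comm, ← Real.mul_rpow (by norm_num) hX0.le]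
          exact Real.rpow_le_rpow hM0.le h2.le (by linarith)
        calc _ ≤ _ := h3
          _ ≤ c0 * Y * (2 ^ κ * M ^ (-κ)) * 1 := by gcongr
          _ = 0 + c0 * 2 ^ κ * (Y * M ^ (-κ)) := by ring
          _ ≤ _ := by gcongr; positivity
      · have h3 := ih (2 * X) (by linarith) h2 (by rw [pow_succ] at hj; linarith)
        have hv := Arc_vol (R + 1) (c0 * Ct ^ (R + 1) * (2 * X)) (c0 * Ct ^ R * (2 * X) / P ^ (k + 2)) t
          (by positivity) (by positivity)
        have h4 := hsup ((N (2 * X) ∩ U) \ N X) (c0 * Y * X ^ (-κ)) _ (by positivity) (by positivity)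
          (fun α hα => hα.1.2) (((hNm _).inter hUm).diff (hNm X))
          ((measure_mono Set.sdiff_subset).trans hv) (fun α hα => hbd α hα.2)
        have h5 : U \ N X ⊆ (U \ N (2 * X)) ∪ ((N (2 * X) ∩ U) \ N X) := by
          rintro α ⟨h6, h7⟩
          by_cases h8 : α ∈ N (2 * X)
          · exact Or.inr ⟨⟨h8, h6⟩, h7⟩
          · exact Or.inl ⟨h6, h8⟩
        have h6 : ∫ α in U \ N X, ‖Sexp f aB bB P α‖ ≤
            ∫ α in (U \ N (2 * X)) ∪ ((N (2 * X) ∩ U) \ N X), ‖Sexp f aB bB P α‖ := by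
          apply setIntegral_mono_set
          · exact hintS.mono_set (Set.union_subset Set.sdiff_subset fun α hα => hα.1.2)
          · exact Eventually.of_forall fun α => norm_nonneg _
          · exact h5.eventuallyLE
        rw [setIntegral_union (Set.disjoint_left.mpr fun α h1 h2 => h1.2 h2.1.1)
          (((hNm _).inter hUm).diff (hNm X)) (hintS.mono_set Set.sdiff_subset)
          (hintS.mono_set fun α hα => hα.1.2)] at h6
        have e1 : (2 * X) ^ (-η) = 2 ^ (-η) * X ^ (-η) := Real.mul_rpow (by norm_num) hX0.le
        have e2 : X ^ (-κ) * (X * X ^ (R + 1)) = X ^ (-η) := by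
          rw [← pow_succ', ← Real.rpow_natCast, ← Real.rpow_add hX0, hη]
          congr 1; push_cast; ring
        have e3 : c0 * Y * X ^ (-κ) * (c0 * Ct ^ (R + 1) * (2 * X) *
            (6 * (c0 * Ct ^ R * (2 * X) / P ^ (k + 2))) ^ (R + 1)) = s * (V * X ^ (-η)) := by
          rw [← e2, hs, hV]
          have : 6 * (c0 * Ct ^ R * (2 * X) / P ^ (k + 2)) = (12 * c0) * Ct ^ R * X / P ^ (k + 2) := by ring
          rw [this, div_pow, mul_pow, mul_pow (12 * c0)]
          ring
        rw [e3] at h4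
        rw [e1] at h3
        calc _ ≤ _ := h6
          _ ≤ (D * s * (V * (2 ^ (-η) * X ^ (-η))) + c0 * 2 ^ κ * (Y * M ^ (-κ))) + s * (V * X ^ (-η)) :=
              add_le_add h3 h4
          _ = (1 + D * 2 ^ (-η)) * s * (V * X ^ (-η)) + c0 * 2 ^ κ * (Y * M ^ (-κ)) := by ring
          _ = _ := by rw [hDeq]
  obtain ⟨j, hj⟩ := pow_unbounded_of_one_lt M (show (1 : ℝ) < 2 by norm_num)
  have h1 := key j X hX hXP (lt_of_lt_of_le hj (le_mul_of_one_le_right (by positivity) hX))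
  have hX0 : 0 < X := by linarith
  calc _ ≤ _ := h1
    _ ≤ (D * s + c0 * 2 ^ κ) * (V * X ^ (-η)) + (D * s + c0 * 2 ^ κ) * (Y * M ^ (-κ)) := by
        gcongr
        · linarith [show 0 < c0 * 2 ^ κ by positivity]
        · linarith [mul_pos hD0 hs0]
    _ = _ := by ring

end Minor
end


-- part CA
section


section Circle

lemma int_eC_one (t : ℝ) (m : ℤ) : ∫ x in Set.Ioc t (t + 1), eC (x * m) = if m = 0 then 1 else 0 := by
  rw [← intervalIntegral.integral_of_le (by linarith)]
  split_ifs with h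
  · subst h
    simp [eC_zero]
  · have hm : (2 * (Real.pi : ℂ) * Complex.I * (m : ℂ)) ≠ 0 := by
      have : (m : ℂ) ≠ 0 := by exact_mod_cast h
      have h2 : (Real.pi : ℂ) ≠ 0 := by exact_mod_cast Real.pi_ne_zero
      simp [this, h2, Complex.I_ne_zero]
    have e : ∀ x : ℝ, eC (x * m) = Complex.exp ((2 * (Real.pi : ℂ) * Complex.I * (m : ℂ)) * x) := by
      intro x
      unfold eC
      congr 1
      push_cast; ring
    simp_rw [e]
    rw [integral_exp_mul_complex hm, ← e, ← e]
    have : eC ((t + 1) * m) = eC (t * m) := by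
      rw [add_mul, one_mul, eC_add_int]
    rw [this, sub_self, zero_div]

lemma int_eC_cube {r : ℕ} (t : ℝ) (m : Fin r → ℤ) :
    ∫ α in ucube r t, eC (∑ i, α i * m i) = if ∀ i, m i = 0 then 1 else 0 := by
  have h1 : ∀ α : Fin r → ℝ, eC (∑ i, α i * m i) = ∏ i, eC (α i * m i) := by
    intro α
    unfold eC
    rw [← Complex.exp_sum]
    congr 1
    push_cast
    rw [Finset.mul_sum]
  simp_rw [h1]
  unfold ucube
  rw [volume_pi, Measure.restrict_pi_pi,
    integral_fintype_prod_eq_prod (fun i (x : ℝ) => eC (x * m i))]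
  simp_rw [int_eC_one]
  split_ifs with h
  · apply Finset.prod_eq_one
    intro i _
    rw [if_pos (h i)]
  · push Not at h
    obtain ⟨i, hi⟩ := h
    apply Finset.prod_eq_zero (Finset.mem_univ i)
    rw [if_neg hi]

lemma Mcount_eq {n r : ℕ} (f : Fin r → MvPolynomial (Fin n) ℤ) (aB bB : Fin n → ℝ) (P t : ℝ)
    (ν : Fin r → ℤ) :
    (Mcount f aB bB P ν : ℂ) = ∫ α in ucube r t, Sexp f aB bB P α * eC (-(∑ i, α i * ν i)) := by
  have h1 : ∀ α : Fin r → ℝ, Sexp f aB bB P α * eC (-(∑ i, α i * ν i)) =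
      ∑ x ∈ boxPts aB bB P, eC (∑ i, α i * ((eval x (f i) - ν i : ℤ) : ℝ)) := by
    intro α
    unfold Sexp
    rw [Finset.sum_mul]
    apply Finset.sum_congr rfl
    intro x _
    rw [← eC_add]
    congr 1
    rw [← sub_eq_add_neg, ← Finset.sum_sub_distrib]
    apply Finset.sum_congr rfl
    intro i _
    push_cast; ring
  simp_rw [h1]
  rw [integral_finsetSum]
  · simp_rw [int_eC_cube]
    unfold Mcount
    rw [Finset.sum_ite, Finset.sum_const_zero, add_zero, Finset.sum_const, nsmul_eq_mul, mul_one]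
    simp only [sub_eq_zero]
  · intro x _
    apply Measure.integrableOn_of_bounded (M := 1)
    · rw [volume_ucube]; simp
    · exact (continuous_eC.comp (by fun_prop)).aestronglyMeasurable
    · exact Eventually.of_forall fun α => (norm_eC _).le

def res {r q : ℕ} (a : Fin r → Fin q) : Fin r → ℤ := fun i => ((a i : ℕ) : ℤ) + 1

lemma arc_cover {r : ℕ} (Q B : ℝ) (hB : 0 ≤ B) (hQB : 2 * Q * B < 1) :
    Arc r Q B ∩ ucube r B =
      ⋃ q ∈ Finset.Icc 1 ⌊Q⌋₊, ⋃ a ∈ resSet r q q, arcq B q (res a) := by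
  ext α
  simp only [Set.mem_iUnion, Set.mem_inter_iff, exists_prop]
  constructor
  · rintro ⟨⟨q, a, hq, hqQ, ha⟩, hα⟩
    have hq1 : (1 : ℝ) ≤ q := by exact_mod_cast hq
    have hqB : q * B ≤ Q * B := by gcongr
    have hBq : B ≤ q * B := le_mul_of_one_le_left hB hq1
    have hpos : ∀ i, 1 ≤ a i ∧ a i ≤ q := by
      intro i
      have h1 := hα i trivial
      have h2 := abs_le.mp (ha i)
      have h3 : q * B < q * α i := by have := h1.1; gcongr
      have h4 : q * α i ≤ q * (B + 1) := by have := h1.2; gcongr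
      constructor
      · have : (0 : ℝ) < a i := by linarith [h2.2]
        have : 0 < a i := by exact_mod_cast this
        omega
      · have : (a i : ℝ) < q + 1 := by linarith [h2.1]
        have : a i < q + 1 := by exact_mod_cast this
        omega
    set b : Fin r → ℕ := fun i => (a i).toNat with hb
    have hba : ∀ i, ((b i : ℕ) : ℤ) = a i := fun i => Int.toNat_of_nonneg (by linarith [(hpos i).1])
    have hb1 : ∀ i, 1 ≤ b i ∧ b i ≤ q := by
      intro i
      have := hpos i
      rw [← hba i] at this
      exact_mod_cast this
    set g := Nat.gcd (Finset.univ.gcd b) q with hg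
    have hg0 : 0 < g := Nat.gcd_pos_of_pos_right _ hq
    obtain ⟨q', hq'⟩ : g ∣ q := Nat.gcd_dvd_right _ _
    have hgb : ∀ i, ∃ b', b i = g * b' := fun i =>
      (Nat.gcd_dvd_left _ _).trans (Finset.gcd_dvd (Finset.mem_univ i))
    choose b' hb' using hgb
    have hq'0 : 1 ≤ q' := by
      rcases Nat.eq_zero_or_pos q' with h | h
      · rw [h, mul_zero] at hq'; omega
      · exact h
    have hb'1 : ∀ i, 1 ≤ b' i ∧ b' i ≤ q' := by
      intro i
      have := hb1 i
      rw [hb' i] at this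
      constructor
      · rcases Nat.eq_zero_or_pos (b' i) with h | h
        · rw [h, mul_zero] at this; omega
        · exact h
      · have h2 := this.2
        rw [hq'] at h2
        exact Nat.le_of_mul_le_mul_left h2 hg0
    have hcop : Nat.gcd (Finset.univ.gcd b') q' = 1 := by
      have h1 : Finset.univ.gcd b = g * Finset.univ.gcd b' := by
        have : b = fun i => g * b' i := funext hb'
        conv_lhs => rw [this]
        rw [Finset.gcd_mul_left]
        simp
      have h2 : g = g * Nat.gcd (Finset.univ.gcd b') q' := by
        conv_lhs => rw [hg, h1, hq']
        rw [Nat.gcd_mul_left]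
      exact Nat.eq_of_mul_eq_mul_left hg0 (by rw [mul_one]; exact h2.symm)
    have hg1 : (1 : ℝ) ≤ g := by exact_mod_cast hg0
    have hqg : (q : ℝ) = g * q' := by exact_mod_cast hq'
    refine ⟨q', ?_, fun i => ⟨b' i - 1, by have := hb'1 i; omega⟩, ?_, ?_⟩
    · rw [Finset.mem_Icc]
      refine ⟨hq'0, Nat.le_floor (le_trans ?_ hqQ)⟩
      rw [hqg]
      exact le_mul_of_one_le_left (by positivity) hg1
    · unfold resSet
      rw [Finset.mem_filter]
      refine ⟨Finset.mem_univ _, ?_⟩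
      have : (fun i => b' i - 1 + 1) = b' := by
        funext i
        have := hb'1 i; omega
      simp only [this]
      exact hcop
    · intro i
      have e : (res (fun i => (⟨b' i - 1, by have := hb'1 i; omega⟩ : Fin q')) i : ℝ) = b' i := by
        unfold res
        have := hb'1 i
        have : ((b' i - 1 : ℕ) : ℤ) + 1 = b' i := by omega
        exact_mod_cast this
      rw [e]
      have h1 := ha i
      have h2 : (a i : ℝ) = g * b' i := by
        rw [← hba i, hb' i]; push_cast; rfl
      rw [h2, hqg, mul_assoc, ← mul_sub, abs_mul, abs_of_nonneg (by linarith)] at h1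
      exact le_trans (le_mul_of_one_le_left (abs_nonneg _) hg1) h1
  · rintro ⟨q, hq, a, ha, hα⟩
    rw [Finset.mem_Icc] at hq
    have hq1 : (1 : ℝ) ≤ q := by exact_mod_cast hq.1
    have hqQ : (q : ℝ) ≤ Q := (Nat.le_floor_iff' (by omega)).mp hq.2
    have hqB : q * B ≤ Q * B := by gcongr
    have hBq : B ≤ q * B := le_mul_of_one_le_left hB hq1
    refine ⟨⟨q, res a, hq.1, hqQ, hα⟩, fun i _ => ?_⟩
    have h1 := abs_le.mp (hα i)
    have h2 : (1 : ℝ) ≤ (res a i : ℝ) := by unfold res; push_cast; linarith [show (0:ℝ) ≤ ((a i : ℕ) : ℝ) by positivity]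
    have h3 : (res a i : ℝ) ≤ q := by
      have : (a i : ℕ) + 1 ≤ q := (a i).2
      unfold res; exact_mod_cast this
    have hq0 : (0 : ℝ) < q := by linarith
    constructor
    · have : (q : ℝ) * B < q * α i := by linarith [h1.1]
      exact lt_of_mul_lt_mul_left this hq0.le
    · have : (q : ℝ) * α i ≤ q * (B + 1) := by linarith [h1.2]
      exact le_of_mul_le_mul_left this hq0

lemma arc_inj {r : ℕ} {Q B : ℝ} (hB : 0 ≤ B) (hQB : 2 * Q * B < 1) {q q' : ℕ} (hq : 1 ≤ q) (hq' : 1 ≤ q')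
    (hqQ : (q : ℝ) ≤ Q) (hqQ' : (q' : ℝ) ≤ Q) {a a' : Fin r → ℤ} (ha : Cop q a) (ha' : Cop q' a')
    {α : Fin r → ℝ} (h : α ∈ arcq B q a) (h' : α ∈ arcq B q' a') : q = q' ∧ a = a' := by
  have hQ0 : 0 ≤ Q := (Nat.cast_nonneg q).trans hqQ
  have key : ∀ i, (q' : ℤ) * a i = q * a' i := by
    intro i
    have h1 := h i
    have h2 := h' i
    have e : ((q' : ℝ) * a i - q * a' i) = q * (q' * α i - a' i) - q' * (q * α i - a i) := by ring
    have h3 : |(q' : ℝ) * a i - q * a' i| < 1 := by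
      rw [e]
      calc _ ≤ |(q : ℝ) * (q' * α i - a' i)| + |(q' : ℝ) * (q * α i - a i)| := abs_sub _ _
        _ ≤ Q * B + Q * B := by
            rw [abs_mul, abs_mul, Nat.abs_cast, Nat.abs_cast]
            gcongr
        _ < 1 := by linarith
    have h4 : |(q' : ℤ) * a i - q * a' i| < 1 := by exact_mod_cast h3
    have := Int.abs_lt_one_iff.mp h4
    linarith
  have d1 : q ∣ q' := ha q' fun i => ⟨a' i, key i⟩
  have d2 : q' ∣ q := ha' q fun i => ⟨a i, (key i).symm⟩
  have hqq := Nat.dvd_antisymm d1 d2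
  refine ⟨hqq, funext fun i => ?_⟩
  have := key i
  rw [← hqq] at this
  exact mul_left_cancel₀ (by exact_mod_cast (by omega : q ≠ 0)) this

end Circle
end


-- part CB
section


section Circle2

lemma arc_preimage {r : ℕ} (B : ℝ) (q : ℕ) (hq : 1 ≤ q) (hB : 0 ≤ B) (a : Fin r → ℤ) :
    (fun β : Fin r → ℝ => β + fun i => (a i : ℝ) / q) ⁻¹' arcq B q a = Metric.closedBall 0 (B / q) := by
  have hq0 : (0 : ℝ) < q := by exact_mod_cast hq
  rw [← setOf_abs_le _ (by positivity)]
  ext β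
  simp only [arcq, Set.mem_preimage, Set.mem_ofPred_eq, Pi.add_apply]
  apply forall_congr'
  intro i
  have e : (q : ℝ) * (β i + a i / q) - a i = q * β i := by field_simp; ring
  rw [e, abs_mul, Nat.abs_cast, le_div_iff₀ hq0, mul_comm]

open scoped Pointwise in
theorem arc_int (n r k : ℕ) (hn : 0 < n) : ∃ c : ℝ, 1 ≤ c ∧
    ∀ (f : Fin r → MvPolynomial (Fin n) ℤ) (C : ℝ), (∀ i, (f i).totalDegree ≤ k + 2) →
    0 ≤ C → (∀ i m, |((coeff m (f i) : ℤ) : ℝ)| ≤ C) →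
    ∀ aB bB : Fin n → ℝ, (∀ j, -1 ≤ aB j ∧ 0 < bB j - aB j ∧ bB j - aB j < 1 ∧ bB j ≤ 1) →
    ∀ P : ℝ, 1 ≤ P → ∀ (q : ℕ) (a : Fin r → ℤ) (ν : Fin r → ℤ) (B : ℝ), 1 ≤ q → 0 ≤ B →
    ‖(∫ α in arcq B q a, Sexp f aB bB P α * eC (-(∑ i, α i * ν i))) -
      ((q : ℂ) ^ n)⁻¹ * SgaussNu f q a ν * (((P : ℂ) ^ n * (((P : ℂ) ^ (k + 2)) ^ r)⁻¹) *
        Jint (topp k f) aB bB (fun i => (P ^ (k + 2))⁻¹ * (ν i : ℝ)) (P ^ (k + 2) * B / q))‖ ≤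
    c * (P ^ n / P) * q * (1 + C * (r * (B / q)) * P ^ (k + 2)) * (2 * (B / q)) ^ r := by
  obtain ⟨c, hc, h⟩ := major_approx n r k hn
  refine ⟨c, hc, fun f C hdeg hC0 hC aB bB hB P hP q a ν B hq hB0 => ?_⟩
  have hq0 : (0 : ℝ) < q := by exact_mod_cast hq
  have hP0 : 0 < P := by linarith
  have hρ : 0 ≤ B / q := by positivity
  set ρ := B / q with hρe
  set s : Fin r → ℝ := fun i => (a i : ℝ) / q with hs
  set F : (Fin r → ℝ) → ℂ := fun α => Sexp f aB bB P α * eC (-(∑ i, α i * ν i)) with hF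
  have hFc : Continuous F := (continuous_Sexp f aB bB P).mul (continuous_eC.comp (by fun_prop))
  have e1 : ∫ α in arcq B q a, F α = ∫ β in Metric.closedBall 0 ρ, F (β + s) := by
    rw [hρe, ← arc_preimage B q hq hB0 a]
    exact ((measurePreserving_add_right volume s).setIntegral_preimage_emb
      (measurableEmbedding_addRight s) F (arcq B q a)).symm
  set g := topp k f with hg
  set μ : Fin r → ℝ := fun i => (P ^ (k + 2))⁻¹ * (ν i : ℝ) with hμ
  set H : (Fin r → ℝ) → ℂ := fun γ => Iosc g (boxSet aB bB) γ * eC (-(∑ i, γ i * μ i)) with hH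
  have hHc : Continuous H := (continuous_Iosc _ _ _).mul (continuous_eC.comp (by fun_prop))
  have hPd : 0 < P ^ (k + 2) := by positivity
  have e2 : Jint g aB bB μ (P ^ (k + 2) * B / q) =
      ((P : ℂ) ^ (k + 2)) ^ r * ∫ β in Metric.closedBall 0 ρ, H (P ^ (k + 2) • β) := by
    rw [Measure.setIntegral_comp_smul_of_pos volume H _ hPd, smul_closedBall _ _ hρ, smul_zero,
      Real.norm_of_nonneg hPd.le, Module.finrank_fin_fun, Complex.real_smul]
    unfold Jint
    rw [setOf_abs_le _ (by positivity), mul_div_assoc]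
    push_cast
    rw [← mul_assoc, mul_inv_cancel₀, one_mul]
    exact pow_ne_zero _ (pow_ne_zero _ (by exact_mod_cast hP0.ne'))
  have hPne : (((P : ℂ) ^ (k + 2)) ^ r) ≠ 0 :=
    pow_ne_zero _ (pow_ne_zero _ (by exact_mod_cast hP0.ne'))
  have e3 : ((q : ℂ) ^ n)⁻¹ * SgaussNu f q a ν * (((P : ℂ) ^ n * (((P : ℂ) ^ (k + 2)) ^ r)⁻¹) *
        Jint g aB bB μ (P ^ (k + 2) * B / q)) =
      ∫ β in Metric.closedBall 0 ρ, (((q : ℂ) ^ n)⁻¹ * SgaussNu f q a ν * (P : ℂ) ^ n) *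
        H (P ^ (k + 2) • β) := by
    rw [integral_const_mul, e2]
    field_simp
  rw [e1, e3]
  have hcomp : IsCompact (Metric.closedBall (0 : Fin r → ℝ) ρ) := isCompact_closedBall _ _
  rw [← integral_sub]
  · have hv : volume (Metric.closedBall (0 : Fin r → ℝ) ρ) = ENNReal.ofReal ((2 * ρ) ^ r) := by
      rw [Real.volume_pi_closedBall _ hρ]; simp
    have h1 := norm_setIntegral_le_of_norm_le_const (μ := volume)
      (s := Metric.closedBall (0 : Fin r → ℝ) ρ)
      (C := c * (P ^ n / P) * q * (1 + C * (r * ρ) * P ^ (k + 2)))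
      (f := fun β => F (β + s) - (((q : ℂ) ^ n)⁻¹ * SgaussNu f q a ν * (P : ℂ) ^ n) *
        H (P ^ (k + 2) • β)) (by rw [hv]; exact ENNReal.ofReal_lt_top) (by
      intro β hβ
      have h2 := h f C hdeg hC0 hC aB bB hB P hP q a β hq
      have h3 : (fun i => (a i : ℝ) / q + β i) = β + s := by
        funext i; simp [hs, add_comm]
      rw [h3] at h2
      have hβi : ∀ i, |β i| ≤ ρ := by
        rw [← setOf_abs_le _ hρ] at hβ
        exact hβ
      have h4 : ∑ i, |β i| ≤ r * ρ := by
        calc _ ≤ ∑ _i : Fin r, ρ := Finset.sum_le_sum fun i _ => hβi i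
          _ = _ := by simp
      have e4 : F (β + s) - (((q : ℂ) ^ n)⁻¹ * SgaussNu f q a ν * (P : ℂ) ^ n) *
          H (P ^ (k + 2) • β) = (Sexp f aB bB P (β + s) - ((q : ℂ) ^ n)⁻¹ * Sgauss f q a * ((P : ℂ) ^ n *
        Iosc (fun i => homogeneousComponent (k + 2) (f i)) (boxSet aB bB) (fun i => P ^ (k + 2) * β i))) *
          eC (-(∑ i, (β + s) i * ν i)) := by
        have e5 : eC (-(∑ i, (β + s) i * ν i)) = eC (-(∑ i, (a i : ℝ) * (ν i : ℝ)) / q) *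
            eC (-(∑ i, (P ^ (k + 2) • β) i * μ i)) := by
          rw [← eC_add]
          congr 1
          rw [neg_div, Finset.sum_div, ← neg_add, ← Finset.sum_add_distrib]
          congr 1
          apply Finset.sum_congr rfl
          intro i _
          simp only [Pi.add_apply, Pi.smul_apply, smul_eq_mul, hs, hμ]
          field_simp
          ring
        simp only [hF, hH, SgaussNu]
        rw [e5]
        have e6 : Iosc (fun i => homogeneousComponent (k + 2) (f i)) (boxSet aB bB)
            (fun i => P ^ (k + 2) * β i) = Iosc g (boxSet aB bB) (P ^ (k + 2) • β) := rfl
        rw [e6]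
        ring
      rw [e4, norm_mul, norm_eC, mul_one]
      refine h2.trans ?_
      gcongr)
    refine h1.trans (le_of_eq ?_)
    rw [measureReal_def, hv, ENNReal.toReal_ofReal (by positivity)]
  · exact (hFc.comp (continuous_id.add continuous_const)).continuousOn.integrableOn_compact hcomp
  · exact (continuous_const.mul (hHc.comp (continuous_const_smul _))).continuousOn.integrableOn_compact hcomp

theorem circle (n r k : ℕ) (hn : 0 < n) : ∃ c : ℝ, 1 ≤ c ∧
    ∀ (f : Fin r → MvPolynomial (Fin n) ℤ) (C : ℝ), (∀ i, (f i).totalDegree ≤ k + 2) →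
    0 ≤ C → (∀ i m, |((coeff m (f i) : ℤ) : ℝ)| ≤ C) →
    ∀ aB bB : Fin n → ℝ, (∀ j, -1 ≤ aB j ∧ 0 < bB j - aB j ∧ bB j - aB j < 1 ∧ bB j ≤ 1) →
    ∀ P : ℝ, 1 ≤ P → ∀ (ν : Fin r → ℤ) (Q B : ℝ), 0 ≤ Q → 0 ≤ B → 2 * Q * B < 1 →
    ‖(Mcount f aB bB P ν : ℂ) - ((P : ℂ) ^ n * (((P : ℂ) ^ (k + 2)) ^ r)⁻¹) *
        ∑ q ∈ Finset.Icc 1 ⌊Q⌋₊, Aq f ν q *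
          Jint (topp k f) aB bB (fun i => (P ^ (k + 2))⁻¹ * (ν i : ℝ)) (P ^ (k + 2) * B / q)‖ ≤
    (∫ α in ucube r B \ Arc r Q B, ‖Sexp f aB bB P α‖) +
      c * (P ^ n / P) * (Q * (Q + C * B * P ^ (k + 2)) * B ^ r) := by
  obtain ⟨c, hc, h⟩ := arc_int n r k hn
  have h2r : (1 : ℝ) ≤ 2 ^ r * (r + 1) := by
    have h1 : (1 : ℝ) ≤ 2 ^ r := one_le_pow₀ (by norm_num)
    have h2 : (1 : ℝ) ≤ r + 1 := by linarith [show (0 : ℝ) ≤ r by positivity]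
    exact one_le_mul_of_one_le_of_one_le h1 h2
  refine ⟨c * (2 ^ r * (r + 1)), one_le_mul_of_one_le_of_one_le hc h2r,
    fun f C hdeg hC0 hC aB bB hB P hP ν Q B hQ0 hB0 hQB => ?_⟩
  have hP0 : 0 < P := by linarith
  have hh := h f C hdeg hC0 hC aB bB hB P hP
  set F : (Fin r → ℝ) → ℂ := fun α => Sexp f aB bB P α * eC (-(∑ i, α i * ν i)) with hF
  have hFc : Continuous F := (continuous_Sexp f aB bB P).mul (continuous_eC.comp (by fun_prop))
  have hFn : ∀ α, ‖F α‖ = ‖Sexp f aB bB P α‖ := fun α => by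
    rw [hF]; simp only; rw [norm_mul, norm_eC, mul_one]
  set U := ucube r B with hU
  have hFi : IntegrableOn F U := by
    apply Measure.integrableOn_of_bounded (M := (boxPts aB bB P).card)
    · rw [volume_ucube]; simp
    · exact hFc.aestronglyMeasurable
    · exact Eventually.of_forall fun α => by rw [hFn]; exact norm_Sexp_le f aB bB P α
  have hAm := measurableSet_Arc r Q B
  have hcov := arc_cover (r := r) Q B hB0 hQB
  have hM := Mcount_eq f aB bB P B ν
  have hsplit : ∫ α in U, F α = (∫ α in Arc r Q B ∩ U, F α) + ∫ α in U \ Arc r Q B, F α := by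
    have := integral_inter_add_sdiff hAm hFi
    rw [← this, Set.inter_comm]
  have hsubU : ∀ q ∈ Finset.Icc 1 ⌊Q⌋₊, ∀ a ∈ resSet r q q, arcq B q (res a) ⊆ U := by
    intro q hq a ha α hα
    have : α ∈ Arc r Q B ∩ U := by
      rw [hcov]
      simp only [Set.mem_iUnion]
      exact ⟨q, hq, a, ha, hα⟩
    exact this.2
  have hfl : ∀ q ∈ Finset.Icc 1 ⌊Q⌋₊, 1 ≤ q ∧ (q : ℝ) ≤ Q := by
    intro q hq
    rw [Finset.mem_Icc, Nat.le_floor_iff hQ0] at hq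
    exact hq
  have harc : ∫ α in Arc r Q B ∩ U, F α =
      ∑ q ∈ Finset.Icc 1 ⌊Q⌋₊, ∑ a ∈ resSet r q q, ∫ α in arcq B q (res a), F α := by
    rw [hcov, integral_biUnion_finset]
    · apply Finset.sum_congr rfl
      intro q hq
      rw [integral_biUnion_finset]
      · intro a _
        exact measurableSet_arcq _ _ _
      · intro a ha a' ha' hne
        refine Set.disjoint_left.mpr fun α h1 h2 => hne ?_
        have hq2 := hfl q hq
        have := (arc_inj hB0 hQB hq2.1 hq2.1 hq2.2 hq2.2 (cop_of_resSet ha) (cop_of_resSet ha') h1 h2).2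
        funext i
        have h3 : ((a i : ℕ) : ℤ) + 1 = ((a' i : ℕ) : ℤ) + 1 := congrFun this i
        apply Fin.ext
        omega
      · intro a ha
        exact hFi.mono_set (hsubU q hq a ha)
    · intro q _
      exact Finset.measurableSet_biUnion _ fun a _ => measurableSet_arcq _ _ _
    · intro q hq q' hq' hne
      refine Set.disjoint_left.mpr fun α h1 h2 => hne ?_
      simp only [Set.mem_iUnion] at h1 h2
      obtain ⟨a, ha, h1⟩ := h1
      obtain ⟨a', ha', h2⟩ := h2
      have hq2 := hfl q hq
      have hq2' := hfl q' hq'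
      exact (arc_inj hB0 hQB hq2.1 hq2'.1 hq2.2 hq2'.2 (cop_of_resSet ha) (cop_of_resSet ha') h1 h2).1
    · intro q hq
      apply hFi.mono_set
      intro α hα
      simp only [Set.mem_iUnion] at hα
      obtain ⟨a, ha, hα⟩ := hα
      exact hsubU q hq a ha hα
  set W : ℂ := (P : ℂ) ^ n * (((P : ℂ) ^ (k + 2)) ^ r)⁻¹ with hW
  set JJ : ℕ → ℂ := fun q => Jint (topp k f) aB bB (fun i => (P ^ (k + 2))⁻¹ * (ν i : ℝ))
    (P ^ (k + 2) * B / q) with hJJ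
  have hmain : W * ∑ q ∈ Finset.Icc 1 ⌊Q⌋₊, Aq f ν q * JJ q =
      ∑ q ∈ Finset.Icc 1 ⌊Q⌋₊, ∑ a ∈ resSet r q q,
        ((q : ℂ) ^ n)⁻¹ * SgaussNu f q (res a) ν * (W * JJ q) := by
    rw [Finset.mul_sum]
    apply Finset.sum_congr rfl
    intro q _
    unfold Aq
    rw [Finset.mul_sum, Finset.sum_mul, Finset.mul_sum]
    apply Finset.sum_congr rfl
    intro a _
    have : SgaussNu f q (fun i => ((a i : ℕ) : ℤ) + 1) ν = SgaussNu f q (res a) ν := rfl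
    rw [this]
    ring
  have hmaj : ‖(∫ α in Arc r Q B ∩ U, F α) - W * ∑ q ∈ Finset.Icc 1 ⌊Q⌋₊, Aq f ν q * JJ q‖ ≤
      c * (2 ^ r * (r + 1)) * (P ^ n / P) * (Q * (Q + C * B * P ^ (k + 2)) * B ^ r) := by
    rw [harc, hmain, ← Finset.sum_sub_distrib]
    simp_rw [← Finset.sum_sub_distrib]
    calc _ ≤ ∑ q ∈ Finset.Icc 1 ⌊Q⌋₊, c * (2 ^ r * (r + 1)) * (P ^ n / P) *
          ((Q + C * B * P ^ (k + 2)) * B ^ r) := by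
          refine (norm_sum_le _ _).trans (Finset.sum_le_sum fun q hq => ?_)
          obtain ⟨hq1, hqQ⟩ := hfl q hq
          have hq0 : (0 : ℝ) < q := by exact_mod_cast hq1
          have hcard : ((resSet r q q).card : ℝ) ≤ (q : ℝ) ^ r := by
            have : (resSet r q q).card ≤ q ^ r := by
              refine (Finset.card_filter_le _ _).trans (le_of_eq ?_)
              simp
            exact_mod_cast this
          calc _ ≤ ∑ a ∈ resSet r q q, c * (P ^ n / P) * q * (1 + C * (r * (B / q)) * P ^ (k + 2)) *
                (2 * (B / q)) ^ r := by
                refine (norm_sum_le _ _).trans (Finset.sum_le_sum fun a _ => ?_)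
                exact hh q (res a) ν B hq1 hB0
            _ = (resSet r q q).card * (c * (P ^ n / P) * q * (1 + C * (r * (B / q)) * P ^ (k + 2)) *
                (2 * (B / q)) ^ r) := by rw [Finset.sum_const, nsmul_eq_mul]
            _ ≤ (q : ℝ) ^ r * (c * (P ^ n / P) * q * (1 + C * (r * (B / q)) * P ^ (k + 2)) *
                (2 * (B / q)) ^ r) := by gcongr
            _ = c * (P ^ n / P) * (2 ^ r * B ^ r) * (q + r * (C * B * P ^ (k + 2))) := by
                rw [mul_pow, div_pow]
                field_simp
            _ ≤ c * (P ^ n / P) * (2 ^ r * B ^ r) * ((r + 1) * (Q + C * B * P ^ (k + 2))) := by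
                gcongr
                have h5 : 0 ≤ C * B * P ^ (k + 2) := by positivity
                have h6 : 0 ≤ (r : ℝ) * Q := by positivity
                have h7 : (r + 1) * (Q + C * B * P ^ (k + 2)) = r * Q + Q + r * (C * B * P ^ (k + 2)) +
                  C * B * P ^ (k + 2) := by ring
                rw [h7]
                linarith
            _ = _ := by ring
      _ = ⌊Q⌋₊ * (c * (2 ^ r * (r + 1)) * (P ^ n / P) * ((Q + C * B * P ^ (k + 2)) * B ^ r)) := by
          rw [Finset.sum_const, nsmul_eq_mul, Nat.card_Icc, Nat.add_sub_cancel]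
      _ ≤ Q * (c * (2 ^ r * (r + 1)) * (P ^ n / P) * ((Q + C * B * P ^ (k + 2)) * B ^ r)) := by
          gcongr
          exact Nat.floor_le hQ0
      _ = _ := by ring
  have hmin : ‖∫ α in U \ Arc r Q B, F α‖ ≤ ∫ α in U \ Arc r Q B, ‖Sexp f aB bB P α‖ := by
    refine (norm_integral_le_integral_norm _).trans (le_of_eq ?_)
    simp_rw [hFn]
  rw [hM, hsplit]
  calc _ = ‖(∫ α in U \ Arc r Q B, F α) + ((∫ α in Arc r Q B ∩ U, F α) -
        W * ∑ q ∈ Finset.Icc 1 ⌊Q⌋₊, Aq f ν q * JJ q)‖ := by congr 1; ring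
    _ ≤ _ := norm_add_le _ _
    _ ≤ _ := add_le_add hmin hmaj

end Circle2
end


-- part CC
section

lemma rp_le {Ct P a b a' b' : ℝ} (hC : 1 ≤ Ct) (hP : 1 ≤ P) (ha : a ≤ a') (hb : b ≤ b') :
    Ct ^ a * P ^ b ≤ Ct ^ a' * P ^ b' :=
  mul_le_mul (Real.rpow_le_rpow_of_exponent_le hC ha) (Real.rpow_le_rpow_of_exponent_le hP hb)
    (by positivity) (by positivity)

lemma G_ge {C Ct P a δ : ℝ} (hC : 1 ≤ Ct) (hP : 1 ≤ P) (hCC : Ct ≤ C) :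
    Ct ^ a * P ^ (-δ) ≤ C * Ct ^ (a - 1) * P ^ (-δ) := by
  have h0 : 0 < Ct := by linarith
  have : Ct ^ a = Ct * Ct ^ (a - 1) := by
    rw [Real.rpow_sub_one h0.ne']; field_simp
  rw [this]
  gcongr

lemma params (r k : ℕ) (η δ : ℝ) (hη : 0 < η) (hδ : δ < η / (η + 2 * (r + 1))) :
    ∃ ξ ε : ℝ, 0 < ξ ∧ 0 < ε ∧ ε ≤ 1 / 2 ∧ 2 * ε < η ∧ ξ * (η + 2 * (r + 1)) ≤ 1 ∧
      δ + ((k : ℝ) + 3) * ε ≤ ξ * η := by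
  have hr : (0 : ℝ) ≤ r := by positivity
  have hk : (0 : ℝ) ≤ k := by positivity
  have hs : 0 < η + 2 * (r + 1) := by positivity
  set e := η / (η + 2 * (r + 1)) - δ with he
  have he0 : 0 < e := by linarith
  refine ⟨1 / (η + 2 * (r + 1)), min (1 / 2) (min (η / 4) (e / (k + 3))), by positivity,
    by positivity, min_le_left _ _, ?_, ?_, ?_⟩
  · have : min (1 / 2) (min (η / 4) (e / (k + 3))) ≤ η / 4 :=
      (min_le_right _ _).trans (min_le_left _ _)
    linarith
  · rw [one_div_mul_cancel hs.ne']
  · have : min (1 / 2) (min (η / 4) (e / (k + 3))) ≤ e / (k + 3) :=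
      (min_le_right _ _).trans (min_le_right _ _)
    have h2 : ((k : ℝ) + 3) * min (1 / 2) (min (η / 4) (e / (k + 3))) ≤ (k + 3) * (e / (k + 3)) := by
      gcongr
    rw [mul_div_cancel₀ _ (by positivity)] at h2
    have h3 : 1 / (η + 2 * ((r : ℝ) + 1)) * η = η / (η + 2 * (r + 1)) := by ring
    rw [h3]
    linarith

/-- first minor arc term -/
lemma term1 (n R k : ℕ) {P Ct C κ ξ ε δ : ℝ} (hP : 1 ≤ P) (hC : 1 ≤ Ct) (hCC : Ct ≤ C)
    (hκ : (R : ℝ) + 2 < κ) (h : δ + ε ≤ ξ * (κ - (R + 2))) :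
    Ct ^ (R + 1) * (Ct ^ R) ^ (R + 1) * P ^ ((n : ℝ) + ε) / (P ^ (k + 2)) ^ (R + 1) *
        (P ^ ξ) ^ (-(κ - (R + 2))) ≤
    P ^ n / (P ^ (k + 2)) ^ (R + 1) *
      (C * Ct ^ (((R : ℝ) + 1) * κ + ((R : ℝ) + 1) ^ 2 - 1) * P ^ (-δ)) := by
  have hP0 : 0 < P := by linarith
  have hC0 : 0 < Ct := by linarith
  have hR : (0 : ℝ) ≤ R := by positivity
  have e1 : Ct ^ (R + 1) * (Ct ^ R) ^ (R + 1) = Ct ^ (((R : ℝ) + 1) ^ 2) := by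
    rw [← pow_mul, ← pow_add, ← Real.rpow_natCast]
    congr 1; push_cast; ring
  rw [e1, Real.rpow_add hP0, Real.rpow_natCast, ← Real.rpow_mul hP0.le]
  have e2 : Ct ^ (((R : ℝ) + 1) ^ 2) * (P ^ n * P ^ ε) / (P ^ (k + 2)) ^ (R + 1) *
      P ^ (ξ * -(κ - (R + 2))) = P ^ n / (P ^ (k + 2)) ^ (R + 1) *
      (Ct ^ (((R : ℝ) + 1) ^ 2) * P ^ (ε + ξ * -(κ - (R + 2)))) := by
    rw [Real.rpow_add hP0]; ring
  rw [e2]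
  refine mul_le_mul_of_nonneg_left ?_ (by positivity)
  refine (rp_le hC hP ?_ ?_).trans (G_ge hC hP hCC)
  · have : 0 ≤ ((R : ℝ) + 1) * κ := mul_nonneg (by linarith) (by linarith)
    linarith
  · linarith

/-- second minor arc term -/
lemma term2 (n R k : ℕ) {P Ct C κ ε δ : ℝ} (hP : 1 ≤ P) (hC : 1 ≤ Ct) (hCC : Ct ≤ C)
    (hκ : (R : ℝ) + 2 < κ) (h : δ + ε ≤ κ - (R + 2)) :
    P ^ ((n : ℝ) + ε) * (P ^ ((R + 1) * (k + 1))) ^ (-κ) ≤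
    P ^ n / (P ^ (k + 2)) ^ (R + 1) *
      (C * Ct ^ (((R : ℝ) + 1) * κ + ((R : ℝ) + 1) ^ 2 - 1) * P ^ (-δ)) := by
  have hP0 : 0 < P := by linarith
  have hC0 : 0 < Ct := by linarith
  have hR : (0 : ℝ) ≤ R := by positivity
  have hk : (0 : ℝ) ≤ k := by positivity
  have e2 : P ^ ((n : ℝ) + ε) * (P ^ ((R + 1) * (k + 1))) ^ (-κ) =
      P ^ n / (P ^ (k + 2)) ^ (R + 1) *
      (Ct ^ (0 : ℝ) * P ^ (ε + ((k : ℝ) + 2) * (R + 1) - (R + 1) * (k + 1) * κ)) := by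
    have : (P ^ (k + 2)) ^ (R + 1) = P ^ (((k : ℝ) + 2) * (R + 1)) := by
      rw [← pow_mul, ← Real.rpow_natCast]; push_cast; rfl
    rw [this, ← Real.rpow_natCast P ((R + 1) * (k + 1)), ← Real.rpow_natCast P n,
      ← Real.rpow_mul hP0.le, Real.rpow_zero, one_mul, ← Real.rpow_add hP0, ← Real.rpow_sub hP0,
      ← Real.rpow_add hP0]
    congr 1
    push_cast
    ring
  rw [e2]
  refine mul_le_mul_of_nonneg_left ?_ (by positivity)
  refine (rp_le hC hP ?_ ?_).trans (G_ge hC hP hCC)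
  · have : 0 ≤ ((R : ℝ) + 1) * κ := mul_nonneg (by linarith) (by linarith)
    positivity
  · obtain ⟨η, rfl⟩ : ∃ η, κ = η + (R + 2) := ⟨κ - (R + 2), by ring⟩
    have hη : 0 < η := by linarith
    have h1 : 0 ≤ (R : ℝ) * k * η := by positivity
    have h2 : 0 ≤ (R : ℝ) * η := by positivity
    have h3 : 0 ≤ (k : ℝ) * η := by positivity
    have h4 : 0 ≤ (R : ℝ) * R * k := by positivity
    have h5 : 0 ≤ (R : ℝ) * k := by positivity
    have h6 : 0 ≤ (R : ℝ) * R := by positivity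
    linarith

/-- major arc approximation term -/
lemma term3 (n R k : ℕ) {P Ct C κ ξ δ c0 : ℝ} (hP : 1 ≤ P) (hC : 1 ≤ Ct) (hCC : Ct ≤ C)
    (hc0 : 1 ≤ c0) (hκ : (R : ℝ) + 2 < κ) (h : δ + ξ * (R + 3) ≤ 1) :
    (P ^ n / P) * ((c0 * Ct ^ (R + 1) * P ^ ξ) * ((c0 * Ct ^ (R + 1) * P ^ ξ) +
      C * (c0 * Ct ^ R * P ^ ξ / P ^ (k + 2)) * P ^ (k + 2)) *
        (c0 * Ct ^ R * P ^ ξ / P ^ (k + 2)) ^ (R + 1)) ≤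
    2 * c0 ^ (R + 3) * (P ^ n / (P ^ (k + 2)) ^ (R + 1) *
      (C * Ct ^ (((R : ℝ) + 1) * κ + ((R : ℝ) + 1) ^ 2 - 1) * P ^ (-δ))) := by
  have hP0 : 0 < P := by linarith
  have hC0 : 0 < Ct := by linarith
  have hC1 : 0 < C := by linarith
  have hR : (0 : ℝ) ≤ R := by positivity
  have e1 : C * (c0 * Ct ^ R * P ^ ξ / P ^ (k + 2)) * P ^ (k + 2) = C * (c0 * Ct ^ R * P ^ ξ) := by
    field_simp
  rw [e1]
  have i1 : c0 * Ct ^ (R + 1) * P ^ ξ ≤ C * (c0 * Ct ^ R * P ^ ξ) := by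
    have : c0 * Ct ^ (R + 1) * P ^ ξ = Ct * (c0 * Ct ^ R * P ^ ξ) := by ring
    rw [this]; gcongr
  calc _ ≤ (P ^ n / P) * ((c0 * Ct ^ (R + 1) * P ^ ξ) * (C * (c0 * Ct ^ R * P ^ ξ) +
      C * (c0 * Ct ^ R * P ^ ξ)) * (c0 * Ct ^ R * P ^ ξ / P ^ (k + 2)) ^ (R + 1)) := by gcongr
    _ = 2 * c0 ^ (R + 3) * (P ^ n / (P ^ (k + 2)) ^ (R + 1) *
      (C * (Ct ^ ((R + 1) + R + R * (R + 1)) * (P⁻¹ * (P ^ ξ) ^ (R + 3))))) := by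
        rw [div_pow, mul_pow, mul_pow, ← pow_mul, pow_add Ct, pow_add Ct]
        field_simp
        ring
    _ ≤ _ := by
        have e3 : P⁻¹ * (P ^ ξ) ^ (R + 3) = P ^ (-1 + ξ * (R + 3)) := by
          rw [Real.rpow_add hP0, Real.rpow_neg_one, ← Real.rpow_natCast, ← Real.rpow_mul hP0.le]
          push_cast; rfl
        rw [e3, ← Real.rpow_natCast Ct, mul_assoc C]
        gcongr 2 * c0 ^ (R + 3) * (P ^ n / (P ^ (k + 2)) ^ (R + 1) * (C * ?_))
        apply rp_le hC hP
        · push_cast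
          have : ((R : ℝ) + 1) * 1 ≤ ((R : ℝ) + 1) * κ :=
            mul_le_mul_of_nonneg_left (by linarith) (by linarith)
          linarith
        · linarith

/-- singular series and integral truncation term -/
lemma term4 (n R k : ℕ) {P Ct C κ ξ ε δ : ℝ} (hP : 1 ≤ P) (hC : 1 ≤ Ct) (hCC : Ct ≤ C)
    (hCP : Ct ≤ P ^ (k + 2)) (hε : 0 ≤ ε) (hξ : ξ ≤ 1 / 2)
    (h : δ + ((k : ℝ) + 3) * ε ≤ ξ * (κ - (R + 2))) :
    P ^ n / (P ^ (k + 2)) ^ (R + 1) *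
      (Ct ^ (((R : ℝ) + 1) * κ) * (Ct ^ ε * (Ct ^ R) ^ (R + 1)) * Ct ^ (R + 1) *
          (P ^ ξ) ^ (-(κ - (R + 2) - 2 * ε))) ≤
    P ^ n / (P ^ (k + 2)) ^ (R + 1) *
      (C * Ct ^ (((R : ℝ) + 1) * κ + ((R : ℝ) + 1) ^ 2 - 1) * P ^ (-δ)) := by
  have hP0 : 0 < P := by linarith
  have hC0 : 0 < Ct := by linarith
  have e1 : Ct ^ (((R : ℝ) + 1) * κ + ((R : ℝ) + 1) ^ 2) =
      Ct ^ (((R : ℝ) + 1) * κ) * (Ct ^ R) ^ (R + 1) * Ct ^ (R + 1) := by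
    rw [Real.rpow_add hC0, mul_assoc, ← pow_mul, ← pow_add, ← Real.rpow_natCast Ct]
    congr 2; push_cast; ring
  have i1 : Ct ^ ε ≤ P ^ (((k : ℝ) + 2) * ε) := by
    rw [Real.rpow_mul hP0.le]
    have : P ^ ((k : ℝ) + 2) = P ^ (k + 2) := by rw [← Real.rpow_natCast]; push_cast; rfl
    rw [this]
    gcongr
  refine mul_le_mul_of_nonneg_left ?_ (by positivity)
  refine le_trans ?_ (G_ge hC hP hCC)
  rw [e1, ← Real.rpow_mul hP0.le]
  calc _ = Ct ^ (((R : ℝ) + 1) * κ) * (Ct ^ R) ^ (R + 1) * Ct ^ (R + 1) *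
        (Ct ^ ε * P ^ (ξ * -(κ - (R + 2) - 2 * ε))) := by ring
    _ ≤ Ct ^ (((R : ℝ) + 1) * κ) * (Ct ^ R) ^ (R + 1) * Ct ^ (R + 1) * P ^ (-δ) := by
        gcongr
        calc _ ≤ P ^ (((k : ℝ) + 2) * ε) * P ^ (ξ * -(κ - (R + 2) - 2 * ε)) := by gcongr
          _ = P ^ (((k : ℝ) + 2) * ε + ξ * -(κ - (R + 2) - 2 * ε)) := (Real.rpow_add hP0 _ _).symm
          _ ≤ _ := by
            apply Real.rpow_le_rpow_of_exponent_le hP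
            have : ξ * ε ≤ 1 / 2 * ε := mul_le_mul_of_nonneg_right hξ hε
            linarith

/-- raising the inequality of the degenerate case to a power -/
lemma caseB_pow {P Ct D s t u v : ℝ} (hP : 1 ≤ P) (hC : 1 ≤ Ct) (hD : 1 ≤ D) (hs : 0 < s)
    (ht : 0 ≤ t) (h : P ^ s ≤ D * Ct ^ v) (hu : v * t ≤ u * s) :
    P ^ t ≤ D ^ (t / s) * Ct ^ u := by
  have hP0 : 0 < P := by linarith
  have hC0 : 0 < Ct := by linarith
  have hts : 0 ≤ t / s := by positivity
  calc P ^ t = (P ^ s) ^ (t / s) := by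
        rw [← Real.rpow_mul hP0.le]; congr 1; field_simp
    _ ≤ (D * Ct ^ v) ^ (t / s) := by gcongr
    _ = D ^ (t / s) * Ct ^ (v * (t / s)) := by
        rw [Real.mul_rpow (by linarith) (by positivity), Real.rpow_mul hC0.le]
    _ ≤ _ := by
        gcongr
        rw [← mul_div_assoc, div_le_iff₀ hs]; exact hu


/-- the assembled asymptotic formula -/
theorem asm (n R k Δ : ℕ) (hn : 0 < n) (hΔ : Δ ≤ n) (δ : ℝ) (hδ : 0 < δ)
    (hκ : (R : ℝ) + 2 < kap n R k Δ)
    (hδκ : δ < (kap n R k Δ - (R + 2)) / (kap n R k Δ + (R + 2))) :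
    ∃ c : ℝ, 1 ≤ c ∧
    ∀ (f : Fin (R + 1) → MvPolynomial (Fin n) ℤ) (Ct C : ℝ), Sys n (R + 1) k Δ f Ct → Ct ≤ C →
    (∀ i m, |((coeff m (f i) : ℤ) : ℝ)| ≤ C) →
    ∀ aB bB : Fin n → ℝ, (∀ j, -1 ≤ aB j ∧ 0 < bB j - aB j ∧ bB j - aB j < 1 ∧ bB j ≤ 1) →
    ∀ (ν : Fin (R + 1) → ℤ) (P : ℝ), 1 ≤ P →
    ‖(Mcount f aB bB P ν : ℂ) - ((P : ℂ) ^ n * (((P : ℂ) ^ (k + 2)) ^ (R + 1))⁻¹) *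
        (singularSeries f ν *
          Jlim (topp k f) aB bB (fun i => (P ^ (k + 2))⁻¹ * (ν i : ℝ)))‖ ≤
    c * (P ^ n / (P ^ (k + 2)) ^ (R + 1) *
      (C * Ct ^ (((R : ℝ) + 1) * kap n R k Δ + ((R : ℝ) + 1) ^ 2 - 1) * P ^ (-δ))) := by
  have hR : (0 : ℝ) ≤ R := by positivity
  have hk : (0 : ℝ) ≤ k := by positivity
  obtain ⟨ξ, ε, hξ, hε, hε2, h2ε, hξη, hδξ⟩ := params (R + 1) k (kap n R k Δ - (R + 2)) δ
    (by linarith) (by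
      refine hδκ.trans_eq ?_
      congr 1
      push_cast
      ring)
  push_cast at hξη
  obtain ⟨c0, hc0, hw⟩ := exists_WeylP n R k Δ hΔ ε hε
  obtain ⟨c1, hc1, hminor⟩ := minor_arcs n R k Δ hΔ ε c0 hc0 hw hκ
  obtain ⟨c2, hc2, hmain⟩ := main_term n R k Δ hn hΔ ε hε (by linarith) (by linarith) c0 hc0
  obtain ⟨c3, hc3, hcirc⟩ := circle n (R + 1) k hn
  generalize kap n R k Δ = κ at *
  have hη : 0 < κ - (R + 2) := by linarith
  have hξ4 : ξ ≤ 1 / 4 := by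
    have h1 : ξ * 4 ≤ ξ * (κ - (R + 2) + 2 * (R + 1 + 1)) :=
      mul_le_mul_of_nonneg_left (by linarith) hξ.le
    linarith
  have hkε : 0 ≤ (k : ℝ) * ε := by positivity
  have hδ1 : δ + 2 * ξ * (R + 2) ≤ 1 := by linarith
  have hηξ : ξ * (κ - (R + 2)) ≤ κ - (R + 2) := by
    have := mul_le_mul_of_nonneg_right (show ξ ≤ 1 by linarith) hη.le
    linarith
  have hRξ : 0 ≤ ξ * R := by positivity
  set D : ℝ := 2 * c0 ^ 2 with hD
  have hD1 : 1 ≤ D := by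
    have : (1 : ℝ) ≤ c0 ^ 2 := one_le_pow₀ hc0
    linarith
  set s : ℝ := (k : ℝ) + 2 - 2 * ξ with hs
  have hs0 : 0 < s := by linarith
  set c4 : ℝ := 2 ^ n * D ^ ((((k : ℝ) + 2) * (R + 1) + δ) / s) with hc4
  set c5 : ℝ := c2 * D ^ (δ / s) with hc5
  have hc40 : 0 ≤ c4 := by positivity
  have hc50 : 0 ≤ c5 := by positivity
  set c6 : ℝ := c3 * (2 * c0 ^ (R + 3)) with hc6
  have hc60 : 0 ≤ c6 := by positivity
  refine ⟨c1 + c1 + c6 + c2 + c4 + c5, by linarith,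
    fun f Ct C hf hCC hC aB bB hB ν P hP => ?_⟩
  have hCt := hf.one
  have hP0 : 0 < P := by linarith
  have hC0 : 0 < Ct := by linarith
  have hC1 : 0 < C := by linarith
  have hX1 : 1 ≤ P ^ ξ := Real.one_le_rpow hP hξ.le
  obtain ⟨hm1, hm2⟩ := hmain f Ct hf aB bB hB ν (fun i => (P ^ (k + 2))⁻¹ * (ν i : ℝ))
  specialize hm2 (P ^ ξ) hX1
  set S : ℂ := singularSeries f ν *
    Jlim (topp k f) aB bB (fun i => (P ^ (k + 2))⁻¹ * (ν i : ℝ)) with hS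
  set W : ℂ := (P : ℂ) ^ n * (((P : ℂ) ^ (k + 2)) ^ (R + 1))⁻¹ with hW
  have hWn : ‖W‖ = P ^ n / (P ^ (k + 2)) ^ (R + 1) := by
    rw [hW, norm_mul, norm_inv, norm_pow, norm_pow, norm_pow, Complex.norm_real,
      Real.norm_of_nonneg hP0.le, div_eq_mul_inv]
  set G : ℝ := P ^ n / (P ^ (k + 2)) ^ (R + 1) *
      (C * Ct ^ (((R : ℝ) + 1) * κ + ((R : ℝ) + 1) ^ 2 - 1) * P ^ (-δ)) with hG
  have hG0 : 0 ≤ G := by positivity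
  by_cases hQB : 2 * (c0 * Ct ^ (R + 1) * P ^ ξ) * (c0 * Ct ^ R * P ^ ξ / P ^ (k + 2)) < 1
  · have hci := hcirc f C hf.deg hC1.le hC aB bB hB P hP ν (c0 * Ct ^ (R + 1) * P ^ ξ)
      (c0 * Ct ^ R * P ^ ξ / P ^ (k + 2)) (by positivity) (by positivity) hQB
    have eB : P ^ (k + 2) * (c0 * Ct ^ R * P ^ ξ / P ^ (k + 2)) = c0 * Ct ^ R * P ^ ξ := by
      field_simp
    rw [eB] at hci
    set T : ℂ := ∑ q ∈ Finset.Icc 1 ⌊c0 * Ct ^ (R + 1) * P ^ ξ⌋₊,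
          Aq f ν q * Jint (topp k f) aB bB (fun i => (P ^ (k + 2))⁻¹ * (ν i : ℝ))
            (c0 * Ct ^ R * P ^ ξ / q) with hT
    have hmi := hminor f Ct hf aB bB hB P hP (c0 * Ct ^ R * P ^ ξ / P ^ (k + 2)) (P ^ ξ) hX1 (by
      rw [← Real.rpow_natCast P]
      apply Real.rpow_le_rpow_of_exponent_le hP
      push_cast
      have : 0 ≤ (R : ℝ) * k := by positivity
      linarith)
    have hCP : Ct ≤ P ^ (k + 2) := by
      have h1 : Ct ^ (R + 1) * Ct ^ R * (P ^ ξ * P ^ ξ) * (c0 * c0) * 2 < P ^ (k + 2) := by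
        have h2 : 2 * (c0 * Ct ^ (R + 1) * P ^ ξ) * (c0 * Ct ^ R * P ^ ξ / P ^ (k + 2)) =
          Ct ^ (R + 1) * Ct ^ R * (P ^ ξ * P ^ ξ) * (c0 * c0) * 2 / P ^ (k + 2) := by ring
        rw [h2, div_lt_one (by positivity)] at hQB
        exact hQB
      have h3 : Ct ≤ Ct ^ (R + 1) * Ct ^ R * (P ^ ξ * P ^ ξ) * (c0 * c0) * 2 := by
        have h4 : Ct ^ 1 ≤ Ct ^ (R + 1) := pow_le_pow_right₀ hCt (by omega)
        rw [pow_one] at h4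
        have h5 : (1 : ℝ) ≤ Ct ^ R := one_le_pow₀ hCt
        have h6 := one_le_mul_of_one_le_of_one_le hX1 hX1
        have h7 := one_le_mul_of_one_le_of_one_le hc0 hc0
        calc Ct = Ct * 1 * 1 * 1 * 1 := by ring
          _ ≤ _ := by gcongr; norm_num
      linarith
    have t1 := term1 n R k (ξ := ξ) (ε := ε) (δ := δ) hP hCt hCC hκ (by linarith)
    have t2 := term2 n R k (ε := ε) (δ := δ) hP hCt hCC hκ (by linarith)
    have t3 := term3 n R k (ξ := ξ) (δ := δ) hP hCt hCC hc0 hκ (by linarith)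
    have t4 := term4 n R k (ξ := ξ) (ε := ε) (δ := δ) hP hCt hCC hCP hε.le (by linarith) hδξ
    rw [← hG] at t1 t2 t3 t4
    have hsplit : (Mcount f aB bB P ν : ℂ) - W * S =
      ((Mcount f aB bB P ν : ℂ) - W * T) - W * (S - T) := by ring
    have b1 : ‖W * (S - T)‖ ≤ c2 * G := by
      rw [norm_mul, hWn]
      calc _ ≤ P ^ n / (P ^ (k + 2)) ^ (R + 1) * _ :=
            mul_le_mul_of_nonneg_left hm2 (by positivity)
        _ = c2 * (P ^ n / (P ^ (k + 2)) ^ (R + 1) *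
          (Ct ^ (((R : ℝ) + 1) * κ) * (Ct ^ ε * (Ct ^ R) ^ (R + 1)) * Ct ^ (R + 1) *
          (P ^ ξ) ^ (-(κ - (R + 2) - 2 * ε)))) := by ring
        _ ≤ _ := mul_le_mul_of_nonneg_left t4 (by linarith)
    have b2 := hmi.trans (mul_le_mul_of_nonneg_left (add_le_add t1 t2) (by linarith))
    have b3 := mul_le_mul_of_nonneg_left t3 (show 0 ≤ c3 by linarith)
    rw [← mul_assoc c3, ← mul_assoc c3 (2 * c0 ^ (R + 3)), ← hc6] at b3
    have b4 : 0 ≤ c4 * G := by positivity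
    have b5 : 0 ≤ c5 * G := by positivity
    rw [hsplit]
    calc _ ≤ _ := norm_sub_le _ _
      _ ≤ (c1 * (G + G) + c6 * G) + c2 * G := add_le_add (hci.trans (add_le_add b2 b3)) b1
      _ ≤ _ := by linarith
  · push Not at hQB
    have hbase : P ^ s ≤ D * Ct ^ (2 * (R : ℝ) + 1) := by
      have h2 : 2 * (c0 * Ct ^ (R + 1) * P ^ ξ) * (c0 * Ct ^ R * P ^ ξ / P ^ (k + 2)) =
          D * (Ct ^ (R + 1) * Ct ^ R) * (P ^ ξ * P ^ ξ) / P ^ (k + 2) := by rw [hD]; ring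
      rw [h2, one_le_div (by positivity)] at hQB
      have e1 : Ct ^ (R + 1) * Ct ^ R = Ct ^ (2 * (R : ℝ) + 1) := by
        rw [← pow_add, ← Real.rpow_natCast]; congr 1; push_cast; ring
      have e2 : P ^ (k + 2) = P ^ s * (P ^ ξ * P ^ ξ) := by
        rw [← Real.rpow_add hP0, ← Real.rpow_add hP0, ← Real.rpow_natCast]
        congr 1; rw [hs]; push_cast; ring
      rw [e1, e2] at hQB
      exact le_of_mul_le_mul_right hQB (by positivity)
    have b4 : ‖(Mcount f aB bB P ν : ℂ)‖ ≤ c4 * G := by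
      rw [Complex.norm_natCast]
      have h1 : (Mcount f aB bB P ν : ℝ) ≤ (2 * P) ^ n := by
        refine le_trans ?_ (card_boxPts_le aB bB P hP hB)
        exact_mod_cast Finset.card_filter_le _ _
      refine h1.trans ?_
      have h2 := caseB_pow (t := ((k : ℝ) + 2) * (R + 1) + δ)
        (u := ((R : ℝ) + 1) * κ + ((R : ℝ) + 1) ^ 2) hP hCt hD1 hs0 (by positivity) hbase (by
          have g1 : ((R : ℝ) + 1) * (R + 2) ≤ (R + 1) * κ :=
            mul_le_mul_of_nonneg_left hκ.le (by linarith)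
          have g2 : (((R : ℝ) + 1) * (R + 2) + (R + 1) ^ 2) * s ≤
              (((R : ℝ) + 1) * κ + (R + 1) ^ 2) * s :=
            mul_le_mul_of_nonneg_right (by linarith) hs0.le
          refine le_trans ?_ g2
          rw [hs]
          have g3 : δ ≤ 1 := by
            have : 0 ≤ 2 * ξ * (R + 2) := by positivity
            linarith
          have g4 : (2 * (R : ℝ) + 1) * δ ≤ (2 * (R : ℝ) + 1) * 1 :=
            mul_le_mul_of_nonneg_left g3 (by linarith)
          have g5 : (2 * (R : ℝ) + 3) * (2 * ξ * (R + 2)) ≤ (2 * (R : ℝ) + 3) * 1 :=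
            mul_le_mul_of_nonneg_left (by linarith) (by linarith)
          have g6 : 0 ≤ (R : ℝ) * k := by positivity
          have g7 : 0 ≤ (R : ℝ) * ξ := by positivity
          linarith)
      have h3 := G_ge (a := ((R : ℝ) + 1) * κ + ((R : ℝ) + 1) ^ 2) (δ := δ) hCt hP hCC
      have e3 : P ^ n = P ^ n / (P ^ (k + 2)) ^ (R + 1) *
          (P ^ (((k : ℝ) + 2) * (R + 1) + δ) * P ^ (-δ)) := by
        rw [← Real.rpow_add hP0, add_neg_cancel_right]
        have : (P ^ (k + 2)) ^ (R + 1) = P ^ (((k : ℝ) + 2) * (R + 1)) := by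
          rw [← pow_mul, ← Real.rpow_natCast]; push_cast; rfl
        rw [← this]
        field_simp
      calc (2 * P) ^ n = 2 ^ n * (P ^ n / (P ^ (k + 2)) ^ (R + 1) *
          (P ^ (((k : ℝ) + 2) * (R + 1) + δ) * P ^ (-δ))) := by rw [mul_pow, ← e3]
        _ ≤ 2 ^ n * (P ^ n / (P ^ (k + 2)) ^ (R + 1) *
          ((D ^ ((((k : ℝ) + 2) * (R + 1) + δ) / s) *
            Ct ^ (((R : ℝ) + 1) * κ + ((R : ℝ) + 1) ^ 2)) * P ^ (-δ))) := by gcongr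
        _ = c4 * (P ^ n / (P ^ (k + 2)) ^ (R + 1) *
          (Ct ^ (((R : ℝ) + 1) * κ + ((R : ℝ) + 1) ^ 2) * P ^ (-δ))) := by rw [hc4]; ring
        _ ≤ _ := mul_le_mul_of_nonneg_left (mul_le_mul_of_nonneg_left h3 (by positivity)) hc40
    have b5 : ‖W * S‖ ≤ c5 * G := by
      rw [norm_mul, hWn]
      have h2 := caseB_pow (t := δ)
        (u := ((R : ℝ) + 1) - ε) hP hCt hD1 hs0 hδ.le hbase (by
          have g1 : ((R : ℝ) + 1 - ε) * (2 - 2 * ξ) ≤ ((R : ℝ) + 1 - ε) * s :=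
            mul_le_mul_of_nonneg_left (by linarith) (by linarith)
          have g2 : (2 * (R : ℝ) + 1) * (δ + 2 * ξ * (R + 2)) ≤ (2 * (R : ℝ) + 1) * 1 :=
            mul_le_mul_of_nonneg_left hδ1 (by linarith)
          have g3 : 0 ≤ ξ * ε := by positivity
          have g4 : 0 ≤ ξ * R * R := by positivity
          linarith)
      have h3 := G_ge (a := ((R : ℝ) + 1) * κ + ((R : ℝ) + 1) ^ 2) (δ := δ) hCt hP hCC
      have e3 : (1 : ℝ) = P ^ δ * P ^ (-δ) := by
        rw [← Real.rpow_add hP0, add_neg_cancel, Real.rpow_zero]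
      have e4 : Ct ^ (((R : ℝ) + 1) * κ + ((R : ℝ) + 1) ^ 2) =
          Ct ^ (((R : ℝ) + 1) * κ) * (Ct ^ ε * (Ct ^ R) ^ (R + 1)) * Ct ^ ((R : ℝ) + 1 - ε) := by
        rw [← pow_mul, ← Real.rpow_natCast Ct (R * (R + 1)), ← Real.rpow_add hC0, ← Real.rpow_add hC0,
          ← Real.rpow_add hC0]
        congr 1; push_cast; ring
      calc _ ≤ P ^ n / (P ^ (k + 2)) ^ (R + 1) *
            (c2 * Ct ^ (((R : ℝ) + 1) * κ) * (Ct ^ ε * (Ct ^ R) ^ (R + 1))) := by gcongr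
        _ = P ^ n / (P ^ (k + 2)) ^ (R + 1) *
            (c2 * Ct ^ (((R : ℝ) + 1) * κ) * (Ct ^ ε * (Ct ^ R) ^ (R + 1)) *
              (P ^ δ * P ^ (-δ))) := by rw [← e3, mul_one]
        _ ≤ P ^ n / (P ^ (k + 2)) ^ (R + 1) *
            (c2 * Ct ^ (((R : ℝ) + 1) * κ) * (Ct ^ ε * (Ct ^ R) ^ (R + 1)) *
              ((D ^ (δ / s) * Ct ^ ((R : ℝ) + 1 - ε)) * P ^ (-δ))) := by gcongr
        _ = c5 * (P ^ n / (P ^ (k + 2)) ^ (R + 1) *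
          (Ct ^ (((R : ℝ) + 1) * κ + ((R : ℝ) + 1) ^ 2) * P ^ (-δ))) := by rw [hc5, e4]; ring
        _ ≤ _ := mul_le_mul_of_nonneg_left (mul_le_mul_of_nonneg_left h3 (by positivity)) hc50
    have g1 : 0 ≤ c1 * G := by positivity
    have g2 : 0 ≤ c2 * G := by positivity
    have g6 : 0 ≤ c6 * G := by positivity
    calc _ ≤ _ := norm_sub_le _ _
      _ ≤ c4 * G + c5 * G := add_le_add b4 b5
      _ ≤ _ := by linarith

end

/-- **Theorem 2.15 (quantitative asymptotic for `M(P,ν)`).** -/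
theorem quantitative_asymptotic (n R d : ℕ) (hR : 0 < R) (hd : 2 ≤ d) (hnR : R < n)
    (δ : ℝ) (hδ : 0 < δ) :
    ∃ c : ℝ, 0 < c ∧
      ∀ (f : Fin R → MvPolynomial (Fin n) ℤ),
        (∀ i, (f i).totalDegree = d) →
        ∀ (aB bB : Fin n → ℝ),
        (∀ j, -1 ≤ aB j ∧ 0 < bB j - aB j ∧ bB j - aB j < 1 ∧ bB j ≤ 1) →
        ∀ C Ct K : ℝ, 1 ≤ C → 1 ≤ Ct →
        coeffMax f C →
        coeffMax (fun i => MvPolynomial.homogeneousComponent d (f i)) Ct →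
        KofDelta n R d (fun i => MvPolynomial.homogeneousComponent d (f i)) K →
        BB R d < K →
        δ < (K - BB R d) / (K + BB R d) →
        ∀ (ν : Fin R → ℤ) (P : ℝ), 2 ≤ P →
          ‖(Mcount f aB bB P ν : ℂ) -
              ((P ^ ((n : ℝ) - (R : ℝ) * (d : ℝ)) : ℝ) : ℂ) * singularSeries f ν *
                Jlim (fun i => MvPolynomial.homogeneousComponent d (f i)) aB bB
                  (fun i => (P ^ d)⁻¹ * (ν i : ℝ))‖ ≤
            c * C * Ct ^ (K / ((d : ℝ) - 1) + (R : ℝ) ^ 2 - 1) *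
              P ^ ((n : ℝ) - (R : ℝ) * (d : ℝ) - δ) := by
  obtain ⟨R, rfl⟩ : ∃ R', R = R' + 1 := ⟨R - 1, by omega⟩
  obtain ⟨k, rfl⟩ : ∃ k, d = k + 2 := ⟨d - 2, by omega⟩
  have hn : 0 < n := by omega
  have hch : ∀ Δ : ℕ, ∃ c : ℝ, 1 ≤ c ∧ (Δ ≤ n → (R : ℝ) + 2 < kap n R k Δ →
      δ < (kap n R k Δ - (R + 2)) / (kap n R k Δ + (R + 2)) →
    ∀ (f : Fin (R + 1) → MvPolynomial (Fin n) ℤ) (Ct C : ℝ), Sys n (R + 1) k Δ f Ct → Ct ≤ C →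
    (∀ i m, |((coeff m (f i) : ℤ) : ℝ)| ≤ C) →
    ∀ aB bB : Fin n → ℝ, (∀ j, -1 ≤ aB j ∧ 0 < bB j - aB j ∧ bB j - aB j < 1 ∧ bB j ≤ 1) →
    ∀ (ν : Fin (R + 1) → ℤ) (P : ℝ), 1 ≤ P →
    ‖(Mcount f aB bB P ν : ℂ) - ((P : ℂ) ^ n * (((P : ℂ) ^ (k + 2)) ^ (R + 1))⁻¹) *
        (singularSeries f ν *
          Jlim (topp k f) aB bB (fun i => (P ^ (k + 2))⁻¹ * (ν i : ℝ)))‖ ≤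
    c * (P ^ n / (P ^ (k + 2)) ^ (R + 1) *
      (C * Ct ^ (((R : ℝ) + 1) * kap n R k Δ + ((R : ℝ) + 1) ^ 2 - 1) * P ^ (-δ)))) := by
    intro Δ
    by_cases h : Δ ≤ n ∧ (R : ℝ) + 2 < kap n R k Δ ∧
      δ < (kap n R k Δ - (R + 2)) / (kap n R k Δ + (R + 2))
    · obtain ⟨c, hc, hh⟩ := asm n R k Δ hn h.1 δ hδ h.2.1 h.2.2
      exact ⟨c, hc, fun _ _ _ => hh⟩
    · exact ⟨1, le_rfl, fun h1 h2 h3 => absurd ⟨h1, h2, h3⟩ h⟩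
  choose c hc1 hc using hch
  have hcs : ∀ Δ ≤ n, c Δ ≤ ∑ Δ ∈ Finset.range (n + 1), c Δ := fun Δ h =>
    Finset.single_le_sum (f := c) (fun i _ => by linarith [hc1 i]) (Finset.mem_range.mpr (by omega))
  refine ⟨∑ Δ ∈ Finset.range (n + 1), c Δ, ?_, ?_⟩
  · linarith [hcs 0 (by omega), hc1 0]
  intro f hdeg aB bB hB C Ct K hC1 hCt1 hC hCt hK hBK hδK ν P hP
  obtain ⟨Δ, hΔ, hKe⟩ := hK
  have hR0 : (0 : ℝ) ≤ R := by positivity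
  have hk0 : (0 : ℝ) ≤ k := by positivity
  have hP0 : 0 < P := by linarith
  have hBBe : BB (R + 1) (k + 2) = ((R : ℝ) + 1) * ((k : ℝ) + 1) * (R + 2) := by
    unfold BB; push_cast; ring
  have hm0 : 0 < ((R : ℝ) + 1) * ((k : ℝ) + 1) := by positivity
  have hKkap : K = ((R : ℝ) + 1) * ((k : ℝ) + 1) * kap n R k Δ := by
    have h1 : K = KK n k Δ := by rw [hKe]; rfl
    rw [h1, kap]
    push_cast
    field_simp
  have hΔn : Δ ≤ n := by
    by_contra hlt
    push Not at hlt
    have h1 : (n : ℝ) - Δ ≤ 0 := by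
      have : (n : ℝ) ≤ Δ := by exact_mod_cast hlt.le
      linarith
    have h2 : K ≤ 0 := by rw [hKe]; exact div_nonpos_of_nonpos_of_nonneg h1 (by positivity)
    have h3 : 0 ≤ BB (R + 1) (k + 2) := by rw [hBBe]; positivity
    linarith
  have hκ : (R : ℝ) + 2 < kap n R k Δ := by
    rw [hBBe, hKkap] at hBK
    exact lt_of_mul_lt_mul_left hBK hm0.le
  have hδκ : δ < (kap n R k Δ - (R + 2)) / (kap n R k Δ + (R + 2)) := by
    rw [hBBe, hKkap, ← mul_sub, ← mul_add, mul_div_mul_left _ _ hm0.ne'] at hδK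
    exact hδK
  have hcoe : ∀ i m, |((coeff m (f i) : ℤ) : ℝ)| ≤ C := fun i m => hC.2 ⟨i, m, rfl⟩
  have hCC : Ct ≤ C := by
    obtain ⟨i, m, hm⟩ := hCt.1
    rw [hm]
    simp only [coeff_homogeneousComponent]
    split_ifs
    · exact hcoe i m
    · simp; linarith
  have hsys : Sys n (R + 1) k Δ f Ct := by
    refine ⟨fun i => (hdeg i).le, hCt1, fun i m hm => ?_, fun b hb => ?_⟩
    · apply hCt.2
      refine ⟨i, m, ?_⟩
      simp only [coeff_homogeneousComponent]
      rw [if_pos hm]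
    · rw [hΔ]
      unfold birchDelta
      exact le_iSup₂_of_le b hb le_rfl
  have hmain := hc Δ hΔn hκ hδκ f Ct C hsys hCC hcoe aB bB hB ν P (by linarith)
  have eW : P ^ ((n : ℝ) - ((R + 1 : ℕ) : ℝ) * ((k + 2 : ℕ) : ℝ)) =
      P ^ n / (P ^ (k + 2)) ^ (R + 1) := by
    rw [Real.rpow_sub hP0, Real.rpow_natCast, ← pow_mul, ← Real.rpow_natCast P ((k + 2) * (R + 1))]
    congr 2
    push_cast
    ring
  have eW2 : P ^ ((n : ℝ) - ((R + 1 : ℕ) : ℝ) * ((k + 2 : ℕ) : ℝ) - δ) =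
      P ^ n / (P ^ (k + 2)) ^ (R + 1) * P ^ (-δ) := by
    rw [sub_eq_add_neg _ δ, Real.rpow_add hP0, eW]
  have eK : K / (((k + 2 : ℕ) : ℝ) - 1) + ((R + 1 : ℕ) : ℝ) ^ 2 - 1 =
      ((R : ℝ) + 1) * kap n R k Δ + ((R : ℝ) + 1) ^ 2 - 1 := by
    rw [hKkap]
    push_cast
    have : (k : ℝ) + 2 - 1 = k + 1 := by ring
    rw [this]
    field_simp
  rw [eW, eW2, eK]
  have eC2 : ((P ^ n / (P ^ (k + 2)) ^ (R + 1) : ℝ) : ℂ) =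
      (P : ℂ) ^ n * (((P : ℂ) ^ (k + 2)) ^ (R + 1))⁻¹ := by
    push_cast; rw [div_eq_mul_inv]
  rw [eC2, mul_assoc _ (singularSeries f ν)]
  refine hmain.trans ?_
  have hC0 : 0 < Ct := by linarith
  calc _ ≤ (∑ Δ ∈ Finset.range (n + 1), c Δ) * (P ^ n / (P ^ (k + 2)) ^ (R + 1) *
      (C * Ct ^ (((R : ℝ) + 1) * kap n R k Δ + ((R : ℝ) + 1) ^ 2 - 1) * P ^ (-δ))) :=
        mul_le_mul_of_nonneg_right (hcs Δ hΔn) (by positivity)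
    _ = _ := by ring

end
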